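/- arXiv:math/0603356 — 3 statements merged into one kernel-verified Lean document; each statement's English description precedes it below -/
import Mathlib

section
/- Let A be a right noetherian ring. Then the dimension of the bounded derived category of finitely generated right A-modules is at most the global dimension of A: dim D^b(mod A) ≤ gldim A, where gldim A is the supremum of the projective dimensions of all right A-modules. -/
/-!
Dimension of triangulated categories (Rouquier): the bounded derived category of
finitely generated modules over a finitely generated commutative algebra over a
perfect field has finite dimension.
-/

open CategoryTheory CategoryTheory.Limits CategoryTheory.Pretriangulated

section TriangulatedDimension

variable (C : Type*) [Category C] [HasZeroObject C] [Preadditive C] [HasShift C ℤ]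
  [∀ n : ℤ, (shiftFunctor C n).Additive] [Pretriangulated C]

/-- `X` is a direct summand (retract) of `Z`. -/
def IsRetract (X Z : C) : Prop := ∃ (s : X ⟶ Z) (r : Z ⟶ X), s ≫ r = 𝟙 X

/-- `I₁ * I₂` : the smallest class of objects, closed under direct summands, containing
every object `Z` fitting in a distinguished triangle `X₁ → Z → X₂ → X₁[1]` with
`X₁ ∈ I₁` and `X₂ ∈ I₂`. -/
def starSets (I₁ I₂ : Set C) : Set C :=
  {X | ∃ (X₁ Z X₂ : C) (f : X₁ ⟶ Z) (g : Z ⟶ X₂) (h : X₂ ⟶ X₁⟦(1 : ℤ)⟧),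
    Triangle.mk f g h ∈ (distTriang C) ∧ X₁ ∈ I₁ ∧ X₂ ∈ I₂ ∧ IsRetract C X Z}

/-- `⟨M⟩` : the smallest class of objects of `C` containing `M` and closed under finite
direct sums, direct summands and shifts in both directions. -/
inductive gen (M : C) : C → Prop
  | base : gen M M
  | sum {X Y Z : C} (i : X ⟶ Z) (p : Z ⟶ X) (j : Y ⟶ Z) (q : Z ⟶ Y) :
      gen M X → gen M Y → i ≫ p = 𝟙 X → j ≫ q = 𝟙 Y → i ≫ q = 0 → j ≫ p = 0 →
      p ≫ i + q ≫ j = 𝟙 Z → gen M Z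
  | shift {X : C} (n : ℤ) : gen M X → gen M (X⟦n⟧)
  | retract {X Z : C} : gen M Z → IsRetract C X Z → gen M X

/-- The classes `⟨M⟩ᵢ` : `⟨M⟩₀ = {0}` and `⟨M⟩ᵢ₊₁ = ⟨M⟩ᵢ * ⟨M⟩`. -/
def level (M : C) : ℕ → Set C
  | 0 => {X | IsZero X}
  | i + 1 => starSets C (level M i) {X | gen C M X}

/-- `dimLE S d` : the (triangulated) subcategory with class of objects `S` has dimension
at most `d`, i.e. there is an object `M` of `S` with `⟨M⟩_{d+1} = S`. -/
def dimLE (S : Set C) (d : ℕ) : Prop := ∃ M ∈ S, level C M (d + 1) = S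

/-- The dimension of the (triangulated) subcategory with class of objects `S`, as an
element of `ℕ∞` : the least `d` such that some object generates `S` in `d + 1` steps,
and `∞` if there is no such `d`. -/
noncomputable def trdim (S : Set C) : ℕ∞ := sInf ((↑) '' {d : ℕ | dimLE C S d})

end TriangulatedDimension

variable (A : Type) [Ring A]

noncomputable instance moduleCatHasDerivedCategory :
    HasDerivedCategory (ModuleCat.{0} A) :=
  HasDerivedCategory.standard _

/-- The class of objects of the bounded derived category `D^b(mod A)` of finitely
generated `A`-modules, realized inside the derived category of `A`-modules as the
complexes with bounded, finitely generated homology. -/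
def Db : Set (DerivedCategory (ModuleCat.{0} A)) :=
  {X | (∃ a b : ℤ, ∀ n : ℤ, n < a ∨ b < n →
      IsZero ((DerivedCategory.homologyFunctor (ModuleCat.{0} A) n).obj X)) ∧
    ∀ n : ℤ, Module.Finite A ((DerivedCategory.homologyFunctor (ModuleCat.{0} A) n).obj X)}

section ProjDim

/-- `pdLE B d M` says that the left `B`-module `M` has projective dimension at most `d`,
i.e. there is a projective resolution `0 → P_d → ⋯ → P_0 → M → 0`. -/
def pdLE (B : Type) [Ring B] : ℕ → (M : Type) → [AddCommGroup M] → [Module B M] → Prop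
  | 0, M, _, _ => Module.Projective B M
  | d + 1, M, _, _ => ∃ (P : Type) (_ : AddCommGroup P) (_ : Module B P)
      (f : P →ₗ[B] M), Function.Surjective f ∧ Module.Projective B P ∧
        pdLE B d (LinearMap.ker f)

/-- `gldimLE B d` says that the global dimension of `B` is at most `d` : every
`B`-module has projective dimension at most `d`. -/
def gldimLE (B : Type) [Ring B] (d : ℕ) : Prop :=
  ∀ (M : Type) (_ : AddCommGroup M) (_ : Module B M), pdLE B d M

/-- The global dimension of a ring `B`, as an element of `ℕ∞`:
the supremum of the projective dimensions of all `B`-modules. -/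
noncomputable def gldim (B : Type) [Ring B] : ℕ∞ :=
  sInf ((↑) '' {d : ℕ | gldimLE B d})

end ProjDim

section Homology

open DerivedCategory ZeroObject

variable {𝒜 : Type*} [Category 𝒜] [Abelian 𝒜] [HasDerivedCategory 𝒜]

/-- The `n`-th homology in the derived category is, naturally, the `n`-th homology of complexes. -/
lemma exists_homologyFunctor_obj_Q_iso (n : ℤ) :
    ∃ β : ∀ L : CochainComplex 𝒜 ℤ, (homologyFunctor 𝒜 n).obj (Q.obj L) ≅ L.homology n,
      ∀ {L L' : CochainComplex 𝒜 ℤ} (f : L ⟶ L'),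
        (homologyFunctor 𝒜 n).map (Q.map f) ≫ (β L').hom =
          (β L).hom ≫ HomologicalComplex.homologyMap f n :=
  ⟨fun L => (homologyFunctorFactors 𝒜 n).app L,
    fun f => (homologyFunctorFactors 𝒜 n).hom.naturality f⟩

/-- A map from a projective object to the `n`-th homology of `X` is induced by a morphism from
the object placed in degree `n`. -/
lemma exists_hom_singleFunctor_obj (X : DerivedCategory 𝒜) (n : ℤ) (P : 𝒜) [Projective P]
    (φ : P ⟶ (homologyFunctor 𝒜 n).obj X) :
    ∃ (f : (singleFunctor 𝒜 n).obj P ⟶ X)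
      (e : P ≅ (homologyFunctor 𝒜 n).obj ((singleFunctor 𝒜 n).obj P)),
      e.hom ≫ (homologyFunctor 𝒜 n).map f = φ := by
  let K : CochainComplex 𝒜 ℤ := Q.objPreimage X
  let α : Q.obj K ≅ X := Q.objObjPreimageIso X
  obtain ⟨β, hβ⟩ := exists_homologyFunctor_obj_Q_iso (𝒜 := 𝒜) n
  let ψ : P ⟶ K.homology n := φ ≫ (homologyFunctor 𝒜 n).map α.inv ≫ (β K).hom
  let z : P ⟶ K.cycles n := Projective.factorThru ψ (K.homologyπ n)
  have hz : z ≫ K.homologyπ n = ψ := Projective.factorThru_comp _ _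
  let S : CochainComplex 𝒜 ℤ := (HomologicalComplex.single 𝒜 (ComplexShape.up ℤ) n).obj P
  let g : S ⟶ K := HomologicalComplex.mkHomFromSingle (z ≫ K.iCycles n) (by simp)
  let e₁ : P ≅ S.homology n :=
    (HomologicalComplex.singleObjHomologySelfIso (ComplexShape.up ℤ) n P).symm
  have hg : e₁.hom ≫ HomologicalComplex.homologyMap g n = ψ := by
    rw [← hz]
    have h₁ : e₁.hom = (HomologicalComplex.singleObjCyclesSelfIso _ n P).inv ≫
        S.homologyπ n := (HomologicalComplex.singleObjCyclesSelfIso_inv_homologyπ _ n P).symm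
    rw [h₁, Category.assoc, HomologicalComplex.homologyπ_naturality, ← Category.assoc]
    congr 1
    rw [← cancel_mono (K.iCycles n), Category.assoc, HomologicalComplex.cyclesMap_i,
      ← Category.assoc]
    erw [HomologicalComplex.singleObjCyclesSelfIso_inv_iCycles]
    simp [g]
  suffices ∃ (f : Q.obj S ⟶ X) (e : P ≅ (homologyFunctor 𝒜 n).obj (Q.obj S)),
      e.hom ≫ (homologyFunctor 𝒜 n).map f = φ from this
  refine ⟨Q.map g ≫ α.hom, e₁ ≪≫ (β S).symm, ?_⟩
  rw [← cancel_mono ((homologyFunctor 𝒜 n).map α.inv), ← cancel_mono (β K).hom]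
  calc _ = e₁.hom ≫ (β S).inv ≫ (homologyFunctor 𝒜 n).map (Q.map g) ≫ (β K).hom := by
        simp
    _ = ψ := by rw [hβ, Iso.inv_hom_id_assoc, hg]
    _ = _ := (Category.assoc _ _ _).symm

lemma isZero_of_isZero_homology (X : DerivedCategory 𝒜)
    (hX : ∀ n, IsZero ((homologyFunctor 𝒜 n).obj X)) : IsZero X := by
  have : X.IsLE 0 := (isLE_iff X 0).2 fun i _ => hX i
  have : X.IsGE 1 := (isGE_iff X 1).2 fun i _ => hX i
  exact TStructure.t.isZero X 0 1 (by lia)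

lemma isZero_homology_singleFunctor_obj (P : 𝒜) {m n : ℤ} (h : m ≠ n) :
    IsZero ((homologyFunctor 𝒜 m).obj ((singleFunctor 𝒜 n).obj P)) := by
  rcases lt_or_gt_of_ne h with h | h
  · exact isZero_of_isGE _ n m h
  · exact isZero_of_isLE _ n m h

/-- Maps from projective objects to finitely many homology objects of `X` are induced by a single
morphism from a direct sum of shifts of these projective objects. -/
lemma exists_hom_of_homology (X : DerivedCategory 𝒜) (p : DerivedCategory 𝒜 → Prop)
    (h0 : p 0) (hsum : ∀ Y Z, p Y → p Z → p (Y ⊞ Z))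
    (P : ℤ → 𝒜) [∀ n, Projective (P n)]
    (hP : ∀ n, p ((singleFunctor 𝒜 n).obj (P n)))
    (φ : ∀ n, P n ⟶ (homologyFunctor 𝒜 n).obj X) (s : Finset ℤ) :
    ∃ (Y : DerivedCategory 𝒜) (f : Y ⟶ X), p Y ∧
      (∀ n ∈ s, ∃ e : P n ≅ (homologyFunctor 𝒜 n).obj Y,
        e.hom ≫ (homologyFunctor 𝒜 n).map f = φ n) ∧
      (∀ n ∉ s, IsZero ((homologyFunctor 𝒜 n).obj Y)) := by
  induction s using Finset.induction_on with
  | empty =>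
    exact ⟨0, 0, h0, by simp, fun n _ => (homologyFunctor 𝒜 n).map_isZero (isZero_zero _)⟩
  | insert m s hm ih =>
    obtain ⟨Y, f, hY, h₁, h₂⟩ := ih
    obtain ⟨g, e, hg⟩ := exists_hom_singleFunctor_obj X m (P m) (φ m)
    have isoL (n : ℤ) (hn : IsZero ((homologyFunctor 𝒜 n).obj ((singleFunctor 𝒜 m).obj (P m)))) :
        IsIso ((homologyFunctor 𝒜 n).map
          (biprod.inl : Y ⟶ Y ⊞ (singleFunctor 𝒜 m).obj (P m))) := by
      refine ⟨(homologyFunctor 𝒜 n).map biprod.fst, by simp [← Functor.map_comp], ?_⟩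
      rw [← CategoryTheory.Functor.map_id, ← biprod.total, Functor.map_add, Functor.map_comp,
        Functor.map_comp,
        hn.eq_of_tgt ((homologyFunctor 𝒜 n).map biprod.snd) 0]
      simp
    have isoR (n : ℤ) (hn : IsZero ((homologyFunctor 𝒜 n).obj Y)) :
        IsIso ((homologyFunctor 𝒜 n).map
          (biprod.inr : _ ⟶ Y ⊞ (singleFunctor 𝒜 m).obj (P m))) := by
      refine ⟨(homologyFunctor 𝒜 n).map biprod.snd, by simp [← Functor.map_comp], ?_⟩
      rw [← CategoryTheory.Functor.map_id, ← biprod.total, Functor.map_add, Functor.map_comp,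
        Functor.map_comp,
        hn.eq_of_tgt ((homologyFunctor 𝒜 n).map biprod.fst) 0]
      simp
    refine ⟨Y ⊞ (singleFunctor 𝒜 m).obj (P m), biprod.desc f g, hsum _ _ hY (hP m), ?_, ?_⟩
    · intro n hn
      by_cases hnm : n = m
      · subst hnm
        have := isoR n (h₂ n hm)
        refine ⟨e ≪≫ asIso ((homologyFunctor 𝒜 n).map biprod.inr), ?_⟩
        simp [← Functor.map_comp, hg]
      · have := isoL n (isZero_homology_singleFunctor_obj _ hnm)
        obtain ⟨e', he'⟩ := h₁ n (Finset.mem_of_mem_insert_of_ne hn hnm)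
        refine ⟨e' ≪≫ asIso ((homologyFunctor 𝒜 n).map biprod.inl), ?_⟩
        simp [← Functor.map_comp, he']
    · intro n hn
      rw [Finset.mem_insert, not_or] at hn
      have := isoL n (isZero_homology_singleFunctor_obj _ hn.1)
      exact (h₂ n hn.2).of_iso (asIso ((homologyFunctor 𝒜 n).map biprod.inl)).symm

/-- If `T.mor₁` is surjective on homology, the homology of the cone of `T.mor₁` consists of the
kernels of the maps induced by `T.mor₁`. -/
lemma nonempty_homology_obj₃_iso_kernel (T : Triangle (DerivedCategory 𝒜)) (hT : T ∈ distTriang _)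
    (h : ∀ n, Epi ((homologyFunctor 𝒜 n).map T.mor₁)) (n : ℤ) :
    Nonempty ((homologyFunctor 𝒜 n).obj T.obj₃ ≅
      kernel ((homologyFunctor 𝒜 (n + 1)).map T.mor₁)) := by
  have h₀ : (homologyFunctor 𝒜 n).map T.mor₂ = 0 :=
    (HomologySequence.epi_homologyMap_mor₁_iff T hT n).1 (h n)
  have : Mono (HomologySequence.δ T n (n + 1)) :=
    (HomologySequence.exact₃ T hT n (n + 1)).mono_g h₀
  exact ⟨(HomologySequence.exact₁ T hT n (n + 1)).fIsKernel.conePointUniqueUpToIso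
    (limit.isLimit _)⟩

end Homology

section Level

variable {C : Type*} [Category C]

lemma isRetract_of_iso {X Y : C} (e : X ≅ Y) : IsRetract C X Y := ⟨e.hom, e.inv, e.hom_inv_id⟩

variable [Preadditive C] [HasShift C ℤ]

lemma gen_of_isZero (M : C) {X : C} (hX : IsZero X) : gen C M X :=
  .retract .base ⟨0, 0, hX.eq_of_src _ _⟩

lemma gen_biprod {M X Y : C} [HasBinaryBiproduct X Y] (hX : gen C M X) (hY : gen C M Y) :
    gen C M (X ⊞ Y) :=
  .sum biprod.inl biprod.fst biprod.inr biprod.snd hX hY (by simp) (by simp) (by simp) (by simp)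
    biprod.total

variable [HasZeroObject C] [∀ n : ℤ, (shiftFunctor C n).Additive] [Pretriangulated C]

lemma level_of_iso {M X Y : C} (e : X ≅ Y) : ∀ {i : ℕ}, Y ∈ level C M i → X ∈ level C M i
  | 0, hY => IsZero.of_iso hY e
  | _ + 1, ⟨X₁, Z, X₂, f, g, h, hT, h₁, h₂, s, r, hsr⟩ =>
    ⟨X₁, Z, X₂, f, g, h, hT, h₁, h₂, e.hom ≫ s, r ≫ e.inv, by simp [reassoc_of% hsr]⟩

lemma mem_level_succ {M : C} {i : ℕ} {T : Triangle C} (hT : T ∈ distTriang C)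
    (h₁ : T.obj₁ ∈ level C M i) (h₃ : gen C M T.obj₃) : T.obj₂ ∈ level C M (i + 1) :=
  ⟨T.obj₁, T.obj₂, T.obj₃, T.mor₁, T.mor₂, T.mor₃, hT, h₁, h₃, isRetract_of_iso (Iso.refl _)⟩

end Level

section Bounded

open DerivedCategory

variable {R : Type} [Ring R]

lemma finite_of_retract {M N : ModuleCat.{0} R} (s : M ⟶ N) (r : N ⟶ M) (h : s ≫ r = 𝟙 M)
    [Module.Finite R N] : Module.Finite R M := by
  refine Module.Finite.of_surjective r.hom fun x => ⟨s x, ?_⟩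
  exact ConcreteCategory.congr_hom h x

lemma Db_of_isRetract {X Y : DerivedCategory (ModuleCat.{0} R)} (h : IsRetract _ X Y)
    (hY : Y ∈ Db R) : X ∈ Db R := by
  obtain ⟨s, r, h⟩ := h
  obtain ⟨⟨a, b, hab⟩, hf⟩ := hY
  have hn (n : ℤ) : (homologyFunctor (ModuleCat.{0} R) n).map s ≫
      (homologyFunctor (ModuleCat.{0} R) n).map r = 𝟙 _ := by
    rw [← Functor.map_comp, h, CategoryTheory.Functor.map_id]
  refine ⟨⟨a, b, fun n hn' => ?_⟩, fun n => ?_⟩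
  · rw [IsZero.iff_id_eq_zero, ← hn n,
      (hab n hn').eq_of_tgt ((homologyFunctor (ModuleCat.{0} R) n).map s) 0, zero_comp]
  · have := hf n
    exact finite_of_retract _ _ (hn n)

lemma Db_of_iso {X Y : DerivedCategory (ModuleCat.{0} R)} (e : X ≅ Y) (hY : Y ∈ Db R) : X ∈ Db R :=
  Db_of_isRetract (isRetract_of_iso e) hY

lemma Db_of_isZero {X : DerivedCategory (ModuleCat.{0} R)} (hX : IsZero X) : X ∈ Db R := by
  have h (n : ℤ) : IsZero ((homologyFunctor (ModuleCat.{0} R) n).obj X) :=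
    (homologyFunctor (ModuleCat.{0} R) n).map_isZero hX
  refine ⟨⟨0, 0, fun n _ => h n⟩, fun n => ?_⟩
  have := ModuleCat.subsingleton_of_isZero (h n)
  infer_instance

lemma Db_shift {X : DerivedCategory (ModuleCat.{0} R)} (hX : X ∈ Db R) (m : ℤ) : X⟦m⟧ ∈ Db R := by
  obtain ⟨⟨a, b, hab⟩, hf⟩ := hX
  have e (n : ℤ) : (homologyFunctor (ModuleCat.{0} R) n).obj (X⟦m⟧) ≅
      (homologyFunctor (ModuleCat.{0} R) (m + n)).obj X :=
    ((homologyFunctor (ModuleCat.{0} R) 0).shiftIso m n (m + n) rfl).app X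
  refine ⟨⟨a - m, b - m, fun n hn => (hab (m + n) (by lia)).of_iso (e n)⟩, fun n => ?_⟩
  have := hf (m + n)
  exact finite_of_retract _ _ (e n).hom_inv_id

lemma Db_singleFunctor_obj (P : ModuleCat.{0} R) [Module.Finite R P] (n : ℤ) :
    (singleFunctor (ModuleCat.{0} R) n).obj P ∈ Db R := by
  refine ⟨⟨n, n, fun m hm => isZero_homology_singleFunctor_obj P (by lia)⟩, fun m => ?_⟩
  by_cases h : m = n
  · subst h
    let e : (homologyFunctor (ModuleCat.{0} R) m).obj
        ((singleFunctor (ModuleCat.{0} R) m).obj P) ≅ P :=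
      (homologyFunctorFactors _ m).app _ ≪≫
        HomologicalComplex.singleObjHomologySelfIso (ComplexShape.up ℤ) m P
    exact finite_of_retract _ _ e.hom_inv_id
  · have := ModuleCat.subsingleton_of_isZero (isZero_homology_singleFunctor_obj P h)
    infer_instance

variable [IsNoetherianRing R]

lemma finite_of_exact {S : ShortComplex (ModuleCat.{0} R)} (hS : S.Exact)
    [Module.Finite R S.X₁] [Module.Finite R S.X₃] : Module.Finite R S.X₂ := by
  have := isNoetherian_of_isNoetherianRing_of_finite R S.X₁
  have := isNoetherian_of_isNoetherianRing_of_finite R S.X₃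
  have := isNoetherian_of_range_eq_ker S.f.hom S.g.hom hS.moduleCat_range_eq_ker
  infer_instance

lemma Db_obj₂ {T : Triangle (DerivedCategory (ModuleCat.{0} R))} (hT : T ∈ distTriang _)
    (h₁ : T.obj₁ ∈ Db R) (h₃ : T.obj₃ ∈ Db R) : T.obj₂ ∈ Db R := by
  obtain ⟨⟨a, b, hab⟩, hf⟩ := h₁
  obtain ⟨⟨a', b', hab'⟩, hf'⟩ := h₃
  have ex (n : ℤ) := HomologySequence.exact₂ T hT n
  refine ⟨⟨min a a', max b b', fun n hn => ?_⟩, fun n => ?_⟩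
  · exact (ex n).isZero_of_both_zeros ((hab n (by lia)).eq_of_src _ _)
      ((hab' n (by lia)).eq_of_tgt _ _)
  · have := hf n
    have := hf' n
    exact finite_of_exact (ex n)

lemma Db_obj₃ {T : Triangle (DerivedCategory (ModuleCat.{0} R))} (hT : T ∈ distTriang _)
    (h₁ : T.obj₁ ∈ Db R) (h₂ : T.obj₂ ∈ Db R) : T.obj₃ ∈ Db R :=
  Db_obj₂ (rot_of_distTriang T hT) h₂ (Db_shift h₁ 1)

lemma Db_biprod {X Y : DerivedCategory (ModuleCat.{0} R)} (hX : X ∈ Db R) (hY : Y ∈ Db R) :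
    (X ⊞ Y) ∈ Db R :=
  Db_obj₂ (binaryBiproductTriangle_distinguished X Y) hX hY

lemma gen_le_Db {M X : DerivedCategory (ModuleCat.{0} R)} (hM : M ∈ Db R) (hX : gen _ M X) :
    X ∈ Db R := by
  induction hX with
  | base => exact hM
  | sum i p j q _ _ _ _ _ _ h hX hY =>
    exact Db_of_isRetract ⟨biprod.lift p q, biprod.desc i j, by simpa using h⟩ (Db_biprod hX hY)
  | shift n _ hX => exact Db_shift hX n
  | retract _ h hZ => exact Db_of_isRetract h hZ

lemma level_subset_Db {M : DerivedCategory (ModuleCat.{0} R)} (hM : M ∈ Db R) :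
    ∀ i, level _ M i ⊆ Db R
  | 0, _, hX => Db_of_isZero hX
  | i + 1, _, ⟨_, _, _, _, _, _, hT, h₁, h₃, h⟩ =>
    Db_of_isRetract h (Db_obj₂ hT (level_subset_Db hM i h₁) (gen_le_Db hM h₃))

end Bounded

section GlobalDimension

variable {R : Type} [Ring R]

lemma hasProjectiveDimensionLT_of_pdLE : ∀ (d : ℕ) (M : Type) [AddCommGroup M] [Module R M],
    pdLE R d M → HasProjectiveDimensionLT (ModuleCat.of R M) (d + 1)
  | 0, M, _, _, h => by
    have : Module.Projective R M := h
    infer_instance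
  | d + 1, M, _, _, ⟨P, _, _, f, hf, _, h⟩ => by
    have h₁ := hasProjectiveDimensionLT_of_pdLE d _ h
    let S : ShortComplex (ModuleCat R) := ShortComplex.mk
      (ModuleCat.ofHom (LinearMap.ker f).subtype) (ModuleCat.ofHom f) (by ext x; exact x.2)
    have hS : S.ShortExact :=
      { exact := by
          rw [ShortComplex.moduleCat_exact_iff]
          exact fun x hx => ⟨⟨x, hx⟩, rfl⟩
        mono_f := (ModuleCat.mono_iff_injective _).2 Subtype.val_injective
        epi_g := (ModuleCat.epi_iff_surjective _).2 hf }
    have : HasProjectiveDimensionLT S.X₂ 1 :=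
      inferInstanceAs (HasProjectiveDimensionLT (ModuleCat.of R P) 1)
    exact hS.hasProjectiveDimensionLT_X₃ (d + 1) h₁
      (hasProjectiveDimensionLT_of_ge _ 1 _ (by lia))

/-- A finitely generated module of projective dimension at most `e` is covered by a finitely
generated projective module with kernel of projective dimension less than `e`. -/
lemma exists_projective_cover (M : ModuleCat.{0} R) [Module.Finite R M] (e : ℕ)
    [HasProjectiveDimensionLT M (e + 1)] :
    ∃ (P : ModuleCat.{0} R) (φ : P ⟶ M), Module.Finite R P ∧ Module.Projective R P ∧ Epi φ ∧
      HasProjectiveDimensionLT (kernel φ) e := by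
  obtain _ | e := e
  · have : HasProjectiveDimensionLT M 1 := ‹_›
    have : Projective M := projective_iff_hasProjectiveDimensionLT_one.2 this
    exact ⟨M, 𝟙 M, inferInstance, ModuleCat.projective_of_module_projective M, inferInstance,
      (isZero_kernel_of_mono (𝟙 M)).hasProjectiveDimensionLT_zero⟩
  · obtain ⟨n, f, hf⟩ := Module.Finite.exists_fin' R M
    let P := ModuleCat.of R (Fin n → R)
    let φ : P ⟶ M := ModuleCat.ofHom f
    have : Epi φ := (ModuleCat.epi_iff_surjective _).2 hf
    have hS : (ShortComplex.mk (kernel.ι φ) φ (by simp)).ShortExact :=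
      { exact := ShortComplex.exact_kernel φ }
    have : Projective P := inferInstance
    exact ⟨P, φ, inferInstanceAs (Module.Finite R (Fin n → R)),
      inferInstanceAs (Module.Projective R (Fin n → R)), ‹_›,
      (hS.hasProjectiveDimensionLT_X₃_iff e ‹_›).1 ‹_›⟩

end GlobalDimension

section Generation

open DerivedCategory

/-- The ring `R` as a left module over itself, placed in degree `0`. -/
noncomputable abbrev regularObject (R : Type) [Ring R] : DerivedCategory (ModuleCat.{0} R) :=
  (singleFunctor (ModuleCat.{0} R) 0).obj (ModuleCat.of R R)

variable {R : Type} [Ring R]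

lemma gen_single_free (n : ℕ) :
    gen _ (regularObject R)
      ((singleFunctor (ModuleCat.{0} R) 0).obj (ModuleCat.of R (Fin n → R))) := by
  induction n with
  | zero =>
    exact gen_of_isZero _ ((singleFunctor _ 0).map_isZero (ModuleCat.isZero_of_subsingleton _))
  | succ n ih =>
    let F := singleFunctor (ModuleCat.{0} R) 0
    let i : ModuleCat.of R R ⟶ ModuleCat.of R (Fin (n + 1) → R) :=
      ModuleCat.ofHom (LinearMap.single R (fun _ => R) 0)
    let p : ModuleCat.of R (Fin (n + 1) → R) ⟶ ModuleCat.of R R :=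
      ModuleCat.ofHom (LinearMap.proj 0)
    let j : ModuleCat.of R (Fin n → R) ⟶ ModuleCat.of R (Fin (n + 1) → R) :=
      ModuleCat.ofHom (LinearMap.pi (Fin.cons 0 fun k => LinearMap.proj k))
    let q : ModuleCat.of R (Fin (n + 1) → R) ⟶ ModuleCat.of R (Fin n → R) :=
      ModuleCat.ofHom (LinearMap.funLeft R R Fin.succ)
    have hip : i ≫ p = 𝟙 _ := by ext; simp [i, p]
    have hjq : j ≫ q = 𝟙 _ := by ext x k; simp [j, q, LinearMap.funLeft]
    have hiq : i ≫ q = 0 := by ext k; simp [i, q, LinearMap.funLeft]; rfl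
    have hjp : j ≫ p = 0 := by ext; simp [j, p]
    have htot : p ≫ i + q ≫ j = 𝟙 _ := by
      refine ModuleCat.hom_ext (LinearMap.ext fun x => funext fun k => ?_)
      refine Fin.cases ?_ (fun k => ?_) k <;> simp [i, p, j, q, LinearMap.funLeft]
    refine gen.sum (F.map i) (F.map p) (F.map j) (F.map q) gen.base ih ?_ ?_ ?_ ?_ ?_
    · rw [← F.map_comp, hip]; exact F.map_id _
    · rw [← F.map_comp, hjq]; exact F.map_id _
    · rw [← F.map_comp, hiq, F.map_zero]
    · rw [← F.map_comp, hjp, F.map_zero]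
    · rw [← F.map_comp, ← F.map_comp, ← F.map_add, htot]; exact F.map_id _

lemma gen_single (P : ModuleCat.{0} R) [Module.Finite R P] [Module.Projective R P] (n : ℤ) :
    gen _ (regularObject R) ((singleFunctor (ModuleCat.{0} R) n).obj P) := by
  have h₀ : gen _ (regularObject R) ((singleFunctor (ModuleCat.{0} R) 0).obj P) := by
    obtain ⟨k, f, hf⟩ := Module.Finite.exists_fin' R P
    obtain ⟨g, hg⟩ := Module.projective_lifting_property f LinearMap.id hf
    refine .retract (gen_single_free k) ⟨(singleFunctor _ 0).map (ModuleCat.ofHom g),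
      (singleFunctor _ 0).map (ModuleCat.ofHom f), ?_⟩
    rw [← Functor.map_comp, ← ModuleCat.ofHom_comp, hg]
    exact CategoryTheory.Functor.map_id _ _
  exact .retract (.shift (-n) h₀) (isRetract_of_iso
    (((singleFunctors (ModuleCat.{0} R)).shiftIso (-n) n 0 (by lia)).symm.app P))

variable [IsNoetherianRing R]

/-- An object of `Db R` whose homology has projective dimension less than `e + 1` maps to an object
of `Db R` whose homology has projective dimension less than `e`, with fiber generated by `R`. -/
lemma exists_triangle (X : DerivedCategory (ModuleCat.{0} R)) (hX : X ∈ Db R) (e : ℕ)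
    (hpd : ∀ n, HasProjectiveDimensionLT ((homologyFunctor (ModuleCat.{0} R) n).obj X) (e + 1)) :
    ∃ T ∈ distTriang (DerivedCategory (ModuleCat.{0} R)), T.obj₂ = X ∧
      gen _ (regularObject R) T.obj₁ ∧ T.obj₃ ∈ Db R ∧
      ∀ n, HasProjectiveDimensionLT ((homologyFunctor (ModuleCat.{0} R) n).obj T.obj₃) e := by
  obtain ⟨⟨a, b, hab⟩, hf⟩ := id hX
  choose P φ hfin hproj hepi hker using fun n =>
    exists_projective_cover ((homologyFunctor (ModuleCat.{0} R) n).obj X) e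
  have (n : ℤ) : Projective (P n) := (P n).projective_of_categoryTheory_projective
  obtain ⟨Y, f, hY, h₁, h₂⟩ := exists_hom_of_homology X (gen _ (regularObject R))
    (gen_of_isZero _ (isZero_zero _)) (fun _ _ => gen_biprod) P (fun n => gen_single (P n) n) φ
    (Finset.Icc a b)
  obtain ⟨Z, g, h, hT⟩ := distinguished_cocone_triangle f
  have key (n : ℤ) : Epi ((homologyFunctor (ModuleCat.{0} R) n).map f) ∧
      HasProjectiveDimensionLT (kernel ((homologyFunctor (ModuleCat.{0} R) n).map f)) e := by
    by_cases hn : n ∈ Finset.Icc a b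
    · obtain ⟨i, hi⟩ := h₁ n hn
      have := hepi n
      have := hker n
      rw [← hi] at *
      exact ⟨epi_of_epi i.hom _, hasProjectiveDimensionLT_of_iso (kernelIsIsoComp i.hom _) e⟩
    · refine ⟨⟨fun _ _ _ => (hab n ?_).eq_of_src _ _⟩, ?_⟩
      · simp only [Finset.mem_Icc] at hn
        lia
      · have := ((h₂ n hn).of_mono
          (kernel.ι ((homologyFunctor (ModuleCat.{0} R) n).map f))).hasProjectiveDimensionLT_zero
        exact hasProjectiveDimensionLT_of_ge _ 0 _ (by lia)
  have hRDb : regularObject R ∈ Db R := Db_singleFunctor_obj _ 0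
  refine ⟨_, hT, rfl, hY, Db_obj₃ hT (gen_le_Db hRDb hY) hX, fun n => ?_⟩
  obtain ⟨i⟩ := nonempty_homology_obj₃_iso_kernel _ hT (fun n => (key n).1) n
  have : HasProjectiveDimensionLT (kernel ((homologyFunctor (ModuleCat.{0} R) (n + 1)).map
      (Triangle.mk f g h).mor₁)) e := (key (n + 1)).2
  exact hasProjectiveDimensionLT_of_iso i.symm e

lemma mem_level_of_fiber (e : ℕ) : ∀ (i : ℕ) (T : Triangle (DerivedCategory (ModuleCat.{0} R))),
    T ∈ distTriang (DerivedCategory (ModuleCat.{0} R)) →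
    T.obj₁ ∈ level _ (regularObject R) i → T.obj₃ ∈ Db R →
    (∀ n, HasProjectiveDimensionLT ((homologyFunctor (ModuleCat.{0} R) n).obj T.obj₃) e) →
      T.obj₂ ∈ level _ (regularObject R) (i + e) := by
  induction e with
  | zero =>
    intro i T hT h₁ _ hpd
    have h₃ : IsZero T.obj₃ := isZero_of_isZero_homology _ fun n =>
      (hasProjectiveDimensionLT_zero_iff_isZero _).1 (hpd n)
    have := (Triangle.isZero₃_iff_isIso₁ T hT).1 h₃
    exact level_of_iso (asIso T.mor₁).symm h₁
  | succ e ih =>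
    rintro i ⟨W, X, Y, f, g, h⟩ hT h₁ h₃ hpd
    obtain ⟨⟨P, _, Y', u, v, w⟩, hT', rfl, hP, hY', hpd'⟩ := exists_triangle Y h₃ e hpd
    obtain ⟨W', f', h', hT''⟩ := distinguished_cocone_triangle₁ (g ≫ v)
    have o := Triangulated.someOctahedron' rfl hT hT' hT''
    have := ih (i + 1) _ hT'' (mem_level_succ o.mem h₁ hP) hY' hpd'
    rwa [add_right_comm, add_assoc] at this

end Generation

/-- **Rouquier**: for a right noetherian ring `A`, the dimension of the bounded derived
category of finitely generated right `A`-modules (i.e. left `Aᵐᵒᵖ`-modules) is at most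
the global dimension of `A` (the supremum of projective dimensions of all right
`A`-modules). -/
theorem dim_Db_le_gldim (A : Type) [Ring A] [IsNoetherianRing Aᵐᵒᵖ] :
    trdim _ (Db Aᵐᵒᵖ) ≤ gldim Aᵐᵒᵖ := by
  refine le_sInf ?_
  rintro _ ⟨d, hd, rfl⟩
  refine sInf_le ⟨d, ⟨(DerivedCategory.singleFunctor _ 0).obj (ModuleCat.of _ Aᵐᵒᵖ),
    Db_singleFunctor_obj _ 0, (level_subset_Db (Db_singleFunctor_obj _ 0) _).antisymm ?_⟩, rfl⟩
  intro X hX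
  have := mem_level_of_fiber (d + 1) 0 _ (contractible_distinguished₁ X)
    (isZero_zero _) hX fun n => hasProjectiveDimensionLT_of_pdLE d _ (hd _ _ _)
  rwa [zero_add] at this
end

section
/- Let k be a perfect field and let A be a reduced, finitely generated commutative k-algebra. Then dim D^b(mod A) ≥ dim A, the Krull dimension of A. (This is the affine case of the lower bound for reduced separated schemes of finite type over a perfect field.) -/
/-!
Dimension of triangulated categories (Rouquier): the bounded derived category of
finitely generated modules over a finitely generated commutative algebra over a
perfect field has finite dimension.
-/

open CategoryTheory CategoryTheory.Limits CategoryTheory.Pretriangulated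

variable (A : Type) [Ring A]

section PretriangulatedGhosts

variable {C : Type*} [Category C] [Preadditive C] [HasShift C ℤ]
  [∀ n : ℤ, (shiftFunctor C n).Additive]

/-- A morphism annihilated by all morphisms from shifts of `M` is annihilated by all
morphisms from objects of `⟨M⟩`. -/
lemma comp_eq_zero_of_gen {M X Y : C} {φ : X ⟶ Y}
    (h : ∀ (i : ℤ) (u : M⟦i⟧ ⟶ X), u ≫ φ = 0) {Z : C} (hZ : gen C M Z) :
    ∀ (i : ℤ) (u : Z⟦i⟧ ⟶ X), u ≫ φ = 0 := by
  induction hZ with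
  | base => exact h
  | @sum A B Z a p b q _ _ _ _ _ _ hsum hA hB =>
    intro i u
    have e : u = (p⟦i⟧' ≫ a⟦i⟧' + q⟦i⟧' ≫ b⟦i⟧') ≫ u := by
      rw [← Functor.map_comp, ← Functor.map_comp, ← Functor.map_add, hsum, CategoryTheory.Functor.map_id,
        Category.id_comp]
    rw [e]
    simp only [Preadditive.add_comp, Category.assoc]
    rw [← Category.assoc (a⟦i⟧') u φ, hA, ← Category.assoc (b⟦i⟧') u φ, hB]
    simp
  | @shift A n _ hA =>
    intro i u
    have := hA (n + i) ((shiftFunctorAdd C n i).hom.app A ≫ u)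
    rw [Category.assoc] at this
    rw [← cancel_epi ((shiftFunctorAdd C n i).hom.app A)]
    simpa using this
  | @retract A B _ hr hB =>
    obtain ⟨s, r, hsr⟩ := hr
    intro i u
    have e : u = s⟦i⟧' ≫ r⟦i⟧' ≫ u := by
      rw [← Category.assoc, ← Functor.map_comp, hsr, CategoryTheory.Functor.map_id, Category.id_comp]
    rw [e, Category.assoc, hB, comp_zero]

variable [HasZeroObject C] [Pretriangulated C]

/-- A morphism annihilated by precomposition with every morphism from an object of `⟨M⟩ₙ`. -/
def IsLevelGhost (M : C) (n : ℕ) {X Y : C} (φ : X ⟶ Y) : Prop :=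
  ∀ Z ∈ level C M n, ∀ u : Z ⟶ X, u ≫ φ = 0

lemma isLevelGhost_zero (M : C) {X Y : C} (φ : X ⟶ Y) : IsLevelGhost M 0 φ :=
  fun _ hZ _ => IsZero.eq_zero_of_src hZ _

lemma IsLevelGhost.comp {M : C} {n : ℕ} {X Y W : C} {φ : X ⟶ Y} (hφ : IsLevelGhost M n φ)
    {ψ : Y ⟶ W} (hψ : ∀ (i : ℤ) (u : M⟦i⟧ ⟶ Y), u ≫ ψ = 0) :
    IsLevelGhost M (n + 1) (φ ≫ ψ) := by
  rintro Z ⟨X₁, Z', X₂, f, g, h, hT, hX₁, hX₂, s, r, hsr⟩ u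
  have h₁ : f ≫ (r ≫ u ≫ φ) = 0 := by
    have := hφ X₁ hX₁ (f ≫ r ≫ u)
    simpa using this
  obtain ⟨v, hv⟩ : ∃ v : X₂ ⟶ Y, r ≫ u ≫ φ = g ≫ v := Triangle.yoneda_exact₂ _ hT _ h₁
  have h₂ : v ≫ ψ = 0 := by
    have := comp_eq_zero_of_gen hψ hX₂ 0 ((shiftFunctorZero C ℤ).hom.app X₂ ≫ v)
    rw [Category.assoc] at this
    rw [← cancel_epi ((shiftFunctorZero C ℤ).hom.app X₂)]
    simpa using this
  calc u ≫ φ ≫ ψ = s ≫ (r ≫ u ≫ φ) ≫ ψ := by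
        simp only [Category.assoc]
        rw [← Category.assoc s r, hsr, Category.id_comp]
    _ = 0 := by
        rw [hv, Category.assoc, h₂, comp_zero, comp_zero]

end PretriangulatedGhosts

section ExtVanishing

open CategoryTheory.Abelian

variable {R : Type} [CommRing R]

/-- Multiplication by `f` is bijective on `Q`. -/
def IsInvertibleOn (f : R) (Q : Type) [AddCommGroup Q] [Module R Q] : Prop :=
  Function.Bijective (fun x : Q => f • x)

lemma IsInvertibleOn.of_dvd {f g : R} (h : f ∣ g) {Q : Type} [AddCommGroup Q] [Module R Q]
    (hg : IsInvertibleOn g Q) : IsInvertibleOn f Q := by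
  obtain ⟨c, rfl⟩ := h
  refine ⟨fun x y hxy => hg.1 ?_, fun y => ?_⟩
  · change (f * c) • x = (f * c) • y
    rw [mul_comm, mul_smul, mul_smul]
    exact congrArg _ hxy
  · obtain ⟨x, hx⟩ := hg.2 y
    exact ⟨c • x, by rw [← hx]; exact smul_smul _ _ _⟩

/-- The modules `H` for which `Ext H Q` vanishes in positive degrees for all modules `Q` on
which `f` is invertible. -/
def ExtVanishing (f : R) (H : ModuleCat.{0} R) : Prop :=
  ∀ Q : ModuleCat.{0} R, IsInvertibleOn f Q → ∀ n : ℕ, Subsingleton (Ext H Q (n + 1))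

lemma ExtVanishing.of_dvd {f g : R} (h : f ∣ g) {H : ModuleCat.{0} R} (hf : ExtVanishing f H) :
    ExtVanishing g H :=
  fun Q hQ n => hf Q (hQ.of_dvd h) n

lemma ExtVanishing.of_iso {f : R} {H H' : ModuleCat.{0} R} (e : H ≅ H') (h : ExtVanishing f H) :
    ExtVanishing f H' := by
  intro Q hQ n
  have := h Q hQ n
  refine subsingleton_of_forall_eq 0 fun x => ?_
  have hx : x = (Ext.mk₀ e.inv).comp ((Ext.mk₀ e.hom).comp x (zero_add _)) (zero_add _) := by
    simp
  rw [hx, Subsingleton.elim ((Ext.mk₀ e.hom).comp x (zero_add _)) 0, Ext.comp_zero]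

lemma ExtVanishing.of_projective (f : R) (H : ModuleCat.{0} R) [Projective H] :
    ExtVanishing f H :=
  fun Q _ n => Ext.subsingleton_of_projective H Q n

lemma ExtVanishing.of_shortExact_middle {f : R} {S : ShortComplex (ModuleCat.{0} R)}
    (hS : S.ShortExact) (h₁ : ExtVanishing f S.X₁) (h₃ : ExtVanishing f S.X₃) :
    ExtVanishing f S.X₂ := by
  intro Q hQ n
  have := h₁ Q hQ n
  have := h₃ Q hQ n
  refine subsingleton_of_forall_eq 0 fun x => ?_
  obtain ⟨y, rfl⟩ := Ext.contravariant_sequence_exact₂ hS Q x (Subsingleton.elim _ _)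
  rw [Subsingleton.elim y 0, Ext.comp_zero]

lemma subsingleton_ext_of_smul_eq_zero {f : R} {T Q : ModuleCat.{0} R}
    (hT : ∀ x : T, f • x = 0) (hQ : IsInvertibleOn f Q) (n : ℕ) :
    Subsingleton (Ext T Q n) := by
  refine subsingleton_of_forall_eq 0 fun x => ?_
  have h0 : f • (𝟙 T) = 0 := by
    ext x
    exact hT x
  have hx : f • x = 0 := by
    have := Ext.smul_comp (Ext.mk₀ (𝟙 T)) x (zero_add n) f
    rw [← Ext.mk₀_smul, h0] at this
    simpa using this.symm
  have : IsIso (f • 𝟙 Q) := by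
    rw [ConcreteCategory.isIso_iff_bijective]
    exact hQ
  have h1 : x.comp (Ext.mk₀ (f • 𝟙 Q)) (add_zero n) = 0 := by
    rw [Ext.mk₀_smul, Ext.comp_smul, Ext.comp_mk₀_id, hx]
  calc x = (x.comp (Ext.mk₀ (f • 𝟙 Q)) (add_zero n)).comp (Ext.mk₀ (inv (f • 𝟙 Q)))
        (add_zero n) := by
          rw [Ext.comp_assoc_of_third_deg_zero, Ext.mk₀_comp_mk₀, IsIso.hom_inv_id,
            Ext.comp_mk₀_id]
    _ = 0 := by rw [h1, Ext.zero_comp]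

lemma ExtVanishing.of_smul_eq_zero {f : R} {T : ModuleCat.{0} R} (hT : ∀ x : T, f • x = 0) :
    ExtVanishing f T :=
  fun _ hQ _ => subsingleton_ext_of_smul_eq_zero hT hQ _

lemma ExtVanishing.of_shortExact_right {f : R} {S : ShortComplex (ModuleCat.{0} R)}
    (hS : S.ShortExact) (h₁ : ∀ x : S.X₁, f • x = 0) (h₂ : ExtVanishing f S.X₂) :
    ExtVanishing f S.X₃ := by
  intro Q hQ n
  have := subsingleton_ext_of_smul_eq_zero h₁ hQ n
  have := h₂ Q hQ n
  refine subsingleton_of_forall_eq 0 fun x => ?_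
  obtain ⟨y, rfl⟩ := Ext.contravariant_sequence_exact₃ hS Q x (Subsingleton.elim _ _)
    (add_comm 1 n)
  rw [Subsingleton.elim y 0, Ext.comp_zero]

/-- Over a reduced ring, a finitely generated minimal prime is annihilated by some element of
its complement. -/
lemma exists_notMem_forall_mul_eq_zero [IsReduced R] {p : Ideal R} (hp : p ∈ minimalPrimes R)
    (hfg : p.FG) : ∃ f ∉ p, ∀ x ∈ p, f * x = 0 := by
  have hpp : p.IsPrime := hp.1.1
  have key : ∀ x ∈ p, ∃ f ∉ p, f * x = 0 := by
    intro x hx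
    have hrad := IsLocalization.AtPrime.radical_map_of_mem_minimalPrimes
      (Localization.AtPrime p) p ⊥ hp
    rw [Ideal.map_bot] at hrad
    have : algebraMap R (Localization.AtPrime p) x ∈ (⊥ : Ideal _).radical :=
      hrad ▸ Ideal.mem_map_of_mem _ hx
    obtain ⟨n, hn⟩ := this
    rw [Ideal.mem_bot, ← map_pow, IsLocalization.map_eq_zero_iff p.primeCompl] at hn
    obtain ⟨⟨y, hy⟩, hxy⟩ := hn
    refine ⟨y, hy, IsReduced.eq_zero _ ⟨n + 1, ?_⟩⟩
    calc (y * x) ^ (n + 1) = (y * x ^ n) * (y ^ n * x) := by ring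
      _ = 0 := by rw [show y * x ^ n = 0 from hxy, zero_mul]
  obtain ⟨s, rfl⟩ := hfg
  have : ∀ t : Finset R, t ⊆ s → ∃ f ∉ Ideal.span (s : Set R), ∀ x ∈ t, f * x = 0 := by
    classical
    intro t
    induction t using Finset.induction_on with
    | empty => exact fun _ => ⟨1, (Ideal.ne_top_iff_one _).1 hpp.ne_top, by simp⟩
    | insert a t _ ih =>
      intro hts
      obtain ⟨f, hf, h⟩ := ih ((Finset.subset_insert _ _).trans hts)
      obtain ⟨g, hg, h'⟩ := key a (Ideal.subset_span (hts (Finset.mem_insert_self _ _)))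
      refine ⟨f * g, fun hfg => (hpp.mem_or_mem hfg).elim hf hg, fun x hx => ?_⟩
      rcases Finset.mem_insert.1 hx with rfl | hx
      · rw [mul_assoc, h', mul_zero]
      · rw [mul_right_comm, h x hx, zero_mul]
  obtain ⟨f, hf, h⟩ := this s subset_rfl
  refine ⟨f, hf, fun x hx => ?_⟩
  have hle : Ideal.span (s : Set R) ≤ LinearMap.ker (LinearMap.lsmul R R f) :=
    Ideal.span_le.2 fun y hy => h y hy
  exact hle hx

/-- Generically on a component of a reduced noetherian ring, a finitely generated module
has no higher extensions. -/
lemma exists_extVanishing [IsReduced R] [IsNoetherianRing R] {p : Ideal R}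
    (hp : p ∈ minimalPrimes R) (H : ModuleCat.{0} R) [Module.Finite R H] :
    ∃ f ∉ p, ExtVanishing f H := by
  have hpp : p.IsPrime := hp.1.1
  refine IsNoetherianRing.induction_on_isQuotientEquivQuotientPrime R (M := H) ‹_›
    (motive := fun N _ _ _ => ∃ f ∉ p, ExtVanishing f (ModuleCat.of R N)) ?_ ?_ ?_
  · intro N _ _ _ _
    exact ⟨1, (Ideal.ne_top_iff_one _).1 hpp.ne_top,
      .of_smul_eq_zero fun x => Subsingleton.elim (α := N) _ _⟩
  · intro N _ _ _ q e
    by_cases hqp : q.1 ≤ p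
    · obtain rfl : q.1 = p := le_antisymm hqp (hp.2 ⟨q.2, bot_le⟩ hqp)
      obtain ⟨f, hf, h⟩ := exists_notMem_forall_mul_eq_zero hp (IsNoetherian.noetherian _)
      refine ⟨f, hf, ?_⟩
      have : Projective (ModuleCat.of R R) := inferInstance
      have := (ExtVanishing.of_shortExact_right (f := f)
        (LinearMap.shortExact_shortComplexKer (f := q.1.mkQ) (Submodule.mkQ_surjective _)) ?_
        (.of_projective f (ModuleCat.of R R)))
      · exact this.of_iso e.symm.toModuleIso
      · rintro ⟨x, hx⟩
        ext
        exact h x (by simpa using hx)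
    · obtain ⟨f, hfq, hfp⟩ := SetLike.not_le_iff_exists.1 hqp
      refine ⟨f, hfp, .of_smul_eq_zero fun x => e.injective ?_⟩
      obtain ⟨y, hy⟩ := Ideal.Quotient.mk_surjective (e x)
      rw [map_smul, ← hy, map_zero]
      exact Ideal.Quotient.eq_zero_iff_mem.2 (Ideal.mul_mem_right _ _ hfq)
  · rintro N₁ _ _ _ N₂ _ _ _ N₃ _ _ _ i π hi hπ hex ⟨f, hf, h₁⟩ ⟨g, hg, h₃⟩
    refine ⟨f * g, fun hfg => (hpp.mem_or_mem hfg).elim hf hg, ?_⟩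
    have hS : (ModuleCat.shortComplexOfCompEqZero i π hex.linearMap_comp_eq_zero).ShortExact :=
      { exact := ModuleCat.shortComplex_exact _ hex
        mono_f := (ModuleCat.mono_iff_injective _).2 hi
        epi_g := (ModuleCat.epi_iff_surjective _).2 hπ }
    exact .of_shortExact_middle hS (h₁.of_dvd (dvd_mul_right _ _)) (h₃.of_dvd (dvd_mul_left _ _))

end ExtVanishing

section Rees

open CategoryTheory.Abelian RingTheory.Sequence

variable {R : Type} [CommRing R]

lemma ext_smul_eq_zero {r : R} {T N : ModuleCat.{0} R} (hT : ∀ x : T, r • x = 0) {n : ℕ}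
    (x : Ext T N n) : r • x = 0 := by
  have h0 : r • (𝟙 T) = 0 := by
    ext x
    exact hT x
  have := Ext.smul_comp (Ext.mk₀ (𝟙 T)) x (zero_add n) r
  rw [← Ext.mk₀_smul, h0] at this
  simpa using this.symm

/-- The vanishing part of Rees' theorem. -/
lemma subsingleton_ext_of_isWeaklyRegular {T : ModuleCat.{0} R} (rs : List R)
    (hT : ∀ r ∈ rs, ∀ x : T, r • x = 0) (N : ModuleCat.{0} R) (hN : IsWeaklyRegular N rs)
    (j : ℕ) (hj : j < rs.length) : Subsingleton (Ext T N j) := by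
  induction rs generalizing N j with
  | nil => simp at hj
  | cons r rs ih =>
    rw [isWeaklyRegular_cons_iff] at hN
    obtain ⟨hr, hN⟩ := hN
    have hS := hr.smulShortComplex_shortExact
    refine subsingleton_of_forall_eq 0 fun x => ?_
    have hx : x.comp (Ext.mk₀ (r • 𝟙 N)) (add_zero j) = 0 := by
      rw [Ext.mk₀_smul, Ext.comp_smul]
      exact ext_smul_eq_zero (hT r List.mem_cons_self) _
    cases j with
    | zero =>
      have := hS.mono_f
      refine Ext.postcomp_mk₀_injective_of_mono T (N.smulShortComplex r).f ?_
      exact hx.trans (Ext.zero_comp (X := T) (p := 0) (h := rfl) ..).symm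
    | succ j =>
      obtain ⟨y, rfl⟩ := Ext.covariant_sequence_exact₁ T hS x hx rfl
      have := ih (fun s hs => hT s (List.mem_cons_of_mem _ hs))
        (ModuleCat.of R (QuotSMulTop r N)) hN j (by simpa using hj)
      have hy : y = 0 := Subsingleton.elim (α := Ext T (ModuleCat.of R (QuotSMulTop r N)) j) _ _
      rw [hy, Ext.zero_comp]
      rfl

end Rees

section Devissage

open CategoryTheory.Abelian DerivedCategory

variable {R : Type} [CommRing R]

lemma ExtVanishing.of_isZero (f : R) {H : ModuleCat.{0} R} (h : IsZero H) : ExtVanishing f H := by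
  intro Q _ n
  refine subsingleton_of_forall_eq 0 fun x => ?_
  rw [← Ext.mk₀_id_comp x, h.eq_of_src (𝟙 H) 0, Ext.mk₀_zero, Ext.zero_comp]

lemma ExtVanishing.hom_eq_zero {f : R} {H K : ModuleCat.{0} R} (hH : ExtVanishing f H)
    (hK : IsInvertibleOn f K) {b j : ℤ} (hbj : 0 ≤ j + b)
    (w : (singleFunctor (ModuleCat.{0} R) b).obj H ⟶
      (((singleFunctor (ModuleCat.{0} R) 0).obj K)⟦(1 : ℤ)⟧)⟦j⟧) : w = 0 := by
  obtain ⟨m, hm⟩ := Int.eq_ofNat_of_zero_le hbj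
  have hm' : (1 + j) + b = ((m + 1 : ℕ) : ℤ) := by push_cast; linarith
  let e₁ := ((singleFunctors (ModuleCat.{0} R)).shiftIso b 0 b (add_zero b)).app H
  let e₂ : (((singleFunctor (ModuleCat.{0} R) 0).obj K)⟦(1 : ℤ)⟧)⟦j⟧⟦b⟧ ≅
    ((singleFunctor (ModuleCat.{0} R) 0).obj K)⟦((m + 1 : ℕ) : ℤ)⟧ :=
    (shiftFunctor _ b).mapIso ((shiftFunctorAdd _ 1 j).symm.app _) ≪≫
      (shiftFunctorAdd' _ (1 + j) b _ hm').symm.app _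
  apply (shiftFunctor (DerivedCategory (ModuleCat.{0} R)) b).map_injective
  rw [Functor.map_zero, ← cancel_epi e₁.inv, ← cancel_mono e₂.hom]
  have := hH K hK m
  have := (Ext.homEquiv (X := H) (Y := K) (n := m + 1)).symm.subsingleton
  exact Subsingleton.elim (α := ShiftedHom ((singleFunctor (ModuleCat.{0} R) 0).obj H)
    ((singleFunctor (ModuleCat.{0} R) 0).obj K) ((m + 1 : ℕ) : ℤ)) _ _

section

variable (X : DerivedCategory (ModuleCat.{0} R)) (b : ℤ)

lemma isIso_homologyFunctor_map_truncLTι {n : ℤ} (hn : n < b) :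
    IsIso ((homologyFunctor (ModuleCat.{0} R) n).map ((TStructure.t.truncLTι b).app X)) := by
  have hT := TStructure.t.triangleLTGE_distinguished b X
  have hz : ∀ m < b, IsZero ((homologyFunctor (ModuleCat.{0} R) m).obj
      ((TStructure.t.truncGE b).obj X)) := fun m hm => isZero_of_isGE _ b m hm
  have h₁ : Mono ((homologyFunctor (ModuleCat.{0} R) n).map ((TStructure.t.truncLTι b).app X)) :=
    (HomologySequence.mono_homologyMap_mor₁_iff _ hT (n - 1) n (by lia)).2
    ((hz (n - 1) (by lia)).eq_of_src _ _)
  have h₂ : Epi ((homologyFunctor (ModuleCat.{0} R) n).map ((TStructure.t.truncLTι b).app X)) :=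
    (HomologySequence.epi_homologyMap_mor₁_iff _ hT n).2
    ((hz n hn).eq_of_tgt _ _)
  exact isIso_of_mono_of_epi _

lemma isIso_homologyFunctor_map_truncGEπ {n : ℤ} (hn : b ≤ n) :
    IsIso ((homologyFunctor (ModuleCat.{0} R) n).map ((TStructure.t.truncGEπ b).app X)) := by
  have hT := TStructure.t.triangleLTGE_distinguished b X
  have hz : ∀ m ≥ b, IsZero ((homologyFunctor (ModuleCat.{0} R) m).obj
      ((TStructure.t.truncLT b).obj X)) := fun m hm => isZero_of_isLE _ (b - 1) m (by lia)
  have h₁ : Epi ((homologyFunctor (ModuleCat.{0} R) n).map ((TStructure.t.truncGEπ b).app X)) :=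
    (HomologySequence.epi_homologyMap_mor₂_iff _ hT n (n + 1) rfl).2
    ((hz (n + 1) (by lia)).eq_of_tgt _ _)
  have h₂ : Mono ((homologyFunctor (ModuleCat.{0} R) n).map ((TStructure.t.truncGEπ b).app X)) :=
    (HomologySequence.mono_homologyMap_mor₂_iff _ hT n).2
    ((hz n hn).eq_of_src _ _)
  exact isIso_of_mono_of_epi _

end

/-- If the homology of a bounded complex `X` has no higher extensions by modules on which `f` is
invertible, then connecting morphisms with `f`-invertible target are annihilated by `X`. -/
lemma comp_singleδ_shift_eq_zero {f : R} {S : ShortComplex (ModuleCat.{0} R)} (hS : S.ShortExact)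
    (hf : IsInvertibleOn f S.X₁) (a : ℤ) (k : ℕ) (X : DerivedCategory (ModuleCat.{0} R))
    (ha : X.IsGE a) (hb : X.IsLE (a + k - 1))
    (hX : ∀ n, ExtVanishing f ((homologyFunctor (ModuleCat.{0} R) n).obj X)) (j : ℤ)
    (u : X ⟶ ((singleFunctor (ModuleCat.{0} R) 0).obj S.X₃)⟦j⟧) :
    u ≫ hS.singleδ⟦j⟧' = 0 := by
  induction k generalizing X with
  | zero =>
    have hz : IsZero X := TStructure.t.isZero X (a + (0 : ℕ) - 1) a (by simp)
    exact hz.eq_of_src _ _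
  | succ k ih =>
    set b : ℤ := a + k with hbdef
    have hb' : X.IsLE b := by
      have : b = a + (k + 1 : ℕ) - 1 := by push_cast; lia
      rwa [this]
    by_cases hbj : 0 ≤ j + b
    · have hι : (TStructure.t.truncLTι b).app X ≫ u ≫ hS.singleδ⟦j⟧' = 0 := by
        rw [← Category.assoc]
        refine ih _ inferInstance inferInstance (fun n => ?_) _
        by_cases hn : n < b
        · have := isIso_homologyFunctor_map_truncLTι X b hn
          exact (hX n).of_iso (asIso ((homologyFunctor (ModuleCat.{0} R) n).map
            ((TStructure.t.truncLTι b).app X))).symm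
        · exact .of_isZero f (isZero_of_isLE _ (b - 1) n (by lia))
      obtain ⟨w, hw⟩ : ∃ w, u ≫ hS.singleδ⟦j⟧' = (TStructure.t.truncGEπ b).app X ≫ w :=
        Triangle.yoneda_exact₂ _ (TStructure.t.triangleLTGE_distinguished b X) _ hι
      obtain ⟨H, ⟨e⟩⟩ := exists_iso_singleFunctor_obj_of_isGE_of_isLE
        ((TStructure.t.truncGE b).obj X) b
      have := isIso_homologyFunctor_map_truncGEπ X b le_rfl
      have hH : ExtVanishing f H := (hX b).of_iso
        (asIso ((homologyFunctor (ModuleCat.{0} R) b).map ((TStructure.t.truncGEπ b).app X)) ≪≫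
          (homologyFunctor (ModuleCat.{0} R) b).mapIso e ≪≫
          (singleFunctorCompHomologyFunctorIso (ModuleCat.{0} R) b).app H)
      have hw0 : e.inv ≫ w = 0 := hH.hom_eq_zero hf hbj _
      rw [hw, ← e.hom_inv_id_assoc w, hw0, comp_zero, comp_zero]
    · have : (((singleFunctor (ModuleCat.{0} R) 0).obj S.X₃)⟦j⟧).IsGE (-j) :=
        TStructure.t.isGE_shift _ 0 j (-j) (by lia)
      rw [TStructure.t.zero u b (-j) (by lia), zero_comp]

end Devissage

section GhostChain

open CategoryTheory.Abelian DerivedCategory RingTheory.Sequence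
open scoped Pointwise

variable {R : Type} [CommRing R]

/-- Generically on a component of a reduced noetherian ring, the objects of `D^b(mod R)` do not
see connecting morphisms. -/
lemma exists_comp_singleδ_shift_eq_zero [IsReduced R] [IsNoetherianRing R] {p : Ideal R}
    (hp : p ∈ minimalPrimes R) {M : DerivedCategory (ModuleCat.{0} R)} (hM : M ∈ Db R) :
    ∃ f ∉ p, ∀ (S : ShortComplex (ModuleCat.{0} R)) (hS : S.ShortExact),
      IsInvertibleOn f S.X₁ → ∀ (i j : ℤ)
        (u : M⟦i⟧ ⟶ ((singleFunctor (ModuleCat.{0} R) 0).obj S.X₃)⟦j⟧),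
        u ≫ hS.singleδ⟦j⟧' = 0 := by
  have hpp : p.IsPrime := hp.1.1
  obtain ⟨⟨a, b, hab⟩, hfin⟩ := hM
  have key : ∀ s : Finset ℤ, ∃ f ∉ p, ∀ n ∈ s,
      ExtVanishing f ((homologyFunctor (ModuleCat.{0} R) n).obj M) := by
    intro s
    induction s using Finset.induction_on with
    | empty => exact ⟨1, (Ideal.ne_top_iff_one _).1 hpp.ne_top, by simp⟩
    | insert m s _ ih =>
      obtain ⟨f, hf, h⟩ := ih
      have := hfin m
      obtain ⟨g, hg, h'⟩ := exists_extVanishing hp ((homologyFunctor (ModuleCat.{0} R) m).obj M)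
      refine ⟨f * g, fun hfg => (hpp.mem_or_mem hfg).elim hf hg, fun n hn => ?_⟩
      rcases Finset.mem_insert.1 hn with rfl | hn
      · exact h'.of_dvd (dvd_mul_left _ _)
      · exact (h n hn).of_dvd (dvd_mul_right _ _)
  obtain ⟨f, hf, h⟩ := key (Finset.Icc a b)
  have hX : ∀ n, ExtVanishing f ((homologyFunctor (ModuleCat.{0} R) n).obj M) := by
    intro n
    by_cases hn : n ∈ Finset.Icc a b
    · exact h n hn
    · refine .of_isZero f (hab n ?_)
      rw [Finset.mem_Icc] at hn
      lia
  refine ⟨f, hf, fun S hS hS₁ i j u => ?_⟩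
  have hk : b ≤ a + (b + 1 - a).toNat - 1 := by lia
  have hGE : M.IsGE a := (isGE_iff _ _).2 fun n hn => hab n (Or.inl hn)
  have hLE : M.IsLE (a + (b + 1 - a).toNat - 1) :=
    (isLE_iff _ _).2 fun n hn => hab n (Or.inr (by lia))
  refine comp_singleδ_shift_eq_zero hS hS₁ (a - i) (b + 1 - a).toNat (M⟦i⟧)
    (TStructure.t.isGE_shift M a i (a - i) (by lia))
    (TStructure.t.isLE_shift M (a + (b + 1 - a).toNat - 1) i _ (by lia))
    (fun n => (hX (i + n)).of_iso ?_) j u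
  exact (((homologyFunctor (ModuleCat.{0} R) 0).shiftIso i n (i + n) rfl).app M).symm

lemma IsInvertibleOn.quotSMulTop {f r : R} {N : Type} [AddCommGroup N] [Module R N]
    (h : IsInvertibleOn f N) : IsInvertibleOn f (QuotSMulTop r N) := by
  constructor
  · intro x y hxy
    obtain ⟨x, rfl⟩ := Submodule.mkQ_surjective _ x
    obtain ⟨y, rfl⟩ := Submodule.mkQ_surjective _ y
    have h1 : f • x - f • y ∈ r • (⊤ : Submodule R N) := by
      rw [← Submodule.Quotient.eq]
      exact hxy
    obtain ⟨z, -, hz⟩ := (Submodule.mem_smul_pointwise_iff_exists _ _ _).1 h1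
    obtain ⟨w, rfl⟩ := h.2 z
    refine (Submodule.Quotient.eq _).2 ((Submodule.mem_smul_pointwise_iff_exists _ _ _).2
      ⟨w, trivial, h.1 ?_⟩)
    change f • r • w = f • (x - y)
    rw [smul_sub, ← hz, smul_comm]
  · intro y
    obtain ⟨y, rfl⟩ := Submodule.mkQ_surjective _ y
    obtain ⟨x, rfl⟩ := h.2 y
    exact ⟨Submodule.mkQ _ x, rfl⟩

lemma IsLevelGhost.comp_extClass {M : DerivedCategory (ModuleCat.{0} R)} {f : R}
    (hM : ∀ (S : ShortComplex (ModuleCat.{0} R)) (hS : S.ShortExact),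
      IsInvertibleOn f S.X₁ → ∀ (i j : ℤ)
        (u : M⟦i⟧ ⟶ ((singleFunctor (ModuleCat.{0} R) 0).obj S.X₃)⟦j⟧),
        u ≫ hS.singleδ⟦j⟧' = 0)
    {S : ShortComplex (ModuleCat.{0} R)} (hS : S.ShortExact) (hf : IsInvertibleOn f S.X₁)
    {T : ModuleCat.{0} R} {n : ℕ} {x : Ext T S.X₃ n} (hx : IsLevelGhost M n x.hom) :
    IsLevelGhost M (n + 1) (x.comp hS.extClass rfl).hom := by
  intro Z hZ u
  have h := hx.comp (fun i u => hM S hS hf i (n : ℤ) u) Z hZ u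
  rw [Ext.comp_hom, ShortComplex.ShortExact.extClass_hom, ShiftedHom.comp, ← Category.assoc x.hom,
    ← Category.assoc u]
  exact h =≫ _ |>.trans zero_comp

lemma exists_ext_ne_zero_isLevelGhost {M : DerivedCategory (ModuleCat.{0} R)} {f : R}
    (hM : ∀ (S : ShortComplex (ModuleCat.{0} R)) (hS : S.ShortExact),
      IsInvertibleOn f S.X₁ → ∀ (i j : ℤ)
        (u : M⟦i⟧ ⟶ ((singleFunctor (ModuleCat.{0} R) 0).obj S.X₃)⟦j⟧),
        u ≫ hS.singleδ⟦j⟧' = 0)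
    (T : ModuleCat.{0} R) (rs : List R) (hT : ∀ r ∈ rs, ∀ x : T, r • x = 0)
    (N : ModuleCat.{0} R) (hfN : IsInvertibleOn f N) (hN : IsWeaklyRegular N rs)
    (α : T →ₗ[R] N ⧸ (Ideal.ofList rs • ⊤ : Submodule R N)) (hα : α ≠ 0) :
    ∃ x : Ext T N rs.length, x ≠ 0 ∧ IsLevelGhost M rs.length x.hom := by
  induction rs generalizing N with
  | nil =>
    let e : (N ⧸ (Ideal.ofList ([] : List R) • ⊤ : Submodule R N)) ≃ₗ[R] N :=
      Submodule.quotEquivOfEqBot _ (by rw [Ideal.ofList_nil, Submodule.bot_smul])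
    refine ⟨Ext.mk₀ (ModuleCat.ofHom (e.toLinearMap ∘ₗ α)), fun h => hα ?_, isLevelGhost_zero _ _⟩
    have h' : (ModuleCat.ofHom (e.toLinearMap ∘ₗ α) : T ⟶ N) = 0 := (Ext.mk₀_eq_zero_iff _).1 h
    refine LinearMap.ext fun x => e.injective ?_
    rw [LinearMap.zero_apply, map_zero]
    exact congrArg (fun g : T ⟶ N => g x) h'
  | cons r rs ih =>
    rw [isWeaklyRegular_cons_iff] at hN
    obtain ⟨hr, hN⟩ := hN
    have hS := hr.smulShortComplex_shortExact
    let e := Submodule.quotOfListConsSMulTopEquivQuotSMulTopInner N r rs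
    obtain ⟨x, hx0, hx⟩ : ∃ x : Ext T (N.smulShortComplex r).X₃ rs.length,
        x ≠ 0 ∧ IsLevelGhost M rs.length x.hom := ih (fun s hs => hT s (List.mem_cons_of_mem _ hs))
      (ModuleCat.of R (QuotSMulTop r N)) hfN.quotSMulTop hN (e.toLinearMap ∘ₗ α)
      (fun h => hα (LinearMap.ext fun x => e.injective (by
        rw [LinearMap.zero_apply, map_zero]
        exact LinearMap.congr_fun h x)))
    refine ⟨x.comp hS.extClass rfl, fun h0 => ?_, ?_⟩
    · obtain ⟨y, hy⟩ := Ext.covariant_sequence_exact₃ T hS x rfl h0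
      have : Subsingleton (Ext T N rs.length) :=
        subsingleton_ext_of_isWeaklyRegular (r :: rs) hT N
          ((isWeaklyRegular_cons_iff ..).2 ⟨hr, hN⟩) _ (by simp)
      have hy0 : y = 0 := Subsingleton.elim (α := Ext T N rs.length) _ _
      rw [hy0, Ext.zero_comp] at hy
      exact hx0 hy.symm
    · exact hx.comp_extClass hM hS hfN

end GhostChain

section LowerBound

open CategoryTheory.Abelian DerivedCategory RingTheory.Sequence
open scoped Pointwise

variable {R : Type} [CommRing R]

lemma singleFunctor_obj_mem_Db (T : ModuleCat.{0} R) [Module.Finite R T] :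
    (singleFunctor (ModuleCat.{0} R) 0).obj T ∈ Db R := by
  have h0 : ∀ n : ℤ, n < 0 ∨ 0 < n → IsZero ((homologyFunctor (ModuleCat.{0} R) n).obj
      ((singleFunctor (ModuleCat.{0} R) 0).obj T)) := by
    rintro n (hn | hn)
    · exact isZero_of_isGE _ 0 n hn
    · exact isZero_of_isLE _ 0 n hn
  refine ⟨⟨0, 0, h0⟩, fun n => ?_⟩
  rcases lt_trichotomy n 0 with hn | rfl | hn
  · have := ModuleCat.subsingleton_of_isZero (h0 n (Or.inl hn))
    infer_instance
  · exact Module.Finite.equiv (M := T)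
      ((singleFunctorCompHomologyFunctorIso (ModuleCat.{0} R) 0).app T).symm.toLinearEquiv
  · have := ModuleCat.subsingleton_of_isZero (h0 n (Or.inr hn))
    infer_instance

/-- If some component of a reduced noetherian ring `R` carries, generically, regular sequences of
length `d + 1`, then `D^b(mod R)` has dimension greater than `d`. -/
lemma not_dimLE_Db_of_isRegular [IsReduced R] [IsNoetherianRing R] {p : Ideal R}
    (hp : p ∈ minimalPrimes R) {d : ℕ}
    (h : ∀ f ∉ p, ∃ (N : ModuleCat.{0} R) (rs : List R),
      rs.length = d + 1 ∧ IsInvertibleOn f N ∧ IsRegular N rs) :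
    ¬ dimLE (DerivedCategory (ModuleCat.{0} R)) (Db R) d := by
  rintro ⟨M, hM, hlevel⟩
  obtain ⟨f, hf, hfM⟩ := exists_comp_singleδ_shift_eq_zero hp hM
  obtain ⟨N, rs, hrs, hfN, hN⟩ := h f hf
  let T := ModuleCat.of R (R ⧸ Ideal.ofList rs)
  obtain ⟨z, hz⟩ : ∃ z : N, z ∉ (Ideal.ofList rs • ⊤ : Submodule R N) := by
    by_contra! hall
    exact hN.top_ne_smul (eq_top_iff.2 fun z _ => hall z).symm
  let z' : N ⧸ (Ideal.ofList rs • ⊤ : Submodule R N) := Submodule.Quotient.mk z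
  let α : T →ₗ[R] N ⧸ (Ideal.ofList rs • ⊤ : Submodule R N) :=
    (Ideal.ofList rs).liftQ (LinearMap.toSpanSingleton R _ z') fun r hr =>
      (Submodule.Quotient.mk_eq_zero _).2 (Submodule.smul_mem_smul hr trivial)
  have hα : α ≠ 0 := by
    intro h0
    have h1 : (1 : R) • z' = 0 := LinearMap.congr_fun h0 (Submodule.Quotient.mk 1)
    rw [one_smul] at h1
    exact hz ((Submodule.Quotient.mk_eq_zero _).1 h1)
  have hT : ∀ r ∈ rs, ∀ x : T, r • x = 0 := by
    intro r hr x
    obtain ⟨x, rfl⟩ := Submodule.mkQ_surjective _ x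
    exact (Submodule.Quotient.mk_eq_zero _).2
      (Ideal.mul_mem_right _ _ (Ideal.subset_span (by simpa using hr)))
  obtain ⟨x, hx0, hx⟩ := exists_ext_ne_zero_isLevelGhost hfM T rs hT N hfN hN.toIsWeaklyRegular α hα
  have : Module.Finite R T := inferInstanceAs (Module.Finite R (R ⧸ Ideal.ofList rs))
  refine hx0 (Ext.ext ?_)
  rw [Ext.zero_hom, ← Category.id_comp x.hom]
  refine hx _ ?_ _
  rw [hrs, hlevel]
  exact singleFunctor_obj_mem_Db T

end LowerBound

section CommutativeAlgebra

open RingTheory.Sequence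
open scoped Pointwise

lemma Polynomial.isWeaklyRegular_map_C_append_of_monic {S : Type*} [CommRing S] {rs : List S}
    (hrs : IsWeaklyRegular S rs) {h : Polynomial S} (hh : h.Monic) :
    IsWeaklyRegular (Polynomial S) (rs.map Polynomial.C ++ [h]) := by
  rw [isWeaklyRegular_append_iff, isWeaklyRegular_singleton_iff]
  refine ⟨hrs.of_flat, (isSMulRegular_quotient_iff_mem_of_smul_mem _ _).2 fun q hq => ?_⟩
  rw [smul_eq_mul, Ideal.mul_top, ← Ideal.map_ofList] at hq ⊢
  rw [← Ideal.mk_ker (I := Ideal.ofList rs), ← Polynomial.ker_mapRingHom, RingHom.mem_ker] at hq ⊢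
  rw [smul_eq_mul, map_mul] at hq
  exact ((hh.map _).mul_right_eq_zero_iff).1 hq

/-- The maximal ideal of an algebraic point of affine space is generated by a regular sequence;
here we only record that the sequence is weakly regular and vanishes at the point. -/
lemma MvPolynomial.exists_isWeaklyRegular_aeval_eq_zero (k : Type*) {K : Type*} [Field k] [Field K]
    [Algebra k K] [Algebra.IsIntegral k K] {s : ℕ} (c : Fin s → K) :
    ∃ rs : List (MvPolynomial (Fin s) k), rs.length = s ∧
      IsWeaklyRegular (MvPolynomial (Fin s) k) rs ∧ ∀ r ∈ rs, aeval c r = 0 := by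
  induction s with
  | zero => exact ⟨[], rfl, IsWeaklyRegular.nil _ _, by simp⟩
  | succ s ih =>
    obtain ⟨rs, hlen, hreg, hrs⟩ := ih (fun i => c i.succ)
    have hh : ((minpoly k (c 0)).map (algebraMap k (MvPolynomial (Fin s) k))).Monic :=
      (minpoly.monic (Algebra.IsIntegral.isIntegral _)).map _
    refine ⟨rs.map (rename Fin.succ) ++ [Polynomial.aeval (X 0) (minpoly k (c 0))],
      by simp [hlen], ?_, ?_⟩
    · let e := (finSuccEquiv k s).toRingEquiv
      have hC (r : MvPolynomial (Fin s) k) :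
          finSuccEquiv k s (rename Fin.succ r) = Polynomial.C r := by
        have : (finSuccEquiv k s).toAlgHom.comp (rename Fin.succ) =
            IsScalarTower.toAlgHom k (MvPolynomial (Fin s) k) _ :=
          algHom_ext fun i => by simp [finSuccEquiv_X_succ]
        exact DFunLike.congr_fun this r
      have hX : finSuccEquiv k s (Polynomial.aeval (X 0) (minpoly k (c 0))) =
          (minpoly k (c 0)).map (algebraMap k (MvPolynomial (Fin s) k)) := by
        rw [← Polynomial.aeval_algHom_apply, finSuccEquiv_X_zero, Polynomial.aeval_X_left_eq_map]
      refine ((finSuccEquiv k s).toAddEquiv.isWeaklyRegular_congr (bs := _) ?_).2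
        (Polynomial.isWeaklyRegular_map_C_append_of_monic hreg hh)
      refine List.rel_append ?_ (List.Forall₂.cons (fun x => ?_) .nil)
      · rw [List.forall₂_map_left_iff, List.forall₂_map_right_iff, List.forall₂_same]
        intro r _ x
        change finSuccEquiv k s (_ * x) = _ * finSuccEquiv k s x
        rw [map_mul, hC]
      · change finSuccEquiv k s (_ * x) = _ * finSuccEquiv k s x
        rw [map_mul, hX]
    · intro r hr
      rcases List.mem_append.1 hr with hr | hr
      · obtain ⟨q, hq, rfl⟩ := List.mem_map.1 hr
        rw [aeval_rename]
        exact hrs q hq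
      · rw [List.mem_singleton.1 hr, ← Polynomial.aeval_algHom_apply, aeval_X, minpoly.aeval]

/-- Homomorphisms to an algebraically closed field extend along injective integral extensions. -/
lemma exists_ringHom_comp_algebraMap_eq {P B K : Type*} [CommRing P] [CommRing B] [Algebra P B]
    [Algebra.IsIntegral P B] [FaithfulSMul P B] [Field K] [IsAlgClosed K] (φ : P →+* K) :
    ∃ ψ : B →+* K, ψ.comp (algebraMap P B) = φ := by
  have hprime : (RingHom.ker φ).IsPrime := RingHom.ker_isPrime φ
  obtain ⟨Q, -, hQ, hQφ⟩ := Ideal.exists_ideal_over_prime_of_isIntegral (S := B) (RingHom.ker φ) ⊥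
    (by rw [← RingHom.ker_eq_comap_bot, (RingHom.injective_iff_ker_eq_bot _).1
      (FaithfulSMul.algebraMap_injective P B)]; exact bot_le)
  have hlo : Q.LiesOver (RingHom.ker φ) := ⟨hQφ.symm⟩
  let _ : Algebra (P ⧸ RingHom.ker φ) K := (RingHom.kerLift φ).toAlgebra
  have : FaithfulSMul (P ⧸ RingHom.ker φ) K :=
    (faithfulSMul_iff_algebraMap_injective _ _).2 (RingHom.kerLift_injective φ)
  have : FaithfulSMul (P ⧸ RingHom.ker φ) (B ⧸ Q) := inferInstance
  have : Module.IsTorsionFree (P ⧸ RingHom.ker φ) (B ⧸ Q) := FaithfulSMul.to_isTorsionFree _ _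
  have : Module.IsTorsionFree (P ⧸ RingHom.ker φ) K := FaithfulSMul.to_isTorsionFree _ _
  let l : B ⧸ Q →ₐ[P ⧸ RingHom.ker φ] K := IsAlgClosed.lift
  refine ⟨l.toRingHom.comp (Ideal.Quotient.mk Q), RingHom.ext fun x => ?_⟩
  exact l.commutes (Ideal.Quotient.mk _ x)

/-- Generic freeness for finite modules over a domain, in terms of flatness. -/
lemma exists_flat_localization_away {P B : Type*} [CommRing P] [IsDomain P] [IsNoetherianRing P]
    [CommRing B] [Algebra P B] [Module.Finite P B] :
    ∃ g : P, g ≠ 0 ∧ Module.Flat P (Localization.Away (algebraMap P B g)) := by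
  have : Module.FinitePresentation P B := Module.finitePresentation_of_finite P B
  obtain ⟨g, hg, hfree, -⟩ := Module.FinitePresentation.exists_free_localizedModule_powers
    (nonZeroDivisors P) (LocalizedModule.mkLinearMap (nonZeroDivisors P) B) (FractionRing P)
  refine ⟨g, nonZeroDivisors.ne_zero hg, ?_⟩
  have : Module.Flat P (LocalizedModule.Away g B) :=
    Module.Flat.trans P (Localization (Submonoid.powers g)) _
  have : IsLocalization (Algebra.algebraMapSubmonoid B (Submonoid.powers g))
      (Localization.Away (algebraMap P B g)) := by
    rw [Algebra.algebraMapSubmonoid, Submonoid.map_powers]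
    infer_instance
  have := isLocalizedModule_iff_isLocalization.2 this
  exact Module.Flat.of_linearEquiv (IsLocalizedModule.linearEquiv (Submonoid.powers g)
    (LocalizedModule.mkLinearMap (Submonoid.powers g) B)
    (IsScalarTower.toAlgHom P B (Localization.Away (algebraMap P B g))).toLinearMap).symm

lemma ringKrullDim_le_of_isIntegral (P B : Type*) [CommRing P] [CommRing B] [Algebra P B]
    [Algebra.IsIntegral P B] : ringKrullDim B ≤ ringKrullDim P :=
  Order.krullDim_le_of_strictMono (PrimeSpectrum.comap (algebraMap P B)) fun I J h =>
    Ideal.IsIntegral.comap_lt_comap (I := I.asIdeal) (J := J.asIdeal) h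

lemma exists_minimalPrimes_le_ringKrullDim_quotient {A : Type*} [CommRing A] {n : ℕ}
    (h : (n : WithBot ℕ∞) ≤ ringKrullDim A) :
    ∃ p ∈ minimalPrimes A, (n : WithBot ℕ∞) ≤ ringKrullDim (A ⧸ p) := by
  obtain ⟨l, hl⟩ := Order.le_krullDim_iff.1 h
  obtain ⟨p, hp, hpl⟩ := Ideal.exists_minimalPrimes_le (I := ⊥) (J := l.head.asIdeal) bot_le
  refine ⟨p, hp, ?_⟩
  rw [ringKrullDim_quotient]
  refine Order.le_krullDim_iff.2 ⟨⟨l.length, fun i => ⟨l i, fun x hx => ?_⟩, fun i => l.step i⟩, hl⟩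
  exact (l.head_le i : l.head ≤ l i) (hpl hx)

lemma MvPolynomial.exists_aeval_ne_zero (K : Type*) {k : Type*} [Field k] [Field K] [Infinite K]
    [Algebra k K] {ι : Type*} {g : MvPolynomial ι k} (hg : g ≠ 0) : ∃ c : ι → K, aeval c g ≠ 0 := by
  by_contra! h
  refine hg (map_injective _ (algebraMap k K).injective ?_)
  rw [map_zero]
  refine MvPolynomial.funext fun c => ?_
  rw [eval_map, map_zero]
  exact h c

/-- Every dense open subset of an affine variety of dimension at least `n` carries a regular
sequence of length `n`. -/
lemma exists_isRegular_of_le_ringKrullDim_quotient (k : Type) [Field k] {A : Type} [CommRing A]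
    [Algebra k A] [Algebra.FiniteType k A] {p : Ideal A} [p.IsPrime] {n : ℕ}
    (hn : (n : WithBot ℕ∞) ≤ ringKrullDim (A ⧸ p)) {f : A} (hf : f ∉ p) :
    ∃ (N : ModuleCat.{0} A) (rs : List A),
      rs.length = n ∧ IsInvertibleOn f N ∧ IsRegular N rs := by
  obtain ⟨s, φ, hφ, hφfin⟩ := exists_finite_inj_algHom_of_fg k (A ⧸ p)
  let P := MvPolynomial (Fin s) k
  let K := AlgebraicClosure k
  let _ : Algebra P (A ⧸ p) := φ.toRingHom.toAlgebra
  have : Module.Finite P (A ⧸ p) := hφfin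
  have : FaithfulSMul P (A ⧸ p) := (faithfulSMul_iff_algebraMap_injective _ _).2 hφ
  have hns : n ≤ s := by
    have h := hn.trans (ringKrullDim_le_of_isIntegral P (A ⧸ p))
    rw [MvPolynomial.ringKrullDim_of_isNoetherianRing, ringKrullDim_eq_zero_of_field, zero_add,
      Nat.card_fin] at h
    exact_mod_cast h
  obtain ⟨g, hg, hflat⟩ := exists_flat_localization_away (P := P) (B := A ⧸ p)
  obtain ⟨g', hg', hfg⟩ := (Algebra.IsAlgebraic.isAlgebraic (R := P)
    (Ideal.Quotient.mk p f)).exists_nonzero_dvd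
      (mem_nonZeroDivisors_of_ne_zero (mt Ideal.Quotient.eq_zero_iff_mem.1 hf))
  let N₁ := Localization.Away (algebraMap P (A ⧸ p) g)
  let N := Localization.Away (algebraMap (A ⧸ p) N₁ (algebraMap P (A ⧸ p) g'))
  have : Module.Flat P N := Module.Flat.trans P N₁ N
  obtain ⟨c, hc⟩ := MvPolynomial.exists_aeval_ne_zero K (mul_ne_zero hg hg')
  rw [map_mul] at hc
  obtain ⟨ψ, hψ⟩ := exists_ringHom_comp_algebraMap_eq (B := A ⧸ p)
    (MvPolynomial.aeval c : P →ₐ[k] K).toRingHom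
  have hψ' (q : P) : ψ (algebraMap P (A ⧸ p) q) = MvPolynomial.aeval c q :=
    RingHom.congr_fun hψ q
  let ψ₁ : N₁ →+* K := IsLocalization.Away.lift (algebraMap P (A ⧸ p) g) (g := ψ)
    (by rw [hψ']; exact (left_ne_zero_of_mul hc).isUnit)
  have hψ₁ (b : A ⧸ p) : ψ₁ (algebraMap _ N₁ b) = ψ b := IsLocalization.Away.lift_eq _ _ _
  let Ψ : N →+* K := IsLocalization.Away.lift
    (algebraMap (A ⧸ p) N₁ (algebraMap P (A ⧸ p) g')) (g := ψ₁)
    (by rw [hψ₁, hψ']; exact (right_ne_zero_of_mul hc).isUnit)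
  have hΨ (b : A ⧸ p) : Ψ (algebraMap _ N b) = ψ b := by
    rw [← hψ₁, IsScalarTower.algebraMap_apply (A ⧸ p) N₁ N]
    exact IsLocalization.Away.lift_eq _ _ _
  obtain ⟨rs, hlen, hreg, hrs⟩ := MvPolynomial.exists_isWeaklyRegular_aeval_eq_zero k c
  obtain ⟨σ, hσ⟩ := (Ideal.Quotient.mk_surjective (I := p)).hasRightInverse
  have hN : IsWeaklyRegular N ((rs.take n).map (algebraMap P N)) := by
    refine IsWeaklyRegular.of_flat ?_
    rw [← List.take_append_drop n rs, isWeaklyRegular_append_iff] at hreg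
    exact hreg.1
  have hσN (q : P) : algebraMap A N (σ (algebraMap P (A ⧸ p) q)) = algebraMap P N q := by
    rw [IsScalarTower.algebraMap_apply A (A ⧸ p) N, IsScalarTower.algebraMap_apply P (A ⧸ p) N]
    exact congrArg _ (hσ _)
  refine ⟨ModuleCat.of A N, (rs.take n).map fun q => σ (algebraMap P (A ⧸ p) q), by simp [hlen, hns],
    ?_, ?_, ?_⟩
  · have hu : IsUnit (algebraMap A N f) := by
      refine isUnit_of_dvd_unit (?_ : _ ∣ algebraMap (A ⧸ p) N (algebraMap P (A ⧸ p) g')) ?_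
      · rw [IsScalarTower.algebraMap_apply A (A ⧸ p) N]
        exact map_dvd _ hfg
      · rw [IsScalarTower.algebraMap_apply (A ⧸ p) N₁ N]
        exact IsLocalization.Away.algebraMap_isUnit _
    have h : Function.Bijective fun x : N => algebraMap A N f * x := hu.unit.mulLeft_bijective
    have e : (fun x : N => algebraMap A N f * x) = fun x => f • x :=
      _root_.funext fun x => (Algebra.smul_def f x).symm
    rw [e] at h
    exact h
  · refine (isWeaklyRegular_map_algebraMap_iff N N _).1 ?_
    rw [List.map_map]
    convert hN using 2
    exact _root_.funext hσN
  · intro h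
    have hle : (Ideal.ofList ((rs.take n).map fun q => σ (algebraMap P (A ⧸ p) q)) • ⊤ :
        Submodule A N) ≤ (RingHom.ker Ψ).restrictScalars A := by
      refine Submodule.smul_le.2 fun a ha x _ => ?_
      have ha' : Ψ (algebraMap A N a) = 0 := by
        refine (Ideal.span_le (I := RingHom.ker (Ψ.comp (algebraMap A N)))).2 ?_ ha
        intro b hb
        obtain ⟨q, hq, rfl⟩ := List.mem_map.1 hb
        change Ψ (algebraMap A N _) = 0
        rw [hσN, IsScalarTower.algebraMap_apply P (A ⧸ p) N, hΨ, hψ']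
        exact hrs q (List.mem_of_mem_take hq)
      refine (congrArg Ψ (Algebra.smul_def (A := N) a x)).trans ?_
      rw [map_mul, ha', zero_mul]
    have h1 : Ψ 1 = 0 := hle (h ▸ Submodule.mem_top (x := (1 : N)))
    exact one_ne_zero ((map_one Ψ).symm.trans h1)

end CommutativeAlgebra

/-- **Rouquier**: for a reduced finitely generated commutative algebra `A` over a perfect
field `k`, the dimension of the bounded derived category `D^b(mod A)` is at least the
Krull dimension of `A` (the affine case of the lower bound for reduced separated schemes
of finite type over a perfect field). -/
theorem krullDim_le_dim_Db_of_reduced (k : Type) [Field k] [PerfectField k]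
    (A : Type) [CommRing A] [Algebra k A] [Algebra.FiniteType k A] [IsReduced A] :
    ringKrullDim A ≤ (trdim _ (Db A) : WithBot ℕ∞) := by
  have : IsNoetherianRing A := Algebra.FiniteType.isNoetherianRing k A
  by_contra! hlt
  have hne : trdim _ (Db A) ≠ ⊤ := fun h => by
    rw [h] at hlt
    exact not_top_lt hlt
  obtain ⟨d, hd, hdeq⟩ : trdim _ (Db A) ∈ ((↑) '' {d : ℕ | dimLE _ (Db A) d} : Set ℕ∞) := by
    refine csInf_mem (Set.nonempty_iff_ne_empty.2 fun h => hne ?_)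
    rw [trdim, h, sInf_empty]
  rw [← hdeq] at hlt
  have hle : ((d + 1 : ℕ) : WithBot ℕ∞) ≤ ringKrullDim A := by
    generalize ringKrullDim A = x at hlt
    induction x with
    | bot => exact absurd hlt not_lt_bot
    | coe x =>
      have h : (d : ℕ∞) < x := WithBot.coe_lt_coe.1 hlt
      exact WithBot.coe_le_coe.2 (by exact_mod_cast Order.add_one_le_of_lt h)
  obtain ⟨p, hp, hdim⟩ := exists_minimalPrimes_le_ringKrullDim_quotient hle
  have := hp.1.1
  exact not_dimLE_Db_of_isRegular hp
    (fun f hf => exists_isRegular_of_le_ringKrullDim_quotient k hdim hf) hd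
end

section
/- Let k be a perfect field and let A be a finitely generated commutative k-algebra. Then dim D^b(mod A) < ∞; that is, there exists an object M of D^b(mod A) and an integer d ≥ 0 such that ⟨M⟩_{d+1} = D^b(mod A). (This is the affine case of the finiteness of the dimension of D^b(X) for X a separated scheme of finite type over a perfect field.) -/
/-!
Dimension of triangulated categories (Rouquier): the bounded derived category of
finitely generated modules over a finitely generated commutative algebra over a
perfect field has finite dimension.
-/

open CategoryTheory CategoryTheory.Limits CategoryTheory.Pretriangulated

variable (A : Type) [Ring A]

namespace CategoryTheory.ObjectProperty

section

variable {C : Type*} [Category C]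

instance isClosedUnderBinaryProducts_retractClosure [HasBinaryProducts C] (P : ObjectProperty C)
    [P.IsClosedUnderBinaryProducts] : P.retractClosure.IsClosedUnderBinaryProducts := by
  suffices h : P.retractClosure.strictLimitsOfShape (Discrete WalkingPair) ≤ P.retractClosure from
    .mk' h
  rintro X ⟨F, hF⟩
  obtain ⟨Y₁, h₁, ⟨r₁⟩⟩ := hF ⟨.left⟩
  obtain ⟨Y₂, h₂, ⟨r₂⟩⟩ := hF ⟨.right⟩
  refine prop_of_iso _ (HasLimit.isoOfNatIso (diagramIsoPair F)).symm ?_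
  refine ⟨Y₁ ⨯ Y₂, prop_prod P _ _ h₁ h₂, ⟨⟨prod.map r₁.i r₂.i, prod.map r₁.r r₂.r, ?_⟩⟩⟩
  ext <;> simp

lemma isRetract_of_retract {X Y : C} (r : Retract X Y) : IsRetract C X Y := ⟨r.i, r.r, r.retract⟩

variable [HasZeroObject C] [Preadditive C] [HasShift C ℤ]
  [∀ n : ℤ, (shiftFunctor C n).Additive] [Pretriangulated C]

instance isClosedUnderBinaryProducts_extensionProduct (P Q : ObjectProperty C)
    [P.IsClosedUnderBinaryProducts] [Q.IsClosedUnderBinaryProducts] :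
    (extensionProduct P Q).IsClosedUnderBinaryProducts := by
  suffices h : (extensionProduct P Q).strictLimitsOfShape (Discrete WalkingPair) ≤
    extensionProduct P Q from .mk' h
  rintro X ⟨F, hF⟩
  choose A B f g h hT hA hB using fun j ↦ hF ⟨j⟩
  have hT' := productTriangle_distinguished (fun j ↦ Triangle.mk (f j) (g j) (h j)) hT
  refine prop_of_iso _ (HasLimit.isoOfNatIso (Discrete.natIso fun _ ↦ Iso.refl _))
    (X := ∏ᶜ fun j ↦ F.obj ⟨j⟩) ?_
  refine ⟨_, _, _, _, _, hT', ?_, ?_⟩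
  · exact P.prop_limit _ (fun j ↦ hA j.as)
  · exact Q.prop_limit _ (fun j ↦ hB j.as)

instance isClosedUnderBinaryProducts_extensionProductIter (P : ObjectProperty C)
    [P.IsClosedUnderBinaryProducts] (n : ℕ) :
    (extensionProductIter P n).IsClosedUnderBinaryProducts := by
  induction n with
  | zero => simpa
  | succ n ih => rw [extensionProductIter_succ]; infer_instance

variable (P : ObjectProperty C)

instance isClosedUnderBinaryProducts_triangEnvelopeIter (n : ℕ) :
    (P.triangEnvelopeIter n).IsClosedUnderBinaryProducts := by
  have : (P.shiftClosure ℤ).binaryProductsClosure.IsClosedUnderBinaryProducts := by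
    infer_instance
  infer_instance

lemma triangEnvelopeIter_shift {n : ℕ} {X : C} (hX : P.triangEnvelopeIter n X) (a : ℤ) :
    P.triangEnvelopeIter n (X⟦a⟧) :=
  (P.triangEnvelopeIter n).le_shift a _ hX

lemma triangEnvelopeIter_of_distinguished [IsTriangulated C] {n m : ℕ} {T : Triangle C}
    (hT : T ∈ distTriang C) (h₁ : P.triangEnvelopeIter n T.obj₁)
    (h₃ : P.triangEnvelopeIter m T.obj₃) : P.triangEnvelopeIter (n + m + 1) T.obj₂ := by
  rw [Nat.add_right_comm, triangEnvelopeIter_add P (n := n + 1) (n' := n) rfl]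
  exact le_retractClosure _ _ ⟨_, _, _, _, _, hT, h₁, h₃⟩

lemma triangEnvelopeIter_of_isZero {n : ℕ} (hP : P.Nonempty) {X : C} (hX : IsZero X) :
    P.triangEnvelopeIter n X := by
  obtain ⟨Y, hY⟩ := hP
  exact (P.triangEnvelopeIter n).prop_of_retract ⟨0, 0, hX.eq_of_src _ _⟩
    (P.le_triangEnvelopeIter n _ hY)

lemma triangEnvelopeIter_le_of_le [IsTriangulated C] {P Q : ObjectProperty C} {n : ℕ}
    (hP : P ≤ Q.triangEnvelopeIter n) (hQ : Q.Nonempty) (m : ℕ) :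
    ∃ r, P.triangEnvelopeIter m ≤ Q.triangEnvelopeIter r := by
  have h0 : P.triangEnvelopeIter 0 ≤ Q.triangEnvelopeIter n := by
    have : (Q.triangEnvelopeIter n).IsClosedUnderLimitsOfShape (Discrete PEmpty.{1}) := by
      suffices h : (Q.triangEnvelopeIter n).strictLimitsOfShape (Discrete PEmpty.{1}) ≤
        Q.triangEnvelopeIter n from .mk' h
      rintro X ⟨F, hF⟩
      refine Q.triangEnvelopeIter_of_isZero hQ ?_
      rw [IsZero.iff_id_eq_zero]
      ext j
      exact j.as.elim
    rw [triangEnvelopeIter_zero, retractClosure_le_iff, binaryProductsClosure_le_iff,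
      shiftClosure_le_iff]
    exact hP
  induction m with
  | zero => exact ⟨n, h0⟩
  | succ m ih =>
    obtain ⟨r, hr⟩ := ih
    refine ⟨n + r + 1, ?_⟩
    rw [triangEnvelopeIter_succ, retractClosure_le_iff]
    rintro X ⟨Y, Z, f, g, h, hT, h₁, h₃⟩
    exact Q.triangEnvelopeIter_of_distinguished hT (h0 _ (by simpa using h₁)) (hr _ h₃)

/-- All objects of `P` are built in boundedly many steps from a single object satisfying `D`. -/
def BoundedlyGenerated (D P : ObjectProperty C) : Prop :=
  ∃ M, D M ∧ ∃ n, P ≤ (singleton M).triangEnvelopeIter n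

namespace BoundedlyGenerated

variable {D P} {Q : ObjectProperty C}

lemma mono (hQ : BoundedlyGenerated D Q) (h : P ≤ Q) : BoundedlyGenerated D P := by
  obtain ⟨M, hM, n, hn⟩ := hQ
  exact ⟨M, hM, n, h.trans hn⟩

lemma of_prop {M : C} (hM : D M) (h : P ≤ (singleton M).isoClosure) : BoundedlyGenerated D P := by
  refine ⟨M, hM, 0, h.trans ?_⟩
  rw [isoClosure_le_iff]
  exact le_triangEnvelopeIter _ _

lemma triangEnvelopeIter [IsTriangulated C] (h : BoundedlyGenerated D P) (n : ℕ) :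
    BoundedlyGenerated D (P.triangEnvelopeIter n) := by
  obtain ⟨M, hM, m, hm⟩ := h
  exact ⟨M, hM, triangEnvelopeIter_le_of_le hm inferInstance n⟩

lemma sup (hD : ∀ X Y, D X → D Y → D (X ⊞ Y))
    (hP : BoundedlyGenerated D P) (hQ : BoundedlyGenerated D Q) [IsTriangulated C] :
    BoundedlyGenerated D (P ⊔ Q) := by
  obtain ⟨M, hM, n, hn⟩ := hP
  obtain ⟨N, hN, m, hm⟩ := hQ
  have h₁ : singleton M ≤ (singleton (M ⊞ N)).triangEnvelopeIter 0 := by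
    rintro _ ⟨_⟩
    exact prop_of_retract _ ⟨biprod.inl, biprod.fst, by simp⟩ (le_triangEnvelopeIter _ 0 _ ⟨()⟩)
  have h₂ : singleton N ≤ (singleton (M ⊞ N)).triangEnvelopeIter 0 := by
    rintro _ ⟨_⟩
    exact prop_of_retract _ ⟨biprod.inr, biprod.snd, by simp⟩ (le_triangEnvelopeIter _ 0 _ ⟨()⟩)
  obtain ⟨r, hr⟩ := triangEnvelopeIter_le_of_le h₁ inferInstance n
  obtain ⟨s, hs⟩ := triangEnvelopeIter_le_of_le h₂ inferInstance m
  refine ⟨M ⊞ N, hD _ _ hM hN, max r s, sup_le ?_ ?_⟩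
  · exact hn.trans (hr.trans (monotone'_triangEnvelopeIter _ (le_max_left _ _)))
  · exact hm.trans (hs.trans (monotone'_triangEnvelopeIter _ (le_max_right _ _)))

end BoundedlyGenerated

section level

lemma gen_of_triangEnvelopeIter_zero (M : C) :
    (singleton M).triangEnvelopeIter 0 ≤ gen C M := by
  have hr : (show ObjectProperty C from gen C M).IsStableUnderRetracts :=
    ⟨fun r h ↦ .retract h (isRetract_of_retract r)⟩
  have hp : (show ObjectProperty C from gen C M).IsClosedUnderBinaryProducts := by
    suffices h : (show ObjectProperty C from gen C M).strictLimitsOfShape (Discrete WalkingPair) ≤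
      gen C M from .mk' h
    rintro X ⟨F, hF⟩
    refine prop_of_iso _ (HasLimit.isoOfNatIso (diagramIsoPair F) ≪≫
      (biprod.isoProd _ _).symm).symm ?_
    exact .sum biprod.inl biprod.fst biprod.inr biprod.snd (hF _) (hF _)
      (by simp) (by simp) (by simp) (by simp) (by simp)
  have hz : (show ObjectProperty C from gen C M).IsClosedUnderLimitsOfShape
      (Discrete PEmpty.{1}) := by
    suffices h : (show ObjectProperty C from gen C M).strictLimitsOfShape (Discrete PEmpty.{1}) ≤
      gen C M from .mk' h
    rintro X ⟨F, hF⟩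
    refine .retract .base ⟨0, 0, ?_⟩
    ext j
    exact j.as.elim
  have hs : (show ObjectProperty C from gen C M).IsStableUnderShift ℤ :=
    ⟨fun a ↦ ⟨fun X hX ↦ .shift a hX⟩⟩
  rw [triangEnvelopeIter_zero]
  refine (retractClosure_le_iff _ (show ObjectProperty C from gen C M)).2
    (binaryProductsClosure_le_iff.2 ((shiftClosure_le_iff _ _).2 ?_))
  rintro _ ⟨_⟩
  exact .base

lemma level_of_triangEnvelopeIter [IsTriangulated C] (M : C) (n : ℕ) :
    (singleton M).triangEnvelopeIter n ≤ (· ∈ level C M (n + 1)) := by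
  induction n with
  | zero =>
    intro X hX
    exact ⟨_, X, X, 0, 𝟙 X, 0, contractible_distinguished₁ X, isZero_zero _,
      gen_of_triangEnvelopeIter_zero M _ hX, 𝟙 X, 𝟙 X, by simp⟩
  | succ n ih =>
    rw [triangEnvelopeIter_succ']
    rintro X ⟨Y, ⟨A, B, f, g, h, hT, hA, hB⟩, ⟨r⟩⟩
    exact ⟨A, Y, B, f, g, h, hT, ih _ hA, gen_of_triangEnvelopeIter_zero M _ (by simpa using hB),
      isRetract_of_retract r⟩

lemma gen_le {D : ObjectProperty C} [D.IsTriangulated] [D.IsStableUnderRetracts]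
    {M : C} (hM : D M) {X : C} (hX : gen C M X) : D X := by
  induction hX with
  | base => exact hM
  | @sum X Y Z i p j q _ _ h₁ h₂ h₃ h₄ h₅ hX hY =>
    let b : BinaryBicone X Y := ⟨Z, p, q, i, j, h₁, h₃, h₄, h₂⟩
    have hb : b.IsBilimit := isBinaryBilimitOfTotal b h₅
    exact prop_of_iso _ (hb.isLimit.conePointUniqueUpToIso (BinaryBiproduct.isLimit X Y)).symm
      (D.ext_of_isTriangulatedClosed₂ _ (binaryBiproductTriangle_distinguished X Y) hX hY)
  | shift n _ h => exact D.le_shift n _ h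
  | retract _ r h =>
    obtain ⟨s, r, hr⟩ := r
    exact D.prop_of_retract ⟨s, r, hr⟩ h

lemma level_le {D : ObjectProperty C} [D.IsTriangulated] [D.IsStableUnderRetracts]
    {M : C} (hM : D M) (n : ℕ) {X : C} (hX : X ∈ level C M n) : D X := by
  induction n generalizing X with
  | zero => exact D.prop_of_isZero hX
  | succ n ih =>
    obtain ⟨A, Z, B, f, g, h, hT, hA, hB, s, r, hr⟩ := hX
    exact D.prop_of_retract ⟨s, r, hr⟩
      (D.ext_of_isTriangulatedClosed₂ _ hT (ih hA) (gen_le hM hB))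

theorem trdim_lt_top_of_boundedlyGenerated [IsTriangulated C] {D : ObjectProperty C}
    [D.IsTriangulated] [D.IsStableUnderRetracts] (h : BoundedlyGenerated D D) :
    trdim C {X | D X} < ⊤ := by
  obtain ⟨M, hM, n, hn⟩ := h
  refine lt_of_le_of_lt (sInf_le ⟨n, ⟨M, hM, ?_⟩, rfl⟩) (ENat.natCast_lt_top n)
  exact Set.Subset.antisymm (fun X hX ↦ level_le hM _ hX)
    fun X hX ↦ level_of_triangEnvelopeIter M n _ (hn _ hX)

end level

end

end CategoryTheory.ObjectProperty

section BoundedDerived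

open DerivedCategory

variable (R : Type) [CommRing R]

/-- `Db R` as a property of objects of the derived category. -/
def DbProp : ObjectProperty (DerivedCategory (ModuleCat.{0} R)) := fun X ↦ X ∈ Db R

lemma moduleFinite_of_exact [IsNoetherianRing R] {S : ShortComplex (ModuleCat.{0} R)}
    (hS : S.Exact) [h₁ : Module.Finite R S.X₁] [h₃ : Module.Finite R S.X₃] :
    Module.Finite R S.X₂ := by
  have h := hS.moduleCat_range_eq_ker
  refine ⟨Submodule.fg_of_fg_map_of_fg_inf_ker S.g.hom
    ((isNoetherian_of_isNoetherianRing_of_finite R S.X₃).noetherian _) ?_⟩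
  rw [top_inf_eq, ← h]
  exact Module.Finite.iff_fg.1 inferInstance

instance DbProp.isStableUnderRetracts : (DbProp R).IsStableUnderRetracts where
  of_retract {X Y} r := by
    rintro ⟨⟨a, b, hab⟩, hY⟩
    refine ⟨⟨a, b, fun n hn ↦ ?_⟩, fun n ↦ ?_⟩
    · exact IsZero.of_mono (r.map (homologyFunctor _ n)).i (hab n hn)
    · have := hY n
      let r' := r.map (homologyFunctor (ModuleCat.{0} R) n)
      refine Module.Finite.of_surjective r'.r.hom fun x ↦ ⟨r'.i.hom x, ?_⟩
      exact ConcreteCategory.congr_hom r'.retract x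

lemma homology_shift_iso (X : DerivedCategory (ModuleCat.{0} R)) (a n : ℤ) :
    Nonempty ((homologyFunctor (ModuleCat.{0} R) n).obj (X⟦a⟧) ≅
      (homologyFunctor (ModuleCat.{0} R) (a + n)).obj X) :=
  ⟨((homologyFunctor (ModuleCat.{0} R) 0).shiftIso a n (a + n) rfl).app X⟩

instance DbProp.isTriangulated [IsNoetherianRing R] : (DbProp R).IsTriangulated where
  exists_zero := by
    refine ⟨_, isZero_zero _, ⟨0, 0, fun n _ ↦ Functor.map_isZero _ (isZero_zero _)⟩, fun n ↦ ?_⟩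
    have h := ModuleCat.subsingleton_of_isZero
      (Functor.map_isZero (homologyFunctor (ModuleCat.{0} R) n) (isZero_zero _))
    exact inferInstance
  isStableUnderShiftBy c := ⟨fun X ↦ by
    rintro ⟨⟨a, b, hab⟩, hX⟩
    refine ⟨⟨a - c, b - c, fun n hn ↦ ?_⟩, fun n ↦ ?_⟩
    · exact (hab (c + n) (by lia)).of_iso (homology_shift_iso R X c n).some
    · have := hX (c + n)
      exact Module.Finite.equiv (homology_shift_iso R X c n).some.symm.toLinearEquiv⟩
  toIsTriangulatedClosed₂ := .mk' fun T hT h₁ h₃ ↦ by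
    have hex (n : ℤ) := (homologyFunctor (ModuleCat.{0} R) n).map_distinguished_exact T hT
    obtain ⟨⟨a, b, hab⟩, h₁⟩ := h₁
    obtain ⟨⟨a', b', hab'⟩, h₃⟩ := h₃
    refine ⟨⟨min a a', max b b', fun n hn ↦ ?_⟩, fun n ↦ ?_⟩
    · exact (hex n).isZero_of_both_zeros ((hab n (by lia)).eq_of_src _ _)
        ((hab' n (by lia)).eq_of_tgt _ _)
    · have := h₁ n
      have := h₃ n
      exact moduleFinite_of_exact R (hex n) (h₁ := h₁ n) (h₃ := h₃ n)

lemma DbProp.biprod [IsNoetherianRing R] {X Y : DerivedCategory (ModuleCat.{0} R)}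
    (hX : DbProp R X) (hY : DbProp R Y) : DbProp R (X ⊞ Y) :=
  (DbProp R).ext_of_isTriangulatedClosed₂ _ (binaryBiproductTriangle_distinguished X Y) hX hY

lemma DbProp.singleFunctor (N : ModuleCat.{0} R) [Module.Finite R N] :
    DbProp R ((singleFunctor _ 0).obj N) := by
  refine ⟨⟨0, 0, fun n hn ↦ ?_⟩, fun n ↦ ?_⟩
  · rcases hn with hn | hn
    · exact isZero_of_isGE _ 0 n hn
    · exact isZero_of_isLE _ 0 n hn
  · rcases lt_trichotomy n 0 with hn | rfl | hn
    · have := ModuleCat.subsingleton_of_isZero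
        (isZero_of_isGE ((DerivedCategory.singleFunctor _ 0).obj N) 0 n hn)
      exact inferInstance
    · exact Module.Finite.equiv (M := N)
        ((singleFunctorCompHomologyFunctorIso _ 0).app N).symm.toLinearEquiv
    · have := ModuleCat.subsingleton_of_isZero
        (isZero_of_isLE ((DerivedCategory.singleFunctor _ 0).obj N) 0 n hn)
      exact inferInstance

end BoundedDerived

section FinitelyGeneratedSubcomplex

variable {R : Type} [CommRing R]

lemma ModuleCat.exists_refinement {A B C : ModuleCat.{0} R} (f : A ⟶ B) (g : C ⟶ B)
    (h : ∀ a, ∃ c, g c = f a) :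
    ∃ (A' : ModuleCat.{0} R) (π : A' ⟶ A) (_ : Epi π) (x : A' ⟶ C), π ≫ f = x ≫ g := by
  let S := LinearMap.eqLocus (f.hom ∘ₗ LinearMap.fst R A C) (g.hom ∘ₗ LinearMap.snd R A C)
  refine ⟨of R S, ofHom (LinearMap.fst R A C ∘ₗ S.subtype), ?_,
    ofHom (LinearMap.snd R A C ∘ₗ S.subtype), ?_⟩
  · rw [ModuleCat.epi_iff_surjective]
    intro a
    obtain ⟨c, hc⟩ := h a
    exact ⟨⟨(a, c), hc.symm⟩, rfl⟩
  · ext ⟨x, hx⟩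
    exact hx

variable (K : CochainComplex (ModuleCat.{0} R) ℤ)

/-- The subcomplex given by a family of submodules stable under the differential. -/
def CochainComplex.ofSubmodules (L : ∀ i, Submodule R (K.X i))
    (hL : ∀ i j, L i ≤ (L j).comap (K.d i j).hom) : CochainComplex (ModuleCat.{0} R) ℤ where
  X i := .of R (L i)
  d i j := ModuleCat.ofHom ((K.d i j).hom.restrict (hL i j))
  shape i j hij := by
    exact ModuleCat.hom_ext (LinearMap.ext fun x ↦
      Subtype.ext (ConcreteCategory.congr_hom (K.shape i j hij) x.1))
  d_comp_d' i j k _ _ := by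
    exact ModuleCat.hom_ext (LinearMap.ext fun x ↦
      Subtype.ext (ConcreteCategory.congr_hom (K.d_comp_d i j k) x.1))

/-- The inclusion of the subcomplex given by a family of submodules. -/
def CochainComplex.ofSubmodulesι (L : ∀ i, Submodule R (K.X i))
    (hL : ∀ i j, L i ≤ (L j).comap (K.d i j).hom) : ofSubmodules K L hL ⟶ K where
  f i := ModuleCat.ofHom (L i).subtype
  comm' _ _ _ := rfl

lemma CochainComplex.quasiIso_ofSubmodulesι (L : ∀ i, Submodule R (K.X i))
    (hL : ∀ i j, L i ≤ (L j).comap (K.d i j).hom)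
    (h₁ : ∀ i, L (i + 1) ⊓ (K.d i (i + 1)).hom.range ≤ (L i).map (K.d i (i + 1)).hom)
    (h₂ : ∀ i, (K.d (i + 1) (i + 1 + 1)).hom.ker ≤ L (i + 1) ⊔ (K.d i (i + 1)).hom.range) :
    QuasiIso (ofSubmodulesι K L hL) := by
  rw [quasiIso_iff]
  intro n
  obtain ⟨i, rfl⟩ : ∃ i, n = i + 1 := ⟨n - 1, by simp⟩
  rw [quasiIsoAt_iff_isIso_homologyMap]
  have : Mono (HomologicalComplex.homologyMap (ofSubmodulesι K L hL) (i + 1)) := by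
    rw [HomologicalComplex.mono_homologyMap_iff_up_to_refinements _ i (i + 1) (i + 1 + 1)
      (by simp) (by simp)]
    intro A x hx y hy
    refine ModuleCat.exists_refinement _ _ fun a ↦ ?_
    obtain ⟨c, hc, hc'⟩ := h₁ i ⟨(x a).2, y a, (ConcreteCategory.congr_hom hy a).symm⟩
    exact ⟨⟨c, hc⟩, Subtype.ext hc'⟩
  have : Epi (HomologicalComplex.homologyMap (ofSubmodulesι K L hL) (i + 1)) := by
    rw [HomologicalComplex.epi_homologyMap_iff_up_to_refinements _ i (i + 1) (i + 1 + 1)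
      (by simp) (by simp)]
    intro A y hy
    let Z := ((ofSubmodules K L hL).d (i + 1) (i + 1 + 1)).hom.ker
    let C := ModuleCat.of R (Z × K.X i)
    let p₁ : C ⟶ (ofSubmodules K L hL).X (i + 1) :=
      ModuleCat.ofHom (Z.subtype ∘ₗ LinearMap.fst R Z (K.X i))
    let p₂ : C ⟶ K.X i := ModuleCat.ofHom (LinearMap.snd R Z (K.X i))
    have hp₁ : p₁ ≫ (ofSubmodules K L hL).d (i + 1) (i + 1 + 1) = 0 :=
      ModuleCat.hom_ext (LinearMap.ext fun x ↦ LinearMap.mem_ker.1 x.1.2)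
    obtain ⟨A', π, hπ, x, hx⟩ := ModuleCat.exists_refinement y
        (p₁ ≫ (ofSubmodulesι K L hL).f (i + 1) + p₂ ≫ K.d i (i + 1)) (by
      intro a
      obtain ⟨l, hl, _, ⟨b, rfl⟩, hlb⟩ := Submodule.mem_sup.1
        (h₂ i (LinearMap.mem_ker.2 (ConcreteCategory.congr_hom hy a)))
      have hl0 : K.d (i + 1) (i + 1 + 1) l = 0 := by
        have h₁ := ConcreteCategory.congr_hom hy a
        have h₂ := ConcreteCategory.congr_hom (K.d_comp_d i (i + 1) (i + 1 + 1)) b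
        simp only [ModuleCat.hom_comp, LinearMap.comp_apply, ModuleCat.hom_zero,
          LinearMap.zero_apply] at h₁ h₂
        rw [show y.hom a = _ from hlb.symm, map_add, h₂, add_zero] at h₁
        exact h₁
      exact ⟨(⟨⟨l, hl⟩, Subtype.ext hl0⟩, b), hlb⟩)
    refine ⟨A', π, hπ, x ≫ p₁, by simp [hp₁], x ≫ p₂, ?_⟩
    simp [hx]
  exact isIso_of_mono_of_epi _

lemma Submodule.exists_fg_map_eq {M N : Type*} [AddCommGroup M] [AddCommGroup N] [Module R M]
    [Module R N] (f : M →ₗ[R] N) (P : Submodule R N) (hP : P.FG) (h : P ≤ f.range) :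
    ∃ L : Submodule R M, L.FG ∧ L.map f = P := by
  obtain ⟨s, rfl⟩ := hP
  choose g hg using fun x : s ↦ h (subset_span x.2)
  refine ⟨span R (Set.range g), fg_span (Set.finite_range g), ?_⟩
  rw [map_span, ← Set.range_comp]
  congr 1
  ext x
  simp [hg]

lemma CategoryTheory.ShortComplex.exists_fg_ker_le_sup_range (S : ShortComplex (ModuleCat.{0} R))
    [h : Module.Finite R S.homology] :
    ∃ N : Submodule R S.X₂, N.FG ∧ N ≤ S.g.hom.ker ∧ S.g.hom.ker ≤ N ⊔ S.f.hom.range := by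
  have : Module.Finite R (S.g.hom.ker ⧸ S.moduleCatToCycles.range) :=
    Module.Finite.equiv S.moduleCatHomologyIso.toLinearEquiv
  obtain ⟨N, hN, hN'⟩ := Submodule.exists_fg_map_eq S.moduleCatToCycles.range.mkQ ⊤
    Module.Finite.fg_top (by simp)
  refine ⟨N.map S.g.hom.ker.subtype, hN.map _, Submodule.map_subtype_le _ _, fun x hx ↦ ?_⟩
  obtain ⟨y, hy, hxy⟩ : S.moduleCatToCycles.range.mkQ ⟨x, hx⟩ ∈
    N.map S.moduleCatToCycles.range.mkQ := hN' ▸ Submodule.mem_top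
  obtain ⟨z, hz⟩ := (Submodule.Quotient.eq _).1 hxy.symm
  refine Submodule.mem_sup.2 ⟨y, ⟨y, hy, rfl⟩, _, ⟨z, rfl⟩, ?_⟩
  have := congrArg Subtype.val hz
  change S.f.hom z = x - y at this
  rw [this]
  abel

lemma CochainComplex.exists_fg_submodules [IsNoetherianRing R] (a b : ℤ) [K.IsStrictlyGE a]
    [K.IsStrictlyLE b] (hK : ∀ i, Module.Finite R (K.homology i)) :
    ∃ L : ∀ i, Submodule R (K.X i), (∀ i, (L i).FG) ∧
      (∀ i, (L i).map (K.d i (i + 1)).hom = L (i + 1) ⊓ (K.d i (i + 1)).hom.range) ∧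
      ∀ i, (K.d (i + 1) (i + 1 + 1)).hom.ker ≤ L (i + 1) ⊔ (K.d i (i + 1)).hom.range := by
  have hsub (i : ℤ) (hi : i < a ∨ b < i) : Subsingleton (K.X i) := by
    apply ModuleCat.subsingleton_of_isZero
    rcases hi with hi | hi
    · exact K.isZero_of_isStrictlyGE a i
    · exact K.isZero_of_isStrictlyLE b i
  suffices h : ∀ n : ℕ, ∃ L : ∀ i, Submodule R (K.X i), (∀ i, (L i).FG) ∧
      ∀ i, b - n < i →
        (L i).map (K.d i (i + 1)).hom = L (i + 1) ⊓ (K.d i (i + 1)).hom.range ∧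
        ∀ j k, j + 1 = i → i + 1 = k →
          (K.d i k).hom.ker ≤ L i ⊔ (K.d j i).hom.range by
    obtain ⟨L, hL, h⟩ := h (b - a + 2).toNat
    refine ⟨L, hL, fun i ↦ ?_, fun i ↦ ?_⟩
    · by_cases hi : i < a - 1
      · have := hsub (i + 1) (by lia)
        exact Subsingleton.elim _ _
      · exact (h i (by lia)).1
    · by_cases hi : i < a - 1
      · have := hsub (i + 1) (by lia)
        exact (Subsingleton.elim _ _ : _ = _).le
      · exact (h (i + 1) (by lia)).2 i _ rfl rfl
  intro n
  induction n with
  | zero =>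
    refine ⟨fun _ ↦ ⊥, fun _ ↦ Submodule.fg_bot, fun i hi ↦ ⟨?_, ?_⟩⟩
    · have := hsub (i + 1) (by lia)
      exact Subsingleton.elim _ _
    · intro j k _ _
      have := hsub i (by lia)
      exact (Subsingleton.elim _ _ : _ = _).le
  | succ n ih =>
    obtain ⟨L, hL, h⟩ := ih
    obtain ⟨c, hc⟩ : ∃ c, c = b - n := ⟨_, rfl⟩
    obtain ⟨N, hN, hN₁, hN₂⟩ : ∃ N : Submodule R (K.X c), N.FG ∧
        N.map (K.d c (c + 1)).hom = L (c + 1) ⊓ (K.d c (c + 1)).hom.range ∧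
        ∀ j k, j + 1 = c → c + 1 = k → (K.d c k).hom.ker ≤ N ⊔ (K.d j c).hom.range := by
      obtain ⟨N₁, hN₁, hN₁'⟩ := Submodule.exists_fg_map_eq (K.d c (c + 1)).hom
        (L (c + 1) ⊓ (K.d c (c + 1)).hom.range) (by
          have : IsNoetherian R (L (c + 1)) :=
            isNoetherian_of_fg_of_noetherian _ (hL _)
          exact Submodule.FG.of_le (hL (c + 1)) inf_le_left) inf_le_right
      obtain ⟨N₂, hN₂, hN₂'⟩ : ∃ N₂ : Submodule R (K.X c), N₂.FG ∧
          N₂ ≤ (K.d c (c + 1)).hom.ker ∧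
          (K.d c (c + 1)).hom.ker ≤ N₂ ⊔ (K.d (c - 1) c).hom.range := by
        have := hK c
        have := Module.Finite.equiv (K.homologyIsoSc' (c - 1) c (c + 1) (by simp)
          (by simp)).toLinearEquiv
        exact ShortComplex.exists_fg_ker_le_sup_range (K.sc' (c - 1) c (c + 1))
      refine ⟨N₁ ⊔ N₂, hN₁.sup hN₂, ?_, ?_⟩
      · rw [Submodule.map_sup, hN₁', LinearMap.le_ker_iff_map.1 hN₂'.1, sup_bot_eq]
      · rintro j k hj rfl
        obtain rfl : j = c - 1 := by lia
        exact hN₂'.2.trans (sup_le_sup_right le_sup_right _)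
    refine ⟨Function.update L c N, fun i ↦ ?_, fun i hi ↦ ?_⟩
    · by_cases hi : i = c
      · subst hi; simpa
      · simpa [hi] using hL i
    · by_cases hi : i = c
      · subst hi
        rw [Function.update_self, Function.update_of_ne (by lia)]
        exact ⟨hN₁, hN₂⟩
      · rw [Function.update_of_ne hi, Function.update_of_ne (by lia)]
        exact h i (by lia)

end FinitelyGeneratedSubcomplex

section BoundedDerivedGeneration

open DerivedCategory

variable {R : Type} [CommRing R]

/-- The complexes concentrated in degree zero given by the modules satisfying `p`. -/
def singleModules (p : ObjectProperty (ModuleCat.{0} R)) :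
    ObjectProperty (DerivedCategory (ModuleCat.{0} R)) :=
  fun X ↦ ∃ N, p N ∧ Nonempty (X ≅ (singleFunctor _ 0).obj N)

/-- The complex with zero differentials. -/
def CochainComplex.zeroDifferential (X : ℤ → ModuleCat.{0} R) :
    CochainComplex (ModuleCat.{0} R) ℤ where
  X := X
  d _ _ := 0

lemma triangEnvelopeIter_zero_isClosedUnderFiniteProducts {C : Type*} [Category C]
    [HasZeroObject C] [Preadditive C] [HasShift C ℤ]
    [∀ n : ℤ, (shiftFunctor C n).Additive] [Pretriangulated C] (P : ObjectProperty C)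
    (hP : P.Nonempty) (n : ℕ) : (P.triangEnvelopeIter n).IsClosedUnderFiniteProducts := by
  have : (P.triangEnvelopeIter n).IsClosedUnderLimitsOfShape (Discrete PEmpty.{1}) := by
    suffices h : (P.triangEnvelopeIter n).strictLimitsOfShape (Discrete PEmpty.{1}) ≤
      P.triangEnvelopeIter n from .mk' h
    rintro X ⟨F, hF⟩
    refine P.triangEnvelopeIter_of_isZero hP ?_
    rw [IsZero.iff_id_eq_zero]
    ext j
    exact j.as.elim
  exact .mk'

lemma singleFunctor_triangEnvelopeIter {p : ObjectProperty (ModuleCat.{0} R)} {N : ModuleCat.{0} R}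
    (hN : p N) (i : ℤ) (n : ℕ) :
    (singleModules p).triangEnvelopeIter n ((singleFunctor _ i).obj N) := by
  have e : (singleFunctor _ i).obj N ≅ ((singleFunctor _ 0).obj N)⟦-i⟧ :=
    (((singleFunctors (ModuleCat.{0} R)).shiftIso (-i) i 0 (by simp)).app N).symm
  exact ObjectProperty.prop_of_iso _ e.symm (ObjectProperty.triangEnvelopeIter_shift _
    (ObjectProperty.le_triangEnvelopeIter _ n _ ⟨N, hN, ⟨Iso.refl _⟩⟩) _)

lemma zeroDifferential_triangEnvelopeIter {p : ObjectProperty (ModuleCat.{0} R)}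
    (X : ℤ → ModuleCat.{0} R) (hX : ∀ i, p (X i)) (s : Finset ℤ)
    (hs : ∀ i, i ∉ s → IsZero (X i)) :
    (singleModules p).triangEnvelopeIter 0 (Q.obj (CochainComplex.zeroDifferential X)) := by
  let K := CochainComplex.zeroDifferential X
  have := triangEnvelopeIter_zero_isClosedUnderFiniteProducts (singleModules p)
    ⟨_, _, hX 0, ⟨Iso.refl _⟩⟩ 0
  let π (i : ℤ) : K ⟶ (HomologicalComplex.single _ _ i).obj (X i) :=
    HomologicalComplex.mkHomToSingle (K := K) (𝟙 (X i)) (fun _ _ ↦ zero_comp)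
  let ι (i : ℤ) : (HomologicalComplex.single _ _ i).obj (X i) ⟶ K :=
    HomologicalComplex.mkHomFromSingle (K := K) (𝟙 (X i)) (fun _ _ ↦ comp_zero)
  have hid : ∑ i : s, π i ≫ ι i = 𝟙 K := by
    ext n : 1
    by_cases hn : n ∈ s
    · have hsum : (∑ i : s, π i ≫ ι i).f n = ∑ i : s, (π i ≫ ι i).f n :=
        map_sum (HomologicalComplex.Hom.fAddMonoidHom n) _ _
      rw [hsum, Finset.sum_eq_single_of_mem ⟨n, hn⟩ (Finset.mem_univ _)]
      · have hπ : (π n).f n = _ := HomologicalComplex.mkHomToSingle_f (K := K) _ _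
        have hι : (ι n).f n = _ := HomologicalComplex.mkHomFromSingle_f (K := K) _ _
        rw [HomologicalComplex.comp_f, hπ, hι]
        erw [Category.id_comp, Category.comp_id]
        exact Iso.inv_hom_id _
      · intro i _ hi
        have : n ≠ i := fun h ↦ hi (Subtype.ext h.symm)
        rw [HomologicalComplex.comp_f,
          (HomologicalComplex.isZero_single_obj_X _ _ _ _ this).eq_of_tgt ((π i).f n) 0, zero_comp]
    · exact (hs n hn).eq_of_src _ _
  let Y (i : s) := Q.obj ((HomologicalComplex.single _ (ComplexShape.up ℤ) i.1).obj (X i))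
  have hY : (singleModules p).triangEnvelopeIter 0 (⨁ Y) :=
    ObjectProperty.prop_of_iso _ (biproduct.isoProduct Y).symm
      (ObjectProperty.prop_product _ fun i ↦ singleFunctor_triangEnvelopeIter (hX i) _ 0)
  refine ObjectProperty.prop_of_retract _ ⟨biproduct.lift (f := Y) fun i ↦ Q.map (π i),
    biproduct.desc (f := Y) fun i ↦ Q.map (ι i), ?_⟩ hY
  rw [biproduct.lift_desc, ← Q.map_id, ← hid, Functor.map_sum]
  exact Finset.sum_congr rfl fun i _ ↦ (Functor.map_comp _ _ _).symm

lemma bounded_triangEnvelopeIter [IsNoetherianRing R] (K : CochainComplex (ModuleCat.{0} R) ℤ)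
    (hK : ∀ i, Module.Finite R (K.X i)) (s : Finset ℤ) (hs : ∀ i, i ∉ s → IsZero (K.X i)) :
    (singleModules (R := R) fun N ↦ Module.Finite R N).triangEnvelopeIter 1 (Q.obj K) := by
  let Z := CochainComplex.zeroDifferential fun i ↦ .of R (K.d i (i + 1)).hom.ker
  let B := CochainComplex.zeroDifferential fun i ↦ .of R (K.d i (i + 1)).hom.range
  let ι : Z ⟶ K :=
    { f i := ModuleCat.ofHom (K.d i (i + 1)).hom.ker.subtype
      comm' i j h := by
        obtain rfl : i + 1 = j := h
        exact ModuleCat.hom_ext (LinearMap.ext fun x ↦ LinearMap.mem_ker.1 x.2) }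
  let π : K ⟶ B :=
    { f i := ModuleCat.ofHom (K.d i (i + 1)).hom.rangeRestrict
      comm' i j h := by
        obtain rfl : i + 1 = j := h
        exact ModuleCat.hom_ext (LinearMap.ext fun x ↦ Subtype.ext
          (ConcreteCategory.congr_hom (K.d_comp_d i (i + 1) (i + 1 + 1)) x).symm) }
  let S : ShortComplex (CochainComplex (ModuleCat.{0} R) ℤ) := .mk ι π (by
    ext i : 1
    exact ModuleCat.hom_ext (LinearMap.ext fun x ↦ Subtype.ext (LinearMap.mem_ker.1 x.2)))
  have hS : S.ShortExact := by
    refine HomologicalComplex.shortExact_of_degreewise_shortExact _ fun i ↦ ?_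
    refine { exact := ?_, mono_f := ?_, epi_g := ?_ }
    · rw [ShortComplex.moduleCat_exact_iff]
      intro x hx
      exact ⟨⟨x, congrArg Subtype.val hx⟩, rfl⟩
    · exact (ModuleCat.mono_iff_injective (ModuleCat.ofHom (K.d i (i + 1)).hom.ker.subtype)).2
        Subtype.val_injective
    · exact (ModuleCat.epi_iff_surjective (ModuleCat.ofHom (K.d i (i + 1)).hom.rangeRestrict)).2
        (LinearMap.surjective_rangeRestrict _)
  have hsub (i : ℤ) (hi : i ∉ s) : Subsingleton (K.X i) :=
    ModuleCat.subsingleton_of_isZero (hs i hi)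
  refine ObjectProperty.triangEnvelopeIter_of_distinguished (n := 0) (m := 0) _
    (triangleOfSES_distinguished hS) ?_ ?_
  · refine zeroDifferential_triangEnvelopeIter _ (fun i ↦ ?_) s fun i hi ↦ ?_
    · exact inferInstanceAs (Module.Finite R (K.d i (i + 1)).hom.ker)
    · have := hsub i hi
      exact ModuleCat.isZero_iff_subsingleton.2
        (inferInstanceAs (Subsingleton (K.d i (i + 1)).hom.ker))
  · refine zeroDifferential_triangEnvelopeIter _ (fun i ↦ ?_) s fun i hi ↦ ?_
    · exact inferInstanceAs (Module.Finite R (K.d i (i + 1)).hom.range)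
    · have := hsub i hi
      exact ModuleCat.isZero_iff_subsingleton.2
        ((K.d i (i + 1)).hom.surjective_rangeRestrict.subsingleton)

lemma DbProp_le_triangEnvelopeIter [IsNoetherianRing R] :
    DbProp R ≤ (singleModules (R := R) fun N ↦ Module.Finite R N).triangEnvelopeIter 1 := by
  rintro X ⟨⟨a, b, hab⟩, hX⟩
  have : X.IsGE a := (isGE_iff _ _).2 fun i hi ↦ hab i (.inl hi)
  have : X.IsLE b := (isLE_iff _ _).2 fun i hi ↦ hab i (.inr hi)
  obtain ⟨K, _, _, ⟨e⟩⟩ := exists_iso_Q_obj_of_isGE_of_isLE X a b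
  obtain ⟨L, hL, hL₁, hL₂⟩ := CochainComplex.exists_fg_submodules K a b fun i ↦ by
    have := hX i
    exact Module.Finite.equiv ((homologyFunctor _ i).mapIso e ≪≫
      (homologyFunctorFactors _ i).app K).toLinearEquiv
  have hL₃ (i j : ℤ) : L i ≤ (L j).comap (K.d i j).hom := by
    by_cases hij : i + 1 = j
    · subst hij
      exact Submodule.map_le_iff_le_comap.1 ((hL₁ i).le.trans inf_le_left)
    · rw [K.shape i j hij]
      exact fun x _ ↦ (L j).zero_mem
  have := CochainComplex.quasiIso_ofSubmodulesι K L hL₃ (fun i ↦ (hL₁ i).ge) hL₂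
  refine ObjectProperty.prop_of_iso _
    (asIso (Q.map (CochainComplex.ofSubmodulesι K L hL₃)) ≪≫ e.symm) ?_
  refine bounded_triangEnvelopeIter _ (fun i ↦ Module.Finite.iff_fg.2 (hL i)) (Finset.Icc a b)
    fun i hi ↦ ?_
  have : Subsingleton (K.X i) := by
    apply ModuleCat.subsingleton_of_isZero
    rw [Finset.mem_Icc, not_and_or, not_le, not_le] at hi
    rcases hi with hi | hi
    · exact K.isZero_of_isStrictlyGE a i
    · exact K.isZero_of_isStrictlyLE b i
  exact ModuleCat.isZero_iff_subsingleton.2 (inferInstanceAs (Subsingleton (L i)))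

end BoundedDerivedGeneration

section ExtAnnihilators

open Abelian

variable {R : Type} [CommRing R]

/-- `x` annihilates `Extⁿ(N, -)`. -/
def ExtAnn (x : R) (n : ℕ) (N : ModuleCat.{0} R) : Prop :=
  ∀ (W : ModuleCat.{0} R) (α : Ext N W n), x • α = 0

lemma ExtAnn.mul_left {x : R} {n : ℕ} {N : ModuleCat.{0} R} (h : ExtAnn x n N) (y : R) :
    ExtAnn (y * x) n N := fun W α ↦ by rw [mul_smul, h, smul_zero]

lemma ExtAnn.of_X₂_of_X₃ {S : ShortComplex (ModuleCat.{0} R)} (hS : S.ShortExact) {x c : R}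
    {m : ℕ} (h₃ : ExtAnn x (m + 1) S.X₃) (h₂ : ExtAnn c m S.X₂) : ExtAnn (x * c) m S.X₁ := by
  intro W α
  obtain ⟨β, hβ⟩ := Ext.contravariant_sequence_exact₁ hS W (x • α) (add_comm 1 m) (by
    rw [Ext.comp_smul, h₃])
  rw [mul_comm, mul_smul, ← hβ, ← Ext.comp_smul, h₂, Ext.comp_zero]

lemma ExtAnn.of_X₁_of_X₂ {S : ShortComplex (ModuleCat.{0} R)} (hS : S.ShortExact) {x c : R}
    {m : ℕ} (h₁ : ExtAnn x m S.X₁) (h₂ : ExtAnn c (m + 1) S.X₂) :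
    ExtAnn (x * c) (m + 1) S.X₃ := by
  intro W α
  obtain ⟨β, hβ⟩ := Ext.contravariant_sequence_exact₃ hS W (c • α) (by
    rw [Ext.comp_smul, h₂]) (add_comm 1 m)
  rw [mul_smul, ← hβ, ← Ext.comp_smul, h₁, Ext.comp_zero]

lemma ExtAnn.of_projective (N : ModuleCat.{0} R) [Projective N] (n : ℕ) :
    ExtAnn (1 : R) (n + 1) N := fun W α ↦ by rw [Ext.eq_zero_of_projective α, smul_zero]

lemma ExtAnn.of_factors {x : R} {N P : ModuleCat.{0} R} [Projective P] (f : N ⟶ P) (g : P ⟶ N)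
    (h : f ≫ g = x • 𝟙 N) (n : ℕ) : ExtAnn x (n + 1) N := by
  intro W α
  have : x • α = (Ext.mk₀ (f ≫ g)).comp α (zero_add _) := by
    rw [h, Ext.mk₀_smul, Ext.smul_comp, Ext.mk₀_id_comp]
  rw [this, ← Ext.mk₀_comp_mk₀, Ext.comp_assoc _ _ _ (add_zero _) (zero_add (n + 1)) (by lia),
    Ext.eq_zero_of_projective
    ((Ext.mk₀ g).comp α (zero_add _)), Ext.comp_zero]

lemma ExtAnn.exists_lift {x : R} {F N : ModuleCat.{0} R} (h : ExtAnn x 1 N) (p : F ⟶ N) [Epi p] :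
    ∃ s : N ⟶ F, s ≫ p = x • 𝟙 N := by
  let S := ShortComplex.mk (kernel.ι p) p (kernel.condition p)
  have hS : S.ShortExact :=
    { exact := ShortComplex.exact_of_f_is_kernel _ (kernelIsKernel p)
      mono_f := inferInstanceAs (Mono (kernel.ι p))
      epi_g := inferInstanceAs (Epi p) }
  obtain ⟨β, hβ⟩ := Ext.covariant_sequence_exact₃ N hS (x • Ext.mk₀ (𝟙 N)) (n₁ := 1) rfl (by
    rw [Ext.smul_comp]; exact h _ _)
  obtain ⟨s, rfl⟩ := (Ext.mk₀_bijective _ _).2 β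
  refine ⟨s, (Ext.mk₀_bijective _ _).1 ?_⟩
  rw [Ext.mk₀_smul, ← hβ, Ext.mk₀_comp_mk₀]

lemma ExtAnn.of_hasProjectiveDimensionLT (N : ModuleCat.{0} R) (n : ℕ)
    [HasProjectiveDimensionLT N n] : ExtAnn (1 : R) n N :=
  fun W α ↦ by rw [Ext.eq_zero_of_hasProjectiveDimensionLT α n le_rfl, smul_zero]

end ExtAnnihilators

section EnvelopeOfModules

open DerivedCategory

variable {R S : Type} [CommRing R] [CommRing S] (f : R →+* S)
  (Q : ObjectProperty (DerivedCategory (ModuleCat.{0} R)))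

/-- The `S`-modules which, seen as complexes of `R`-modules, are built from `Q` in a given
number of steps. -/
def moduleEnvelope (n : ℕ) : ObjectProperty (ModuleCat.{0} S) :=
  fun N ↦ Q.triangEnvelopeIter n ((singleFunctor _ 0).obj ((ModuleCat.restrictScalars f).obj N))

namespace moduleEnvelope

variable {f Q} {n m : ℕ}

lemma of_iso {N N' : ModuleCat.{0} S} (h : moduleEnvelope f Q n N) (e : N ≅ N') :
    moduleEnvelope f Q n N' :=
  ObjectProperty.prop_of_iso (Q.triangEnvelopeIter n)
    ((singleFunctor _ 0).mapIso ((ModuleCat.restrictScalars f).mapIso e))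
    h

lemma of_retract {N N' : ModuleCat.{0} S} (h : moduleEnvelope f Q n N') (r : Retract N N') :
    moduleEnvelope f Q n N :=
  ObjectProperty.prop_of_retract (Q.triangEnvelopeIter n)
    ((r.map (ModuleCat.restrictScalars f)).map (singleFunctor _ 0)) h

lemma shortExact_map {T : ShortComplex (ModuleCat.{0} S)} (hT : T.ShortExact) :
    (T.map (ModuleCat.restrictScalars f)).ShortExact :=
  hT.map_of_exact (ModuleCat.restrictScalars f)

lemma X₂ {T : ShortComplex (ModuleCat.{0} S)} (hT : T.ShortExact)
    (h₁ : moduleEnvelope f Q n T.X₁) (h₃ : moduleEnvelope f Q m T.X₃) :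
    moduleEnvelope f Q (n + m + 1) T.X₂ :=
  Q.triangEnvelopeIter_of_distinguished (shortExact_map (f := f) hT).singleTriangle_distinguished
    h₁ h₃

lemma X₃ {T : ShortComplex (ModuleCat.{0} S)} (hT : T.ShortExact)
    (h₁ : moduleEnvelope f Q n T.X₁) (h₂ : moduleEnvelope f Q m T.X₂) :
    moduleEnvelope f Q (m + n + 1) T.X₃ :=
  Q.triangEnvelopeIter_of_distinguished (rot_of_distTriang _
    (shortExact_map (f := f) hT).singleTriangle_distinguished)
    h₂ (Q.triangEnvelopeIter_shift h₁ _)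

lemma X₁ {T : ShortComplex (ModuleCat.{0} S)} (hT : T.ShortExact)
    (h₂ : moduleEnvelope f Q n T.X₂) (h₃ : moduleEnvelope f Q m T.X₃) :
    moduleEnvelope f Q (m + n + 1) T.X₁ :=
  Q.triangEnvelopeIter_of_distinguished (inv_rot_of_distTriang _
    (shortExact_map (f := f) hT).singleTriangle_distinguished)
    (Q.triangEnvelopeIter_shift h₃ _) h₂

lemma pi (ι : Type) [Finite ι] {N : ModuleCat.{0} S} (hN : moduleEnvelope f Q n N)
    (hQ : Q.Nonempty) :
    moduleEnvelope f Q n (ModuleCat.of S (ι → N)) := by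
  have := triangEnvelopeIter_zero_isClosedUnderFiniteProducts Q hQ n
  have := Fintype.ofFinite ι
  let G := ModuleCat.restrictScalars f ⋙ singleFunctor _ 0
  refine of_iso ?_ (ModuleCat.biproductIsoPi fun _ : ι ↦ N)
  exact ObjectProperty.prop_of_iso (Q.triangEnvelopeIter n) ((G.mapBiproduct fun _ : ι ↦ N) ≪≫
    biproduct.isoProduct _).symm (ObjectProperty.prop_product (Q.triangEnvelopeIter n) fun i ↦ hN)

end moduleEnvelope

lemma ModuleCat.shortExact_subtype {N : Type} [AddCommGroup N] [Module S N] (L : Submodule S N) :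
    (ShortComplex.mk (ModuleCat.ofHom L.subtype) (ModuleCat.ofHom L.mkQ) (by
      ext; simp)).ShortExact :=
  ModuleCat.shortComplex_shortExact _ (LinearMap.exact_subtype_mkQ L) L.injective_subtype
    L.mkQ_surjective

lemma ModuleCat.shortExact_ker {N N' : Type} [AddCommGroup N] [Module S N]
    [AddCommGroup N'] [Module S N'] (g : N →ₗ[S] N') (hg : Function.Surjective g) :
    (ShortComplex.mk (ModuleCat.ofHom (LinearMap.ker g).subtype) (ModuleCat.ofHom g) (by
      ext; simp)).ShortExact :=
  ModuleCat.shortComplex_shortExact _ (LinearMap.exact_subtype_ker_map g)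
    (LinearMap.ker g).injective_subtype hg

namespace moduleEnvelope

variable {f Q} {n m : ℕ}

lemma of_lift (x : S) (hx : ∀ N : ModuleCat.{0} S, Module.Finite S N → (∀ y : N, x • y = 0) →
      moduleEnvelope f Q 0 N) {F Y : ModuleCat.{0} S} [Module.Finite S F]
    (hF : moduleEnvelope f Q 0 F) (hY : ∀ y : Y, x • y = 0 → y = 0) (p : F ⟶ Y) (s : Y ⟶ F)
    (hs : s ≫ p = x • 𝟙 Y) : moduleEnvelope f Q 1 Y := by
  have hps (y : Y) : p.hom (s.hom y) = x • y := by
    have := congr_arg (fun q : Y ⟶ Y ↦ q.hom y) hs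
    simpa using this
  let t : Y →ₗ[S] Y := x • LinearMap.id
  have ht : Function.Injective t := by
    rw [injective_iff_map_eq_zero]
    exact hY
  let L : Submodule S F := (LinearMap.range t).comap p.hom
  let e := LinearEquiv.ofInjective t ht
  have hL := ModuleCat.shortExact_subtype L
  have h₃ : moduleEnvelope f Q 0 (ModuleCat.of S (F ⧸ L)) := by
    refine hx _ (inferInstanceAs (Module.Finite S (F ⧸ L))) fun y ↦ ?_
    obtain ⟨y, rfl⟩ := L.mkQ_surjective y
    rw [← map_smul, Submodule.mkQ_apply, Submodule.Quotient.mk_eq_zero]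
    exact ⟨p.hom y, by simp [t]⟩
  refine of_retract (N' := ModuleCat.of S L) (X₁ hL hF h₃) ?_
  refine
    { i := ModuleCat.ofHom (LinearMap.codRestrict L s.hom fun y ↦ ⟨y, by simp [t, hps]⟩)
      r := ModuleCat.ofHom (e.symm.toLinearMap ∘ₗ
        LinearMap.codRestrict _ (p.hom ∘ₗ L.subtype) fun l ↦ l.2)
      retract := ?_ }
  refine ModuleCat.hom_ext (LinearMap.ext fun y ↦ ?_)
  change e.symm _ = y
  rw [LinearEquiv.symm_apply_eq]
  exact Subtype.ext (hps y)

lemma exists_forall_of_torsionFree [IsNoetherianRing S] [IsDomain S] (hQ : Q.Nonempty) {x : S}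
    (hx₀ : x ≠ 0) (hx : ∀ N : ModuleCat.{0} S, Module.Finite S N → (∀ y : N, x • y = 0) →
      moduleEnvelope f Q 0 N) (hS : moduleEnvelope f Q 0 (ModuleCat.of S S)) (n : ℕ) :
    ∃ c, ∀ Y : ModuleCat.{0} S, Module.Finite S Y → (∀ y : Y, x • y = 0 → y = 0) →
      ExtAnn x (n + 1) Y → moduleEnvelope f Q c Y := by
  have hF (m : ℕ) : moduleEnvelope f Q 0 (ModuleCat.of S (Fin m → S)) := pi (Fin m) hS hQ
  induction n with
  | zero =>
    refine ⟨1, fun Y _ hY h ↦ ?_⟩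
    obtain ⟨m, p, hp⟩ := Module.Finite.exists_fin' S Y
    have : Epi (ModuleCat.ofHom p) := (ModuleCat.epi_iff_surjective _).2 hp
    obtain ⟨s, hs⟩ := h.exists_lift (ModuleCat.ofHom p)
    have : Module.Finite S (ModuleCat.of S (Fin m → S)) :=
      inferInstanceAs (Module.Finite S (Fin m → S))
    exact of_lift x hx (hF m) hY _ s hs
  | succ n ih =>
    obtain ⟨c, hc⟩ := ih
    refine ⟨0 + c + 1, fun Y _ hY h ↦ ?_⟩
    obtain ⟨m, p, hp⟩ := Module.Finite.exists_fin' S Y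
    have hT := ModuleCat.shortExact_ker p hp
    have hproj : Projective (ModuleCat.of S (Fin m → S)) :=
      (IsProjective.iff_projective (Fin m → S)).1 inferInstance
    refine X₃ hT (hc _ (inferInstanceAs (Module.Finite S (LinearMap.ker p))) ?_ ?_) (hF m)
    · intro y hy
      ext i
      have := congr_fun (congr_arg Subtype.val hy) i
      simpa [hx₀] using this
    · have := ExtAnn.of_X₂_of_X₃ hT (m := n + 1) h (ExtAnn.of_projective _ n)
      rwa [mul_one] at this

lemma exists_forall [IsNoetherianRing S] [IsDomain S] (hQ : Q.Nonempty) {x : S}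
    (hx₀ : x ≠ 0) (hx : ∀ N : ModuleCat.{0} S, Module.Finite S N → (∀ y : N, x • y = 0) →
      moduleEnvelope f Q 0 N) (hS : moduleEnvelope f Q 0 (ModuleCat.of S S)) (n : ℕ)
    (hn : ∀ Y : ModuleCat.{0} S, ExtAnn x (n + 1) Y) :
    ∃ c, ∀ Y : ModuleCat.{0} S, Module.Finite S Y → moduleEnvelope f Q c Y := by
  obtain ⟨c, hc⟩ := exists_forall_of_torsionFree hQ hx₀ hx hS n
  refine ⟨0 + c + 1, fun Y _ ↦ ?_⟩
  obtain ⟨m, p, hp⟩ := Module.Finite.exists_fin' S Y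
  refine X₃ (ModuleCat.shortExact_ker p hp)
    (hc _ (inferInstanceAs (Module.Finite S (LinearMap.ker p))) ?_ (hn _)) (pi (Fin m) hS hQ)
  intro y hy
  ext i
  have := congr_fun (congr_arg Subtype.val hy) i
  simpa [hx₀] using this

end moduleEnvelope

end EnvelopeOfModules

/-- Some nonzero element of `R` annihilates all `Ext` modules in a given positive degree. -/
def HasUniformExtAnn (R : Type) [CommRing R] : Prop :=
  ∃ x : R, x ≠ 0 ∧ ∃ n, ∀ N : ModuleCat.{0} R, ExtAnn x (n + 1) N

section NoetherianInduction

open DerivedCategory ObjectProperty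

variable {R : Type} [CommRing R]

/-- The finitely generated modules which are annihilated by `I`. -/
def finiteModulesKilledBy (I : Ideal R) : ObjectProperty (ModuleCat.{0} R) :=
  fun N ↦ Module.Finite R N ∧ ∀ a ∈ I, ∀ y : N, a • y = 0

lemma singleModules_nonempty (I : Ideal R) :
    (singleModules (finiteModulesKilledBy I)).Nonempty :=
  ⟨_, ModuleCat.of R PUnit, ⟨inferInstanceAs (Module.Finite R PUnit), fun _ _ _ ↦ rfl⟩,
    ⟨Iso.refl _⟩⟩

lemma boundedlyGenerated_top :
    BoundedlyGenerated (DbProp R) (singleModules (finiteModulesKilledBy (⊤ : Ideal R))) := by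
  have : Module.Finite R (ModuleCat.of R PUnit) := inferInstanceAs (Module.Finite R PUnit)
  refine .of_prop (DbProp.singleFunctor R (ModuleCat.of R PUnit)) ?_
  rintro X ⟨N, ⟨-, hN⟩, ⟨e⟩⟩
  have h₀ (y : N) : y = 0 := by simpa using hN 1 trivial y
  let e' : N ≃ₗ[R] PUnit :=
    { toFun := fun _ ↦ 0
      invFun := fun _ ↦ 0
      map_add' := fun _ _ ↦ rfl
      map_smul' := fun _ _ ↦ rfl
      left_inv := fun y ↦ (h₀ y).symm
      right_inv := fun _ ↦ rfl }
  exact ⟨_, .mk (), ⟨e ≪≫ (singleFunctor _ 0).mapIso e'.toModuleIso⟩⟩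

variable [IsNoetherianRing R]

lemma boundedlyGenerated_of_mul_mem {I : Ideal R} {a b : R} (hab : a * b ∈ I)
    (ha : BoundedlyGenerated (DbProp R)
      (singleModules (finiteModulesKilledBy (I ⊔ Ideal.span {a}))))
    (hb : BoundedlyGenerated (DbProp R)
      (singleModules (finiteModulesKilledBy (I ⊔ Ideal.span {b})))) :
    BoundedlyGenerated (DbProp R) (singleModules (finiteModulesKilledBy I)) := by
  let Q := singleModules (finiteModulesKilledBy (I ⊔ Ideal.span {b})) ⊔
    singleModules (finiteModulesKilledBy (I ⊔ Ideal.span {a}))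
  have hQ : BoundedlyGenerated (DbProp R) Q := hb.sup (fun _ _ ↦ DbProp.biprod R) ha
  refine (hQ.triangEnvelopeIter 1).mono ?_
  rintro X ⟨N, ⟨_, hN⟩, ⟨e⟩⟩
  have key (N' : ModuleCat.{0} R) (c : R) (h : ∀ y ∈ I, ∀ z : N', y • z = 0)
      (hc : ∀ z : N', c • z = 0) : ∀ y ∈ I ⊔ Ideal.span {c}, ∀ z : N', y • z = 0 := by
    intro y hy z
    obtain ⟨i, hi, w, hw, rfl⟩ := Submodule.mem_sup.1 hy
    obtain ⟨v, rfl⟩ := Ideal.mem_span_singleton'.1 hw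
    rw [add_smul, h i hi, mul_smul, hc, smul_zero, add_zero]
  refine ObjectProperty.prop_of_iso (Q.triangEnvelopeIter 1) e.symm ?_
  let t : N →ₗ[R] N := a • LinearMap.id
  let L := LinearMap.range t
  refine Q.triangEnvelopeIter_of_distinguished (n := 0) (m := 0)
    (ModuleCat.shortExact_subtype L).singleTriangle_distinguished
    (le_triangEnvelopeIter _ _ _ (Or.inl ⟨_, ⟨inferInstanceAs (Module.Finite R L), ?_⟩,
      ⟨Iso.refl _⟩⟩))
    (le_triangEnvelopeIter _ _ _ (Or.inr ⟨_, ⟨inferInstanceAs (Module.Finite R (N ⧸ L)), ?_⟩,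
      ⟨Iso.refl _⟩⟩))
  · refine key _ _ (fun y hy z ↦ Subtype.ext (hN y hy z.1)) ?_
    rintro ⟨_, z, rfl⟩
    refine Subtype.ext ?_
    change b • a • z = 0
    rw [smul_smul, mul_comm, hN _ hab]
  · have hL := L.mkQ_surjective
    refine key _ _ (fun y hy z ↦ ?_) fun z ↦ ?_
    · obtain ⟨z, rfl⟩ := hL z
      change y • L.mkQ z = 0
      rw [← map_smul, hN y hy, map_zero]
    · obtain ⟨z, rfl⟩ := hL z
      change a • L.mkQ z = 0
      rw [← map_smul, Submodule.mkQ_apply, Submodule.Quotient.mk_eq_zero]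
      exact ⟨z, rfl⟩

lemma boundedlyGenerated_of_isPrime {I : Ideal R} [I.IsPrime] (h : HasUniformExtAnn (R ⧸ I))
    (ih : ∀ J > I, BoundedlyGenerated (DbProp R) (singleModules (finiteModulesKilledBy J))) :
    BoundedlyGenerated (DbProp R) (singleModules (finiteModulesKilledBy I)) := by
  obtain ⟨x, hx₀, n, hn⟩ := h
  obtain ⟨x, rfl⟩ := Ideal.Quotient.mk_surjective x
  let J := I ⊔ Ideal.span {x}
  have hJ : I < J := by
    refine lt_of_le_of_ne le_sup_left fun h ↦ hx₀ (Ideal.Quotient.eq_zero_iff_mem.2 ?_)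
    rw [h]
    exact Ideal.mem_sup_right (Ideal.mem_span_singleton_self x)
  let f := Ideal.Quotient.mk I
  let M := (singleFunctor _ 0).obj ((ModuleCat.restrictScalars f).obj (ModuleCat.of _ (R ⧸ I)))
  let Q := singleModules (finiteModulesKilledBy J) ⊔ (singleton M).isoClosure
  have hfin (Y : ModuleCat.{0} (R ⧸ I)) (hY : Module.Finite (R ⧸ I) Y) :
      Module.Finite R ((ModuleCat.restrictScalars f).obj Y) := by
    obtain ⟨s, hs⟩ := hY.fg_top
    refine ⟨⟨s, ?_⟩⟩
    rw [eq_top_iff]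
    suffices h : ∀ y : Y, (show (ModuleCat.restrictScalars f).obj Y from y) ∈
      Submodule.span R (show Set ((ModuleCat.restrictScalars f).obj Y) from (s : Set Y)) from
        fun y _ ↦ h y
    intro y
    have hy : y ∈ Submodule.span (R ⧸ I) (s : Set Y) := hs ▸ Submodule.mem_top
    induction hy using Submodule.span_induction with
    | mem y hy => exact Submodule.subset_span hy
    | zero => exact Submodule.zero_mem _
    | add y z _ _ h₁ h₂ => exact Submodule.add_mem _ h₁ h₂
    | smul a y _ h =>
      obtain ⟨a, rfl⟩ := Ideal.Quotient.mk_surjective a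
      exact Submodule.smul_mem _ a h
  have hQ : BoundedlyGenerated (DbProp R) Q := by
    refine (ih J hJ).sup (fun _ _ ↦ DbProp.biprod R) (.of_prop ?_ le_rfl)
    have := hfin (ModuleCat.of _ (R ⧸ I)) (inferInstanceAs (Module.Finite (R ⧸ I) (R ⧸ I)))
    exact DbProp.singleFunctor R _
  have hQne : Q.Nonempty := ⟨M, Or.inr ⟨M, .mk (), ⟨Iso.refl _⟩⟩⟩
  have hx (N : ModuleCat.{0} (R ⧸ I)) (hN : Module.Finite (R ⧸ I) N)
      (h : ∀ y : N, Ideal.Quotient.mk I x • y = 0) : moduleEnvelope f Q 0 N := by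
    refine le_triangEnvelopeIter _ _ _ (Or.inl ⟨_, ⟨hfin N hN, ?_⟩, ⟨Iso.refl _⟩⟩)
    intro y hy z
    obtain ⟨i, hi, w, hw, rfl⟩ := Submodule.mem_sup.1 hy
    obtain ⟨v, rfl⟩ := Ideal.mem_span_singleton'.1 hw
    have h₁ (z : (ModuleCat.restrictScalars f).obj N) : i • z = 0 := by
      change f i • (show N from z) = 0
      rw [Ideal.Quotient.eq_zero_iff_mem.2 hi, zero_smul]
    have h₂ (z : (ModuleCat.restrictScalars f).obj N) : x • z = 0 := h z
    rw [add_smul, h₁, mul_smul, h₂, smul_zero, add_zero]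
  obtain ⟨c, hc⟩ := moduleEnvelope.exists_forall (f := f) (Q := Q) hQne hx₀ hx
    (le_triangEnvelopeIter _ _ _ (Or.inr ⟨M, .mk (), ⟨Iso.refl _⟩⟩)) n hn
  refine (hQ.triangEnvelopeIter c).mono ?_
  rintro X ⟨N, ⟨_, hN⟩, ⟨e⟩⟩
  have htors : Module.IsTorsionBySet R N I := fun y a ↦ hN a.1 a.2 y
  let _ := htors.module
  have : IsScalarTower R (R ⧸ I) N := htors.isScalarTower
  have := hc (ModuleCat.of (R ⧸ I) N) (Module.Finite.of_restrictScalars_finite R (R ⧸ I) N)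
  let e' : (ModuleCat.restrictScalars f).obj (ModuleCat.of (R ⧸ I) N) ≅ N :=
    { hom := ModuleCat.ofHom
        (X := (ModuleCat.restrictScalars f).obj (ModuleCat.of (R ⧸ I) N))
        { toFun := fun y ↦ y, map_add' := fun _ _ ↦ rfl, map_smul' := fun _ _ ↦ rfl }
      inv := ModuleCat.ofHom
        (Y := (ModuleCat.restrictScalars f).obj (ModuleCat.of (R ⧸ I) N))
        { toFun := fun y ↦ y, map_add' := fun _ _ ↦ rfl, map_smul' := fun _ _ ↦ rfl }
      hom_inv_id := rfl
      inv_hom_id := rfl }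
  exact ObjectProperty.prop_of_iso (Q.triangEnvelopeIter c)
    ((singleFunctor _ 0).mapIso e' ≪≫ e.symm) this

theorem boundedlyGenerated_singleModules
    (h : ∀ I : Ideal R, I.IsPrime → HasUniformExtAnn (R ⧸ I)) (I : Ideal R) :
    BoundedlyGenerated (DbProp R) (singleModules (finiteModulesKilledBy I)) := by
  refine IsNoetherian.induction (P := fun I : Ideal R ↦ BoundedlyGenerated (DbProp R)
    (singleModules (finiteModulesKilledBy I))) (fun (I : Ideal R) ih ↦ ?_) I
  by_cases hI : I.IsPrime
  · exact boundedlyGenerated_of_isPrime (h I hI) ih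
  by_cases hI' : I = ⊤
  · exact hI' ▸ boundedlyGenerated_top
  rw [Ideal.isPrime_iff] at hI
  push Not at hI
  obtain ⟨a, b, hab, ha, hb⟩ := hI hI'
  have key (c : R) (hc : c ∉ I) : I ⊔ Ideal.span {c} > I :=
    lt_of_le_of_ne le_sup_left fun h ↦ hc (h ▸
      Ideal.mem_sup_right (Ideal.mem_span_singleton_self c))
  exact boundedlyGenerated_of_mul_mem hab (ih _ (key a ha)) (ih _ (key b hb))

theorem trdim_Db_lt_top_of_forall_isPrime
    (h : ∀ I : Ideal R, I.IsPrime → HasUniformExtAnn (R ⧸ I)) : trdim _ (Db R) < (⊤ : ℕ∞) := by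
  refine trdim_lt_top_of_boundedlyGenerated (D := DbProp R) ?_
  refine (BoundedlyGenerated.triangEnvelopeIter ?_ 1).mono DbProp_le_triangEnvelopeIter
  refine (boundedlyGenerated_singleModules h ⊥).mono ?_
  rintro X ⟨N, hN, e⟩
  exact ⟨N, ⟨hN, fun a ha y ↦ by rw [(Submodule.mem_bot R).1 ha, zero_smul]⟩, e⟩

end NoetherianInduction

section GlobalDimension

open TensorProduct

lemma CategoryTheory.HasProjectiveDimensionLT.map {C D : Type*} [Category C] [Category D]
    [Abelian C] [Abelian D] [EnoughProjectives C] (F : C ⥤ D) [F.Additive]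
    [PreservesFiniteLimits F] [PreservesFiniteColimits F] [F.PreservesProjectiveObjects]
    (X : C) (n : ℕ) [h : HasProjectiveDimensionLT X (n + 1)] :
    HasProjectiveDimensionLT (F.obj X) (n + 1) := by
  induction n generalizing X with
  | zero =>
    have : Projective X := (projective_iff_hasProjectiveDimensionLT_one (X := X)).2 h
    have : Projective (F.obj X) := F.projective_obj X
    infer_instance
  | succ n ih =>
    let p := Projective.π X
    let S := ShortComplex.mk (kernel.ι p) p (kernel.condition p)
    have hS : S.ShortExact :=
      { exact := ShortComplex.exact_of_f_is_kernel _ (kernelIsKernel p)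
        mono_f := inferInstanceAs (Mono (kernel.ι p))
        epi_g := inferInstanceAs (Epi p) }
    have hp : Projective S.X₂ := inferInstanceAs (Projective (Projective.over X))
    have := (hS.hasProjectiveDimensionLT_X₃_iff n hp).1 h
    have := ih S.X₁
    exact ((hS.map_of_exact F).hasProjectiveDimensionLT_X₃_iff n (F.projective_obj S.X₂)).2 this

lemma hasProjectiveDimensionLT_tensorProduct {R : Type} [CommRing R] (S : Type) [CommRing S]
    [Algebra R S] [Module.Flat R S] (N : ModuleCat.{0} R) (n : ℕ)
    [h : HasProjectiveDimensionLT N (n + 1)] :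
    HasProjectiveDimensionLT (ModuleCat.of S (S ⊗[R] N)) (n + 1) := by
  have hproj (N : ModuleCat.{0} R) (hN : Projective N) :
      Projective (ModuleCat.of S (S ⊗[R] N)) := by
    have : Module.Projective R N := (IsProjective.iff_projective N).2 hN
    exact (IsProjective.iff_projective (S ⊗[R] N)).1 inferInstance
  induction n generalizing N with
  | zero =>
    have := hproj N ((projective_iff_hasProjectiveDimensionLT_one (X := N)).2 h)
    infer_instance
  | succ n ih =>
    let p := Projective.π N
    have hp : Function.Surjective p.hom := (ModuleCat.epi_iff_surjective p).1 inferInstance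
    have hT := ModuleCat.shortExact_ker p.hom hp
    have hP : Projective (ModuleCat.of R (Projective.over N : ModuleCat.{0} R)) :=
      inferInstanceAs (Projective (Projective.over N))
    have := (hT.hasProjectiveDimensionLT_X₃_iff n hP).1 h
    let T := ShortComplex.mk (ModuleCat.ofHom ((LinearMap.ker p.hom).subtype.baseChange S))
      (ModuleCat.ofHom (p.hom.baseChange S)) (by
        refine ModuleCat.hom_ext ?_
        change p.hom.baseChange S ∘ₗ (LinearMap.ker p.hom).subtype.baseChange S = 0
        rw [← LinearMap.baseChange_comp, LinearMap.comp_ker_subtype, LinearMap.baseChange_zero])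
    have hT' : T.ShortExact := ModuleCat.shortComplex_shortExact T
      (Module.Flat.lTensor_exact S (LinearMap.exact_subtype_ker_map p.hom))
      (Module.Flat.lTensor_preserves_injective_linearMap _
        (LinearMap.ker p.hom).injective_subtype)
      (LinearMap.lTensor_surjective S hp)
    exact (hT'.hasProjectiveDimensionLT_X₃_iff n (hproj _ hP)).2
      (ih (ModuleCat.of R (LinearMap.ker p.hom)))

/-- All modules over `R` have projective dimension `< n`. -/
def GlobalDimensionLT (R : Type) [CommRing R] (n : ℕ) : Prop :=
  ∀ N : ModuleCat.{0} R, HasProjectiveDimensionLT N n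

lemma GlobalDimensionLT.of_field (K : Type) [Field K] : GlobalDimensionLT K 1 := fun N ↦ by
  have : Projective N := (IsProjective.iff_projective N).1
      (Module.Projective.of_free (R := K) (P := N))
  infer_instance

lemma GlobalDimensionLT.hasUniformExtAnn {R : Type} [CommRing R] [Nontrivial R] {n : ℕ}
    (h : GlobalDimensionLT R (n + 1)) : HasUniformExtAnn R :=
  ⟨1, one_ne_zero, n, fun N ↦ have := h N; .of_hasProjectiveDimensionLT N (n + 1)⟩

lemma GlobalDimensionLT.of_ringEquiv {R S : Type} [CommRing R] [CommRing S] (e : R ≃+* S) {n : ℕ}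
    (h : GlobalDimensionLT R (n + 1)) : GlobalDimensionLT S (n + 1) := fun N ↦ by
  let E := ModuleCat.restrictScalarsEquivalenceOfRingEquiv.{0} e
  have : E.inverse.PreservesProjectiveObjects := ⟨fun hX ↦ E.symm.toAdjunction.map_projective _ hX⟩
  have := h (E.functor.obj N)
  have : HasProjectiveDimensionLT ((E.functor ⋙ E.inverse).obj N) (n + 1) :=
    HasProjectiveDimensionLT.map E.inverse (E.functor.obj N) n
  exact hasProjectiveDimensionLT_of_iso (E.unitIso.symm.app N) _

section Polynomial

open Polynomial

variable (S : Type) [CommRing S] (N : Type) [AddCommGroup N] [Module S N] [Module S[X] N]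
  [IsScalarTower S S[X] N]

/-- Multiplication by `X` on an `S[X]`-module, as an `S`-linear map. -/
noncomputable def mulX : N →ₗ[S] N := ((X : S[X]) • (LinearMap.id : N →ₗ[S[X]] N)).restrictScalars S

/-- The map `X ⊗ 1 - 1 ⊗ X` on `S[X] ⊗ N`. -/
noncomputable def tensorSubX : S[X] ⊗[S] N →ₗ[S[X]] S[X] ⊗[S] N :=
  (X : S[X]) • LinearMap.id - (mulX S N).baseChange S[X]

/-- The action map `S[X] ⊗ N → N`. -/
noncomputable def tensorAct : S[X] ⊗[S] N →ₗ[S[X]] N :=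
  LinearMap.liftBaseChange S[X] (LinearMap.id : N →ₗ[S] N)

lemma tensorSubX_tmul (p : S[X]) (y : N) :
    tensorSubX S N (p ⊗ₜ y) = (X * p) ⊗ₜ y - p ⊗ₜ ((X : S[X]) • y) := by
  simp [tensorSubX, mulX, smul_tmul']

lemma tensorAct_tmul (p : S[X]) (y : N) : tensorAct S N (p ⊗ₜ[S] y) = p • y := by
  simp [tensorAct]

lemma tensorAct_comp_tensorSubX : tensorAct S N ∘ₗ tensorSubX S N = 0 := by
  refine LinearMap.ext fun t ↦ ?_
  induction t using TensorProduct.induction_on with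
  | zero => simp
  | add a b ha hb => rw [map_add, ha, hb, map_add]
  | tmul p y =>
    simp [tensorSubX_tmul, tensorAct_tmul, smul_smul, mul_comm]

lemma tensorSubX_mem_range (p : S[X]) (y : N) :
    p ⊗ₜ[S] y - 1 ⊗ₜ[S] (p • y) ∈ LinearMap.range (tensorSubX S N) := by
  induction p using Polynomial.induction_on generalizing y with
  | C a =>
    have : (C a : S[X]) = a • 1 := by rw [Polynomial.smul_eq_C_mul, mul_one]
    rw [this, smul_tmul, smul_assoc, one_smul, sub_self]
    exact Submodule.zero_mem _
  | add p q hp hq =>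
    rw [add_tmul, add_smul, tmul_add, add_sub_add_comm]
    exact Submodule.add_mem _ (hp y) (hq y)
  | monomial n a h =>
    have h₁ : tensorSubX S N ((C a * X ^ n) ⊗ₜ y) ∈ LinearMap.range (tensorSubX S N) := ⟨_, rfl⟩
    convert Submodule.add_mem _ h₁ (h ((X : S[X]) • y)) using 1
    rw [tensorSubX_tmul, smul_smul, sub_add_sub_cancel,
      show X * (C a * X ^ n) = C a * X ^ (n + 1) by ring,
      show C a * X ^ n * X = C a * X ^ (n + 1) by ring]

lemma tensorSubX_injective : Function.Injective (tensorSubX S N) := by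
  let E := TensorProduct.equivFinsuppOfBasisLeft (N := N) (Polynomial.basisMonomials S)
  have hE (p : S[X]) (y : N) (i : ℕ) : E (p ⊗ₜ y) i = p.coeff i • y :=
    TensorProduct.equivFinsuppOfBasisLeft_apply_tmul_apply _ p y i
  have key (t : S[X] ⊗[S] N) (i : ℕ) :
      E (tensorSubX S N t) (i + 1) = E t i - (X : S[X]) • E t (i + 1) := by
    induction t using TensorProduct.induction_on with
    | zero => simp
    | add a b ha hb => simp only [map_add, Finsupp.add_apply, ha, hb, smul_add]; abel
    | tmul p y =>
      rw [tensorSubX_tmul, map_sub, Finsupp.sub_apply, hE, hE, hE, hE, Polynomial.coeff_X_mul,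
        smul_comm]
  rw [injective_iff_map_eq_zero]
  intro t ht
  have h₁ (i k : ℕ) : E t i = (X ^ k : S[X]) • E t (i + k) := by
    induction k with
    | zero => simp
    | succ k ih =>
      have := key t (i + k)
      rw [ht, map_zero, Finsupp.zero_apply, eq_comm, sub_eq_zero] at this
      rw [ih, this, smul_smul, pow_succ, add_assoc]
  refine E.injective ?_
  rw [map_zero]
  ext i
  obtain ⟨m, hm⟩ := (E t).support.exists_nat_subset_range
  rw [h₁ i m, Finsupp.notMem_support_iff.1 fun h ↦ by simpa using hm h, smul_zero,
    Finsupp.zero_apply]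

lemma exact_tensorSubX_tensorAct : Function.Exact (tensorSubX S N) (tensorAct S N) := by
  rw [LinearMap.exact_iff]
  refine le_antisymm (fun t ht ↦ ?_) ?_
  · have : t - 1 ⊗ₜ (tensorAct S N t) ∈ LinearMap.range (tensorSubX S N) := by
      clear ht
      induction t using TensorProduct.induction_on with
      | zero => simp
      | add a b ha hb =>
        rw [map_add, tmul_add, add_sub_add_comm]
        exact Submodule.add_mem _ ha hb
      | tmul p y =>
        rw [tensorAct_tmul]
        exact tensorSubX_mem_range S N p y
    rwa [LinearMap.mem_ker.1 ht, tmul_zero, sub_zero] at this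
  · rintro _ ⟨t, rfl⟩
    exact LinearMap.congr_fun (tensorAct_comp_tensorSubX S N) t

end Polynomial

open Polynomial in
lemma GlobalDimensionLT.polynomial {S : Type} [CommRing S] {n : ℕ}
    (h : GlobalDimensionLT S (n + 1)) : GlobalDimensionLT S[X] (n + 2) := fun N ↦ by
  let f : S →+* S[X] := C
  let _ : Module S N := Module.compHom N f
  have : IsScalarTower S S[X] N := ⟨fun a p y ↦ by
    rw [Polynomial.smul_eq_C_mul, mul_smul]; rfl⟩
  have := h (ModuleCat.of S N)
  have h₂ : HasProjectiveDimensionLT (ModuleCat.of S[X] (S[X] ⊗[S] N)) (n + 1) :=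
    hasProjectiveDimensionLT_tensorProduct S[X] (ModuleCat.of S N) n
  let T := ShortComplex.mk (ModuleCat.ofHom (tensorSubX S N)) (ModuleCat.ofHom (tensorAct S N))
    (ModuleCat.hom_ext (tensorAct_comp_tensorSubX S N))
  have hT : T.ShortExact := ModuleCat.shortComplex_shortExact T (exact_tensorSubX_tensorAct S N)
    (tensorSubX_injective S N) fun y ↦ ⟨1 ⊗ₜ y, (tensorAct_tmul S N 1 y).trans (one_smul _ y)⟩
  exact hT.hasProjectiveDimensionLT_X₃ (n + 1) h₂
    (hasProjectiveDimensionLT_of_ge _ (n + 1) _ (Nat.le_succ _))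

lemma GlobalDimensionLT.mvPolynomial (K : Type) [Field K] (n : ℕ) :
    GlobalDimensionLT (MvPolynomial (Fin n) K) (n + 1) := by
  induction n with
  | zero =>
    exact (GlobalDimensionLT.of_field K).of_ringEquiv
      (MvPolynomial.isEmptyAlgEquiv K (Fin 0)).symm.toRingEquiv
  | succ n ih => exact ih.polynomial.of_ringEquiv (MvPolynomial.finSuccEquiv K n).symm.toRingEquiv

end GlobalDimension

section Simple

open Polynomial

lemma exists_free_factorization (S M : Type) [CommRing S] [IsDomain S] [AddCommGroup M] [Module S M]
    [Module.Finite S M] :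
    ∃ (c : S) (P : Submodule S M), c ≠ 0 ∧ Module.Free S P ∧ ∀ y : M, c • y ∈ P := by
  obtain ⟨n, v, hv⟩ := Module.Finite.exists_fin (R := S) (M := M)
  obtain ⟨s, hs, h⟩ := exists_maximal_linearIndepOn S v
  have h' : ∀ i, ∃ a : S, a ≠ 0 ∧ a • v i ∈ Submodule.span S (v '' s) := by
    intro i
    by_cases hi : i ∈ s
    · exact ⟨1, one_ne_zero, by
        rw [one_smul]; exact Submodule.subset_span (Set.mem_image_of_mem v hi)⟩
    · exact h i hi
  choose a ha hav using h'
  refine ⟨∏ i, a i, Submodule.span S (v '' s), Finset.prod_ne_zero_iff.2 fun i _ ↦ ha i, ?_, ?_⟩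
  · rw [Set.image_eq_range]
    exact Module.Free.of_basis (Module.Basis.span hs)
  · have key : (⊤ : Submodule S M) ≤
        (Submodule.span S (v '' s)).comap (LinearMap.lsmul S M (∏ i, a i)) := by
      rw [← hv, Submodule.span_le]
      rintro _ ⟨i, rfl⟩
      change (∏ i, a i) • v i ∈ Submodule.span S (v '' s)
      rw [← Finset.prod_erase_mul _ _ (Finset.mem_univ i), mul_smul]
      exact Submodule.smul_mem _ _ (hav i)
    exact fun y ↦ key Submodule.mem_top

lemma ExtAnn.finsupp_of_finite (S R : Type) [CommRing S] [IsDomain S] [CommRing R] [Algebra S R]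
    [Module.Finite S R] :
    ∃ c : S, c ≠ 0 ∧ ∀ (ι : Type) (m : ℕ), ExtAnn c (m + 1) (ModuleCat.of S (ι →₀ R)) := by
  obtain ⟨c, P, hc, hP, hcP⟩ := exists_free_factorization S R
  refine ⟨c, hc, fun ι m ↦ ?_⟩
  have : Projective (ModuleCat.of S (ι →₀ P)) :=
    (IsProjective.iff_projective (ι →₀ P)).1 inferInstance
  let u : R →ₗ[S] P := (LinearMap.lsmul S R c).codRestrict P hcP
  refine ExtAnn.of_factors (P := ModuleCat.of S (ι →₀ P))
    (ModuleCat.ofHom (Finsupp.mapRange.linearMap u))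
    (ModuleCat.ofHom (Finsupp.mapRange.linearMap P.subtype)) ?_ m
  ext : 1
  refine LinearMap.ext fun f ↦ ?_
  ext i
  rfl

variable {S R : Type} [CommRing S] [CommRing R] [Algebra S R]

/-- The twisted derivative of a semilinear map: a linear map `φ` over `S` is corrected along a
polynomial `g` into one whose commutator with `x` is the commutator of `φ` with `g(x)`. -/
lemma exists_linearMap_commutator_eq {N F : Type} [AddCommGroup N] [Module R N] [Module S N]
    [IsScalarTower S R N] [AddCommGroup F] [Module R F] [Module S F] [IsScalarTower S R F]
    (p : F →ₗ[R] N) (φ : N →ₗ[S] F) (t : S) (h : ∀ y, p (φ y) = t • y) (x : R) (g : S[X]) :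
    ∃ ψ : N →ₗ[S] F, (∀ y, x • ψ y - ψ (x • y) = aeval x g • φ y - φ (aeval x g • y)) ∧
      ∀ y, p (ψ y) = (algebraMap S R t * aeval x (derivative g)) • y := by
  induction g using Polynomial.induction_on with
  | C a => exact ⟨0, by simp, by simp⟩
  | add g₁ g₂ h₁ h₂ =>
    obtain ⟨ψ₁, h₁, h₁'⟩ := h₁
    obtain ⟨ψ₂, h₂, h₂'⟩ := h₂
    refine ⟨ψ₁ + ψ₂, fun y ↦ ?_, fun y ↦ ?_⟩
    · have e : x • (ψ₁ + ψ₂) y - (ψ₁ + ψ₂) (x • y) =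
          (x • ψ₁ y - ψ₁ (x • y)) + (x • ψ₂ y - ψ₂ (x • y)) := by
        simp only [LinearMap.add_apply, smul_add]; abel
      rw [e, h₁, h₂]
      simp only [map_add, add_smul]
      abel
    · simp only [LinearMap.add_apply, map_add, h₁', h₂', mul_add, add_smul]
  | monomial n a h =>
    generalize hg : C a * X ^ n = g at h
    have hg' : C a * X ^ (n + 1) = g * X := by rw [← hg, pow_succ, mul_assoc]
    rw [hg']
    obtain ⟨ψ, h₁, h₂⟩ := h
    refine ⟨(LinearMap.lsmul R F x).restrictScalars S ∘ₗ ψ +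
      φ ∘ₗ (LinearMap.lsmul R N (aeval x g)).restrictScalars S, fun y ↦ ?_, fun y ↦ ?_⟩
    · have e := congr_arg (x • ·) (h₁ y)
      simp only [smul_sub] at e
      simp only [LinearMap.add_apply, LinearMap.comp_apply, LinearMap.restrictScalars_apply,
        LinearMap.lsmul_apply, map_mul, aeval_X, smul_add, mul_smul]
      rw [smul_comm x (aeval x g) (φ y)] at e
      have e2 : x • x • ψ y = aeval x g • x • φ y - x • φ (aeval x g • y) + x • ψ (x • y) := by
        rw [← e]; abel
      rw [e2]; abel
    · simp only [LinearMap.add_apply, LinearMap.comp_apply, LinearMap.restrictScalars_apply,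
        LinearMap.lsmul_apply, map_add, map_smul, h, h₂, derivative_mul, derivative_X, map_mul,
        aeval_X, mul_one]
      rw [← algebraMap_smul R t (aeval x g • y)]
      simp only [← mul_smul, ← add_smul]
      congr 1
      ring

lemma map_smul_of_adjoin_eq_top {N F : Type} [AddCommGroup N] [Module R N] [Module S N]
    [IsScalarTower S R N] [AddCommGroup F] [Module R F] [Module S F] [IsScalarTower S R F]
    {x : R} (hx : Algebra.adjoin S {x} = ⊤) (ψ : N →ₗ[S] F) (h : ∀ y, ψ (x • y) = x • ψ y)
    (r : R) (y : N) : ψ (r • y) = r • ψ y := by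
  have hr : r ∈ Algebra.adjoin S {x} := hx ▸ Algebra.mem_top
  induction hr using Algebra.adjoin_induction generalizing y with
  | mem z hz => obtain rfl := hz; exact h y
  | algebraMap s => simp
  | add a b _ _ ha hb => simp only [add_smul, map_add, ha, hb]
  | mul a b _ _ ha hb => simp only [mul_smul, ha, hb]

lemma ExtAnn.of_adjoin_eq_top {c : S}
    (hc : ∀ (ι : Type) (m : ℕ), ExtAnn c (m + 1) (ModuleCat.of S (ι →₀ R)))
    {x : R} (hx : Algebra.adjoin S {x} = ⊤) {g : S[X]} (hg : aeval x g = 0) (n : ℕ) :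
    ∀ (t : S) (N : Type) [AddCommGroup N] [Module R N] [Module S N] [IsScalarTower S R N],
      ExtAnn t (n + 1) (ModuleCat.of S N) →
      ExtAnn (algebraMap S R (t * c ^ n) * aeval x (derivative g)) (n + 1) (ModuleCat.of R N) := by
  have hsurj (N : Type) [AddCommGroup N] [Module R N] :
      Function.Surjective (Finsupp.linearCombination R (id : N → N)) :=
    Finsupp.linearCombination_id_surjective R N
  have hproj (N : Type) : Projective (ModuleCat.of R (N →₀ R)) :=
    (IsProjective.iff_projective (N →₀ R)).1 inferInstance
  induction n with
  | zero =>
    intro t N _ _ _ _ h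
    let p : (N →₀ R) →ₗ[R] N := Finsupp.linearCombination R id
    have : Epi (ModuleCat.ofHom (p.restrictScalars S)) :=
      (ModuleCat.epi_iff_surjective _).2 (hsurj N)
    obtain ⟨s, hs⟩ := h.exists_lift (ModuleCat.ofHom (p.restrictScalars S))
    have hs' (y : N) : p (s.hom y) = t • y :=
      congr_arg (fun f : ModuleCat.of S N ⟶ ModuleCat.of S N ↦ f.hom y) hs
    obtain ⟨ψ, h₁, h₂⟩ := exists_linearMap_commutator_eq p s.hom t hs' x g
    have h₃ (y : N) : ψ (x • y) = x • ψ y := by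
      have := h₁ y
      rw [hg, zero_smul, zero_smul, map_zero, sub_zero, sub_eq_zero] at this
      exact this.symm
    let ψ' : N →ₗ[R] (N →₀ R) :=
      { toFun := ψ
        map_add' := map_add ψ
        map_smul' := map_smul_of_adjoin_eq_top hx ψ h₃ }
    have := hproj N
    refine ExtAnn.of_factors (P := ModuleCat.of R (N →₀ R)) (ModuleCat.ofHom ψ')
      (ModuleCat.ofHom p) ?_ 0
    ext y
    rw [pow_zero, mul_one]
    exact h₂ y
  | succ n ih =>
    intro t N _ _ _ _ h
    let p : (N →₀ R) →ₗ[R] N := Finsupp.linearCombination R id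
    let K := LinearMap.ker p
    have hS := ModuleCat.shortExact_ker (p.restrictScalars S) (hsurj N)
    have h₁ : ExtAnn (t * c) (n + 1) (ModuleCat.of S K) :=
      ExtAnn.of_X₂_of_X₃ hS h (hc N n)
    have h₂ := ih (t * c) K h₁
    have hR := ModuleCat.shortExact_ker p (hsurj N)
    have := hproj N
    have h₃ := ExtAnn.of_X₁_of_X₂ hR h₂ (ExtAnn.of_projective (ModuleCat.of R (N →₀ R)) (n + 1))
    rw [mul_one] at h₃
    rw [pow_succ', ← mul_assoc]
    exact h₃

theorem HasUniformExtAnn.of_adjoin_eq_top [IsDomain S] [IsDomain R] [FaithfulSMul S R]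
    [Module.Finite S R] {x : R} (hx : Algebra.adjoin S {x} = ⊤) {g : S[X]} (hg : aeval x g = 0)
    (hg' : aeval x (derivative g) ≠ 0) (h : HasUniformExtAnn S) : HasUniformExtAnn R := by
  obtain ⟨c, hc, hcF⟩ := ExtAnn.finsupp_of_finite S R
  obtain ⟨s, hs, n, hsN⟩ := h
  refine ⟨algebraMap S R (s * c ^ n) * aeval x (derivative g), mul_ne_zero ?_ hg', n, fun N ↦ ?_⟩
  · rw [Ne, FaithfulSMul.algebraMap_eq_zero_iff]
    exact mul_ne_zero hs (pow_ne_zero n hc)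
  · let := Module.compHom N (algebraMap S R)
    have : IsScalarTower S R N := ⟨fun a b y ↦ by rw [Algebra.smul_def, mul_smul]; rfl⟩
    exact ExtAnn.of_adjoin_eq_top hcF hx hg n s N (hsN (ModuleCat.of S N))

end Simple

section SeparableNormalization

open MvPolynomial

lemma MvPolynomial.totalDegree_pderiv_lt {k ι : Type*} [CommSemiring k] (f : MvPolynomial ι k)
    (i : ι)
    (hf : 0 < f.totalDegree) : (pderiv i f).totalDegree < f.totalDegree := by
  rw [totalDegree, Finset.sup_lt_iff hf]
  intro m hm
  have hm' : m + Finsupp.single i 1 ∈ f.support := by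
    rw [mem_support_iff, coeff_pderiv] at hm
    exact mem_support_iff.2 (left_ne_zero_of_mul hm)
  have h := le_totalDegree hm'
  rw [Finsupp.sum_add_index' (fun _ ↦ rfl) (fun _ _ _ ↦ rfl), Finsupp.sum_single_index rfl] at h
  omega

lemma MvPolynomial.exists_eq_pow_of_forall_pderiv_eq_zero {k ι : Type*} [Field k] (p : ℕ)
    [hp : Fact p.Prime] [CharP k p] [PerfectField k] (f : MvPolynomial ι k)
    (h : ∀ i, pderiv i f = 0) :
    ∃ g : MvPolynomial ι k, f = g ^ p ∧ g.totalDegree * p ≤ f.totalDegree := by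
  have hdvd (m : ι →₀ ℕ) (hm : m ∈ f.support) (i : ι) : p ∣ m i := by
    by_contra hi
    have h0 : m i ≠ 0 := fun h0 ↦ hi (h0 ▸ dvd_zero p)
    have e : m - Finsupp.single i 1 + Finsupp.single i 1 = m :=
      tsub_add_cancel_of_le (Finsupp.single_le_iff.2 (Nat.one_le_iff_ne_zero.2 h0))
    have := congr_arg (coeff (m - Finsupp.single i 1)) (h i)
    rw [coeff_pderiv, e, coeff_zero, mul_eq_zero] at this
    have hmi : (((m - Finsupp.single i 1 : ι →₀ ℕ) i : ℕ) : k) + 1 = (m i : k) := by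
      rw [← Nat.cast_succ]
      congr 1
      simp only [Finsupp.coe_tsub, Pi.sub_apply, Finsupp.single_eq_same]
      omega
    rw [hmi, CharP.cast_eq_zero_iff k p] at this
    exact this.elim (mem_support_iff.1 hm) hi
  let div (m : ι →₀ ℕ) : ι →₀ ℕ := m.mapRange (· / p) (Nat.zero_div p)
  have hdiv (m : ι →₀ ℕ) (hm : m ∈ f.support) : p • div m = m := by
    ext i
    exact Nat.mul_div_cancel' (hdvd m hm i)
  let f' : MvPolynomial ι k := ∑ m ∈ f.support, monomial (div m) (coeff m f)
  have hf' : expand p f' = f := by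
    conv_rhs => rw [← f.support_sum_monomial_coeff]
    rw [map_sum]
    refine Finset.sum_congr rfl fun m hm ↦ ?_
    rw [expand_monomial, hdiv m hm]
  have := ExpChar.prime (R := k) hp.out
  refine ⟨map (frobeniusEquiv k p).symm.toRingHom f', ?_, ?_⟩
  · rw [← map_frobenius_expand p, ← hf', map_expand, map_map]
    have h : (frobenius k p).comp (frobeniusEquiv k p).symm.toRingHom = RingHom.id k :=
      RingHom.ext (frobeniusEquiv k p).apply_symm_apply
    rw [h, map_id]
  · rw [← hf', totalDegree_expand]
    exact Nat.mul_le_mul_right p (Finset.sup_mono (support_map_subset _ _))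

lemma exists_aeval_pderiv_ne_zero {k R ι : Type*} [Field k] [PerfectField k] [CommRing R]
    [IsDomain R] [Algebra k R] (x : ι → R) (p : ℕ) [hp : Fact p.Prime] [CharP k p]
    (hx : ¬ AlgebraicIndependent k x) :
    ∃ (f : MvPolynomial ι k) (i : ι), aeval x f = 0 ∧ aeval x (pderiv i f) ≠ 0 := by
  let T : Set (MvPolynomial ι k) := {f | f ≠ 0 ∧ aeval x f = 0}
  have hT : T.Nonempty := by
    rw [algebraicIndependent_iff] at hx
    push Not at hx
    obtain ⟨f, h₁, h₂⟩ := hx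
    exact ⟨f, h₂, h₁⟩
  let f := totalDegree.argminOn T hT
  obtain ⟨hf₀, hfx⟩ : f ∈ T := totalDegree.argminOn_mem T hT
  have hmin (g : MvPolynomial ι k) (hg : aeval x g = 0) (h : g.totalDegree < f.totalDegree) :
      g = 0 := by
    by_contra hg₀
    exact totalDegree.not_lt_argminOn T (a := g) ⟨hg₀, hg⟩ h
  have hpos (g : MvPolynomial ι k) (h₀ : g ≠ 0) (h : aeval x g = 0) : 0 < g.totalDegree := by
    rw [pos_iff_ne_zero]
    intro h'
    rw [totalDegree_eq_zero_iff_eq_C] at h'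
    rw [h', algHom_C, FaithfulSMul.algebraMap_eq_zero_iff] at h
    exact h₀ (by rw [h', h, C_0])
  by_contra! hcon
  obtain ⟨g, hg, hdeg⟩ := exists_eq_pow_of_forall_pderiv_eq_zero p f fun i ↦
    hmin _ (hcon f i hfx) (totalDegree_pderiv_lt f i (hpos f hf₀ hfx))
  have hg₀ : g ≠ 0 := by
    rintro rfl
    exact hf₀ (hg.trans (zero_pow hp.out.ne_zero))
  have hgx : aeval x g = 0 := by
    rw [hg, map_pow] at hfx
    exact eq_zero_of_pow_eq_zero hfx
  refine hg₀ (hmin g hgx (lt_of_lt_of_le ?_ hdeg))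
  exact lt_mul_of_one_lt_right (hpos g hg₀ hgx) hp.out.one_lt

lemma exists_weights (m e B : ℕ) (he : 0 < e) (i₀ : Fin (m + 1)) :
    ∃ r : Fin (m + 1) → ℕ, r i₀ = 1 ∧ (∀ j, r j ≠ 0) ∧ (∀ j, j ≠ i₀ → e ∣ r j) ∧
      ∀ v w : Fin (m + 1) → ℕ, (∀ j, v j < B) → (∀ j, w j < B) →
        ∑ j, r j * v j = ∑ j, r j * w j → v = w := by
  let N := e * (B + 2)
  let σ : Equiv.Perm (Fin (m + 1)) := Equiv.swap i₀ 0
  have hB : B + 2 ≤ N := Nat.le_mul_of_pos_left _ he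
  refine ⟨fun j ↦ N ^ (σ j : ℕ), by simp [σ], fun j ↦ pow_ne_zero _ (by omega), ?_, ?_⟩
  · intro j hj
    refine dvd_pow (Dvd.intro _ rfl) ?_
    intro h
    refine hj (σ.injective ?_)
    rw [Equiv.swap_apply_left]
    exact Fin.ext h
  · intro v w hv hw h
    have key (u : Fin (m + 1) → ℕ) :
        ∑ j, N ^ (σ j : ℕ) * u j = Nat.ofDigits N (List.ofFn (u ∘ σ.symm)) := by
      rw [← Equiv.sum_comp σ.symm]
      simp [Nat.ofDigits_eq_sum_mapIdx, List.mapIdx_eq_ofFn, mul_comm, List.sum_ofFn,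
        Fin.sum_univ_succ (fun j : Fin (m + 1) ↦ N ^ (j : ℕ) * u (σ.symm j))]
    rw [key, key] at h
    have := Nat.ofDigits_inj_of_len_eq (by omega : 1 < N) (by simp) ?_ ?_ h
    · have := List.ofFn_injective this
      ext j
      simpa using congr_fun this (σ j)
    · intro l hl
      obtain ⟨j, rfl⟩ := (List.mem_ofFn' _ _).1 hl
      exact (hv _).trans_le (by omega)
    · intro l hl
      obtain ⟨j, rfl⟩ := (List.mem_ofFn' _ _).1 hl
      exact (hw _).trans_le (by omega)

/-- If distinct monomials of `f` have distinct weights with respect to `r`, then a substitution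
`X j ↦ X ^ r j + C (y j)` makes `f` monic, up to a scalar. -/
lemma exists_monic_smul_aeval {k S ι : Type*} [Field k] [CommRing S] [Nontrivial S] [Algebra k S]
    [Fintype ι] (r : ι → ℕ) (hr : ∀ j, r j ≠ 0) (y : ι → S) {f : MvPolynomial ι k} (hf : f ≠ 0)
    (hinj : ∀ v ∈ f.support, ∀ w ∈ f.support, ∑ j, r j * v j = ∑ j, r j * w j → v = w) :
    ∃ a : k, a ≠ 0 ∧
      (Polynomial.C (algebraMap k S a) *
        aeval (fun j ↦ Polynomial.X ^ r j + Polynomial.C (y j)) f).Monic := by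
  let q (v : ι →₀ ℕ) : Polynomial S :=
    ∏ j, (Polynomial.X ^ r j + Polynomial.C (y j)) ^ v j
  have hq (v : ι →₀ ℕ) : (q v).Monic :=
    Polynomial.monic_prod_of_monic _ _ fun j _ ↦ (Polynomial.monic_X_pow_add_C _ (hr j)).pow _
  have hqd (v : ι →₀ ℕ) : (q v).natDegree = ∑ j, r j * v j := by
    rw [Polynomial.natDegree_prod_of_monic _ _ fun j _ ↦
      (Polynomial.monic_X_pow_add_C _ (hr j)).pow _]
    refine Finset.sum_congr rfl fun j _ ↦ ?_
    rw [(Polynomial.monic_X_pow_add_C _ (hr j)).natDegree_pow, Polynomial.natDegree_X_pow_add_C,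
      mul_comm]
  have hfq : aeval (fun j ↦ Polynomial.X ^ r j + Polynomial.C (y j)) f =
      ∑ v ∈ f.support, coeff v f • q v := by
    conv_lhs => rw [← f.support_sum_monomial_coeff]
    rw [map_sum]
    refine Finset.sum_congr rfl fun v _ ↦ ?_
    rw [aeval_monomial, Algebra.smul_def, Finsupp.prod_fintype _ _ fun j ↦ pow_zero _]
  obtain ⟨v, hv, hmax⟩ := Finset.exists_max_image f.support (fun v ↦ ∑ j, r j * v j)
    (support_nonempty.2 hf)
  have ha := mem_support_iff.1 hv
  refine ⟨(coeff v f)⁻¹, inv_ne_zero ha,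
    Polynomial.monic_of_natDegree_le_of_coeff_eq_one (∑ j, r j * v j) ?_ ?_⟩
  · refine (Polynomial.natDegree_C_mul_le _ _).trans ?_
    rw [hfq]
    refine Polynomial.natDegree_sum_le_of_forall_le _ _ fun w hw ↦ ?_
    exact (Polynomial.natDegree_smul_le _ _).trans ((hqd w).trans_le (hmax w hw))
  · rw [Polynomial.coeff_C_mul, ← Algebra.smul_def, hfq, Polynomial.finsetSum_coeff,
      Finset.sum_eq_single v]
    · rw [Polynomial.coeff_smul, ← hqd v, (hq v).coeff_natDegree, smul_smul, inv_mul_cancel₀ ha,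
        one_smul]
    · intro w hw hwv
      rw [Polynomial.coeff_smul, Polynomial.coeff_eq_zero_of_natDegree_lt, smul_zero]
      rw [hqd]
      exact lt_of_le_of_ne (hmax w hw) fun h ↦ hwv (hinj w hw v hv h)
    · exact fun h ↦ (h hv).elim

lemma aeval_derivative_aeval {k S R ι : Type*} [Field k] [CommRing S] [Algebra k S] [CommRing R]
    [Algebra k R] [Algebra S R] [IsScalarTower k S R] (r : ι → ℕ) (y : ι → S) (x : ι → R) (i : ι)
    (hy : ∀ j, algebraMap S R (y j) = x j - x i ^ r j) (hi : r i = 1)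
    (hr : ∀ j, j ≠ i → ((r j : ℕ) : R) = 0) (f : MvPolynomial ι k) :
    Polynomial.aeval (x i) (aeval (fun j ↦ Polynomial.X ^ r j + Polynomial.C (y j)) f) =
        aeval x f ∧
      Polynomial.aeval (x i) (Polynomial.derivative
        (aeval (fun j ↦ Polynomial.X ^ r j + Polynomial.C (y j)) f)) = aeval x (pderiv i f) := by
  classical
  induction f using MvPolynomial.induction_on with
  | C a =>
    rw [algHom_C, algHom_C, pderiv_C, map_zero, IsScalarTower.algebraMap_apply k S (Polynomial S)]
    simp [← IsScalarTower.algebraMap_apply k S R]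
  | add f g hf hg => simp only [map_add, hf, hg, and_self]
  | mul_X f j h =>
    have hX : Polynomial.aeval (x i) (Polynomial.derivative
        (Polynomial.X ^ r j + Polynomial.C (y j))) = aeval x (pderiv i (X j : MvPolynomial ι k)) :=
          by
      by_cases hj : j = i
      · subst hj
        simp [hi]
      · simp [pderiv_X_of_ne hj, Polynomial.derivative_X_pow, hr j hj]
    refine ⟨by simp [h.1, hy], ?_⟩
    rw [map_mul, pderiv_mul, Polynomial.derivative_mul, map_add, map_mul, map_mul, aeval_X, hX,
      h.1, h.2]
    simp [hy]

end SeparableNormalization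

section FiniteTypeDomain

open MvPolynomial

lemma IsIntegral.exists_aeval_derivative_ne_zero (k : Type*) {S R : Type*} [Field k] [CharZero k]
    [CommRing S] [Algebra k S] [CommRing R] [Nontrivial R] [Algebra S R] {x : R}
    (hx : IsIntegral S x) :
    ∃ g : Polynomial S, Polynomial.aeval x g = 0 ∧ Polynomial.aeval x
      (Polynomial.derivative g) ≠ 0 := by
  refine ⟨minpoly S x, minpoly.aeval S x, fun h ↦ ?_⟩
  have : Nontrivial S := (algebraMap S R).domain_nontrivial
  have hpos := minpoly.natDegree_pos hx
  have hm := minpoly.monic hx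
  obtain ⟨d, hd⟩ := Nat.exists_eq_succ_of_ne_zero hpos.ne'
  have hd0 : ((d + 1 : ℕ) : k) ≠ 0 := Nat.cast_ne_zero.2 d.succ_ne_zero
  let q := Polynomial.C (algebraMap k S ((d + 1 : ℕ) : k)⁻¹) *
    Polynomial.derivative (minpoly S x)
  have hqd : q.natDegree ≤ d :=
    (Polynomial.natDegree_C_mul_le _ _).trans
      ((Polynomial.natDegree_derivative_le _).trans (by omega))
  have hq : q.Monic := by
    refine Polynomial.monic_of_natDegree_le_of_coeff_eq_one d hqd ?_
    have h1 : (minpoly S x).coeff (d + 1) = 1 := by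
      rw [← Nat.succ_eq_add_one, ← hd]
      exact hm.coeff_natDegree
    have h2 : (d : S) + 1 = algebraMap k S ((d + 1 : ℕ) : k) := by simp
    rw [Polynomial.coeff_C_mul, Polynomial.coeff_derivative, h1, one_mul, h2, ← map_mul,
      inv_mul_cancel₀ hd0, map_one]
  have hqx : Polynomial.aeval x q = 0 := by rw [map_mul, h, mul_zero]
  have := Polynomial.natDegree_le_natDegree (minpoly.min S x hq hqx)
  omega

variable {k : Type} [Field k]

lemma exists_monic_aeval_derivative {R S ι : Type*} [CommRing R] [IsDomain R] [Algebra k R]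
    [CommRing S] [Nontrivial S] [Algebra k S] [Algebra S R] [IsScalarTower k S R] [Fintype ι]
    (r : ι → ℕ) (hr : ∀ j, r j ≠ 0) (y : ι → S) (x : ι → R) (i : ι)
    (hy : ∀ j, algebraMap S R (y j) = x j - x i ^ r j) {f : MvPolynomial ι k} (hf : f ≠ 0)
    (hfx : aeval x f = 0)
    (hinj : ∀ v ∈ f.support, ∀ w ∈ f.support, ∑ j, r j * v j = ∑ j, r j * w j → v = w) :
    ∃ g : Polynomial S, g.Monic ∧ Polynomial.aeval (x i) g = 0 ∧
      (r i = 1 → (∀ j, j ≠ i → ((r j : ℕ) : R) = 0) → aeval x (pderiv i f) ≠ 0 →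
        Polynomial.aeval (x i) (Polynomial.derivative g) ≠ 0) := by
  obtain ⟨a, ha, hmonic⟩ := exists_monic_smul_aeval r hr y hf hinj
  have h0 : Polynomial.aeval (x i)
      (aeval (fun j ↦ Polynomial.X ^ r j + Polynomial.C (y j)) f) = 0 := by
    have : ((Polynomial.aeval (R := S) (x i)).restrictScalars k).comp
        (aeval (fun j ↦ Polynomial.X ^ r j + Polynomial.C (y j))) = aeval x := by
      refine MvPolynomial.algHom_ext fun j ↦ ?_
      simp [hy]
    exact (DFunLike.congr_fun this f).trans hfx
  refine ⟨_, hmonic, by rw [map_mul, h0, mul_zero], fun hi hr' hne ↦ ?_⟩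
  rw [Polynomial.derivative_C_mul, map_mul, (aeval_derivative_aeval r y x i hy hi hr' f).2,
    Polynomial.aeval_C, ← IsScalarTower.algebraMap_apply k S R]
  exact mul_ne_zero ((FaithfulSMul.algebraMap_eq_zero_iff k R).not.2 ha) hne

lemma exists_monic_aeval_eq_zero {R : Type*} [CommRing R] [IsDomain R] [Algebra k R] {m : ℕ}
    (x : Fin (m + 1) → R) (hx : Algebra.adjoin k (Set.range x) = ⊤)
    {f : MvPolynomial (Fin (m + 1)) k} (hf : f ≠ 0) (hfx : aeval x f = 0) (i : Fin (m + 1))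
    (e : ℕ) (he : 0 < e) :
    ∃ (y : Fin m → R) (g : Polynomial (Algebra.adjoin k (Set.range y))), g.Monic ∧
      Polynomial.aeval (x i) g = 0 ∧
      Algebra.adjoin (Algebra.adjoin k (Set.range y)) {x i} = ⊤ ∧
      ((e : R) = 0 → aeval x (pderiv i f) ≠ 0 →
        Polynomial.aeval (x i) (Polynomial.derivative g) ≠ 0) := by
  obtain ⟨r, hri, hr, hre, hinj⟩ := exists_weights m e (f.totalDegree + 1) he i
  let y (l : Fin m) : R := x (i.succAbove l) - x i ^ r (i.succAbove l)
  let S := Algebra.adjoin k (Set.range y)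
  have hY (j : Fin (m + 1)) : x j - x i ^ r j ∈ S := by
    rcases Fin.eq_self_or_eq_succAbove i j with rfl | ⟨l, rfl⟩
    · rw [hri, pow_one, sub_self]
      exact S.zero_mem
    · exact Algebra.subset_adjoin ⟨l, rfl⟩
  let Y (j : Fin (m + 1)) : S := ⟨_, hY j⟩
  have hlt (v : Fin (m + 1) →₀ ℕ) (hv : v ∈ f.support) (j : Fin (m + 1)) :
      v j < f.totalDegree + 1 :=
    Nat.lt_succ_of_le ((monomial_le_degreeOf j hv).trans (degreeOf_le_totalDegree f j))
  obtain ⟨g, hg, hgx, hg'⟩ := exists_monic_aeval_derivative r hr Y x i (fun _ ↦ rfl) hf hfx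
    fun v hv w hw h ↦ DFunLike.coe_injective (hinj v w (hlt v hv) (hlt w hw) h)
  refine ⟨y, g, hg, hgx, ?_, fun he0 ↦ hg' hri fun j hj ↦ ?_⟩
  · have hle : Algebra.adjoin k (Set.range x) ≤ (Algebra.adjoin S {x i}).restrictScalars k := by
      rw [Algebra.adjoin_le_iff]
      rintro _ ⟨j, rfl⟩
      have h1 : x j = algebraMap S R (Y j) + x i ^ r j := (sub_add_cancel _ _).symm
      rw [h1]
      exact add_mem (Subalgebra.algebraMap_mem (Algebra.adjoin S {x i}) (Y j))
        (pow_mem (Algebra.subset_adjoin (Set.mem_singleton (x i))) (r j))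
    rw [hx] at hle
    exact eq_top_iff.2 fun z _ ↦ hle Algebra.mem_top
  · obtain ⟨c, hc⟩ := hre j hj
    rw [hc, Nat.cast_mul, he0, zero_mul]

lemma exists_separable_normalization [PerfectField k] {R : Type*} [CommRing R] [IsDomain R]
    [Algebra k R] {m : ℕ} (x : Fin (m + 1) → R) (hx : Algebra.adjoin k (Set.range x) = ⊤)
    (hind : ¬ AlgebraicIndependent k x) :
    ∃ (y : Fin m → R) (z : R) (g : Polynomial (Algebra.adjoin k (Set.range y))),
      IsIntegral (Algebra.adjoin k (Set.range y)) z ∧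
      Algebra.adjoin (Algebra.adjoin k (Set.range y)) {z} = ⊤ ∧
      Polynomial.aeval z g = 0 ∧ Polynomial.aeval z (Polynomial.derivative g) ≠ 0 := by
  obtain ⟨p, hp⟩ := CharP.exists k
  rcases CharP.char_is_prime_or_zero k p with hprime | rfl
  · have : Fact p.Prime := ⟨hprime⟩
    obtain ⟨f, i, hf, hfi⟩ := exists_aeval_pderiv_ne_zero x p hind
    have hf₀ : f ≠ 0 := by
      rintro rfl
      exact hfi (by simp)
    obtain ⟨y, g, hg, hgx, htop, hg'⟩ :=
      exists_monic_aeval_eq_zero x hx hf₀ hf i p hprime.pos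
    refine ⟨y, x i, g, ⟨g, hg, hgx⟩, htop, hgx, hg' ?_ hfi⟩
    rw [← map_natCast (algebraMap k R), CharP.cast_eq_zero, map_zero]
  · have : CharZero k := CharP.charP_to_charZero k
    rw [algebraicIndependent_iff] at hind
    push Not at hind
    obtain ⟨f, hf, hf₀⟩ := hind
    obtain ⟨y, g, hg, hgx, htop, -⟩ := exists_monic_aeval_eq_zero x hx hf₀ hf 0 1 one_pos
    have hzint : IsIntegral (Algebra.adjoin k (Set.range y)) (x 0) := ⟨g, hg, hgx⟩
    obtain ⟨g', h₁, h₂⟩ := hzint.exists_aeval_derivative_ne_zero k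
    exact ⟨y, x 0, g', hzint, htop, h₁, h₂⟩

lemma HasUniformExtAnn.of_adjoin_range_eq_top [PerfectField k] (n : ℕ) :
    ∀ (R : Type) [CommRing R] [IsDomain R] [Algebra k R] (x : Fin n → R),
      Algebra.adjoin k (Set.range x) = ⊤ → HasUniformExtAnn R := by
  have hfree (n : ℕ) (R : Type) [CommRing R] [IsDomain R] [Algebra k R] (x : Fin n → R)
      (hx : Algebra.adjoin k (Set.range x) = ⊤) (hind : AlgebraicIndependent k x) :
      HasUniformExtAnn R := by
    have e : MvPolynomial (Fin n) k ≃ₐ[k] R :=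
      (hind.aevalEquiv.trans (Subalgebra.equivOfEq _ _ hx)).trans Subalgebra.topEquiv
    exact ((GlobalDimensionLT.mvPolynomial k n).of_ringEquiv e.toRingEquiv).hasUniformExtAnn
  induction n with
  | zero =>
    intro R _ _ _ x hx
    exact hfree 0 R x hx
      (algebraicIndependent_empty_type_iff.2 (FaithfulSMul.algebraMap_injective k R))
  | succ m ih =>
    intro R _ _ _ x hx
    by_cases hind : AlgebraicIndependent k x
    · exact hfree _ R x hx hind
    obtain ⟨y, z, g, hz, htop, hg, hg'⟩ := exists_separable_normalization x hx hind
    let S := Algebra.adjoin k (Set.range y)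
    have hS : HasUniformExtAnn S := by
      refine ih S (fun l ↦ ⟨y l, Algebra.subset_adjoin ⟨l, rfl⟩⟩) ?_
      rw [← Algebra.adjoin_adjoin_coe_preimage (R := k) (s := Set.range y)]
      congr 1
      ext w
      simp [Subtype.ext_iff]
    have : Module.Finite S R := by
      have := Algebra.finite_adjoin_simple_of_isIntegral hz
      rw [htop] at this
      exact Module.Finite.equiv (Subalgebra.topEquiv (R := S) (A := R)).toLinearEquiv
    exact HasUniformExtAnn.of_adjoin_eq_top htop hg hg' hS

theorem HasUniformExtAnn.of_finiteType (k : Type) [Field k] [PerfectField k] (R : Type)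
    [CommRing R] [IsDomain R] [Algebra k R] [Algebra.FiniteType k R] : HasUniformExtAnn R := by
  obtain ⟨n, φ, hφ⟩ := (Algebra.FiniteType.iff_quotient_mvPolynomial'' (R := k) (S := R)).1
    inferInstance
  refine HasUniformExtAnn.of_adjoin_range_eq_top (k := k) n R (fun i ↦ φ (X i)) ?_
  rw [Algebra.adjoin_range_eq_range_aeval, AlgHom.range_eq_top]
  rwa [show (aeval fun i ↦ φ (X i)) = φ from (MvPolynomial.aeval_unique φ).symm]

end FiniteTypeDomain

/-- **Rouquier**: for a finitely generated commutative algebra `A` over a perfect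
field `k`, the bounded derived category `D^b(mod A)` has finite dimension. -/
theorem dim_Db_lt_top_of_finiteType (k : Type) [Field k] [PerfectField k]
    (A : Type) [CommRing A] [Algebra k A] [Algebra.FiniteType k A] :
    trdim _ (Db A) < (⊤ : ℕ∞) := by
  have := Algebra.FiniteType.isNoetherianRing k A
  exact trdim_Db_lt_top_of_forall_isPrime fun I _ ↦ HasUniformExtAnn.of_finiteType k (A ⧸ I)
end
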